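/- arXiv:0710.5142 — 6 statements merged into one kernel-verified Lean document; each statement's English description precedes it below -/
import Mathlib

section
/- For n ≥ 3 taxa, any dissimilarity map d, any real coefficients t_1, …, t_n, and any pair of distinct taxa b, c, one has q_{bc}(d + Σ_a t_a·s_a) = q_{bc}(d) − 2·Σ_a t_a. In particular, adding a linear combination of shift vectors to d does not change any difference q_{bc}(d) − q_{b'c'}(d) of Q-criteria, so the relative order of the Q-criteria is unchanged. -/
/-- The Q-criterion of a dissimilarity map `d` on `n` taxa at the pair `(b, c)`:
`q_{bc}(d) = (n-2) d_{bc} - Σ_k d_{bk} - Σ_k d_{kc}`. -/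
def qCriterion (n : ℕ) (d : Fin n → Fin n → ℝ) (b c : Fin n) : ℝ :=
  ((n : ℝ) - 2) * d b c - (∑ k, d b k) - ∑ k, d k c

/-- The shift vector of taxon `a`: the dissimilarity map in which `a` is at distance 1
from all other taxa and all other distances are 0. -/
def shiftVector (n : ℕ) (a : Fin n) : Fin n → Fin n → ℝ :=
  fun i j => if i ≠ j ∧ (i = a ∨ j = a) then 1 else 0

theorem shift_sum_aux (n : ℕ) (t : Fin n → ℝ) (i j : Fin n) :
    ∑ a, t a * shiftVector n a i j = t i + t j - if i = j then 2 * t i else 0 := by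
  unfold shiftVector
  by_cases h : i = j
  · subst h
    simp
    ring
  · have : ∀ a, t a * (if i ≠ j ∧ (i = a ∨ j = a) then (1 : ℝ) else 0)
        = (if i = a then t a else 0) + (if j = a then t a else 0) := by
      intro a
      by_cases h1 : i = a <;> by_cases h2 : j = a <;> simp_all
    simp only [this, Finset.sum_add_distrib]
    simp [h]

theorem qCriterion_shift_aux (n : ℕ) (d : Fin n → Fin n → ℝ)
    (t : Fin n → ℝ) (b c : Fin n) (hbc : b ≠ c) :
    qCriterion n (fun i j => d i j + ∑ a, t a * shiftVector n a i j) b c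
      = qCriterion n d b c - 2 * ∑ a, t a := by
  unfold qCriterion
  simp only [shift_sum_aux, Finset.sum_add_distrib, Finset.sum_sub_distrib]
  simp [hbc]
  ring

/-- For `n ≥ 3` taxa, any dissimilarity map `d` (symmetric with zero diagonal), any real
coefficients `t`, and any pair of distinct taxa `b ≠ c`, we have
`q_{bc}(d + Σ_a t_a s_a) = q_{bc}(d) - 2 Σ_a t_a`.  In particular, differences of
Q-criteria are unchanged by adding a linear combination of shift vectors,
so the relative order of the Q-criteria is unchanged. -/
theorem qCriterion_add_shift (n : ℕ) (hn : 3 ≤ n) (d : Fin n → Fin n → ℝ)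
    (hsym : ∀ i j, d i j = d j i) (hdiag : ∀ i, d i i = 0)
    (t : Fin n → ℝ) (b c : Fin n) (hbc : b ≠ c) :
    qCriterion n (fun i j => d i j + ∑ a, t a * shiftVector n a i j) b c
      = qCriterion n d b c - 2 * ∑ a, t a ∧
    ∀ b' c' : Fin n, b' ≠ c' →
      qCriterion n (fun i j => d i j + ∑ a, t a * shiftVector n a i j) b c
        - qCriterion n (fun i j => d i j + ∑ a, t a * shiftVector n a i j) b' c'
      = qCriterion n d b c - qCriterion n d b' c' := by
  refine ⟨qCriterion_shift_aux n d t b c hbc, ?_⟩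
  intro b' c' h
  rw [qCriterion_shift_aux n d t b c hbc, qCriterion_shift_aux n d t b' c' h]
  ring
end

section
/- Let n ≥ 4 and let a ≠ b be two taxa that are merged into a new node z, so that a dissimilarity map d on the n taxa is reduced to the dissimilarity map red(d) on the taxon set ({1,…,n}∖{a,b}) ∪ {z} given by red(d)_{zk} = (d_{ak} + d_{bk} − d_{ab})/2 for k ∉ {a,b} and red(d)_{jk} = d_{jk} for j, k ∉ {a,b}. Then: (i) for any taxon c ∉ {a,b}, the reduction red(s_c) of the shift vector s_c equals the shift vector of c on the reduced taxon set; and (ii) the reductions red(s_a) and red(s_b) are the zero dissimilarity map. Hence the reduction of any linear combination of shift vectors is again a linear combination of shift vectors. -/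
/-- The shift vector of a taxon `a` in an arbitrary (decidable) taxon set:
`(s_a)_{ij} = 1` if `i ≠ j` and `a ∈ {i, j}`, and `0` otherwise. -/
def shiftOn {τ : Type*} [DecidableEq τ] (a : τ) : τ → τ → ℝ :=
  fun i j => if i ≠ j ∧ (i = a ∨ j = a) then 1 else 0

/-- The reduction of a dissimilarity map `d` on `{1,…,n}` after merging taxa `a ≠ b`
into a new node `z`.  The reduced taxon set is modelled as
`Option {k : Fin n // k ≠ a ∧ k ≠ b}`, with `none` playing the role of `z`:
`red(d)_{zk} = (d_{ak} + d_{bk} - d_{ab})/2` and `red(d)_{jk} = d_{jk}` for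
`j, k ∉ {a, b}`. -/
noncomputable def reduce (n : ℕ) (a b : Fin n) (d : Fin n → Fin n → ℝ) :
    Option {k : Fin n // k ≠ a ∧ k ≠ b} → Option {k : Fin n // k ≠ a ∧ k ≠ b} → ℝ
  | some j, some k => d j.1 k.1
  | none, some k => (d a k.1 + d b k.1 - d a b) / 2
  | some j, none => (d j.1 a + d j.1 b - d a b) / 2
  | none, none => 0

theorem reduce_sum_aux (n : ℕ) (a b : Fin n) (t : Fin n → ℝ)
    (p q : Option {k : Fin n // k ≠ a ∧ k ≠ b}) :
    reduce n a b (fun i j => ∑ m, t m * shiftOn m i j) p q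
      = ∑ m, t m * reduce n a b (shiftOn m) p q := by
  rcases p with _ | p <;> rcases q with _ | q <;>
    simp only [reduce, mul_zero, Finset.sum_const_zero, ← Finset.sum_add_distrib,
      ← Finset.sum_sub_distrib, Finset.sum_div] <;>
    exact Finset.sum_congr rfl fun m _ => by ring

/-- After merging two taxa `a ≠ b` into a node `z`:
(i) for any taxon `c ∉ {a,b}`, the reduction of the shift vector `s_c` is the shift
vector of `c` on the reduced taxon set;
(ii) the reductions of `s_a` and of `s_b` are the zero dissimilarity map; and hence
(iii) the reduction of any linear combination of shift vectors is again a linear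
combination of shift vectors. -/
theorem reduce_shift (n : ℕ) (hn : 4 ≤ n) (a b : Fin n) (hab : a ≠ b) :
    (∀ (c : Fin n) (hca : c ≠ a) (hcb : c ≠ b),
      reduce n a b (shiftOn c) = shiftOn (some ⟨c, hca, hcb⟩)) ∧
    (reduce n a b (shiftOn a) = fun _ _ => 0) ∧
    (reduce n a b (shiftOn b) = fun _ _ => 0) ∧
    (∀ t : Fin n → ℝ, ∃ u : Option {k : Fin n // k ≠ a ∧ k ≠ b} → ℝ,
      reduce n a b (fun i j => ∑ m, t m * shiftOn m i j)
        = fun p q => ∑ m, u m * shiftOn m p q) := by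
  have h1 : ∀ (c : Fin n) (hca : c ≠ a) (hcb : c ≠ b),
      reduce n a b (shiftOn c) = shiftOn (some ⟨c, hca, hcb⟩) := by
    intro c hca hcb
    funext p q
    rcases p with _ | ⟨p, hp⟩ <;> rcases q with _ | ⟨q, hq⟩ <;>
      simp only [reduce, shiftOn, ne_eq, Option.some.injEq, Subtype.mk.injEq, reduceCtorEq] <;>
      grind
  have h2 : reduce n a b (shiftOn a) = fun _ _ => 0 := by
    funext p q
    rcases p with _ | ⟨p, hp⟩ <;> rcases q with _ | ⟨q, hq⟩ <;>
      simp only [reduce, shiftOn] <;> grind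
  have h3 : reduce n a b (shiftOn b) = fun _ _ => 0 := by
    funext p q
    rcases p with _ | ⟨p, hp⟩ <;> rcases q with _ | ⟨q, hq⟩ <;>
      simp only [reduce, shiftOn] <;> grind
  refine ⟨h1, h2, h3, fun t => ⟨fun m => m.elim 0 (fun k => t k.1), ?_⟩⟩
  funext p q
  rw [reduce_sum_aux, Fintype.sum_option]
  simp only [Option.elim, zero_mul, zero_add]
  have h4 : ∀ k : {k : Fin n // k ≠ a ∧ k ≠ b},
      t k.1 * shiftOn (some k) p q = t k.1 * reduce n a b (shiftOn k.1) p q := by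
    rintro ⟨k, hka, hkb⟩
    rw [h1 k hka hkb]
  rw [Finset.sum_congr rfl fun k _ => h4 k]
  rw [← Finset.sum_subtype (Finset.univ.filter fun k : Fin n => k ≠ a ∧ k ≠ b)
    (by simp) (fun k => t k * reduce n a b (shiftOn k) p q)]
  symm
  apply Finset.sum_subset (Finset.subset_univ _)
  intro k _ hk
  by_cases ha : k = a
  · subst ha; simp [h2]
  · by_cases hb : k = b
    · subst hb; simp [h3]
    · exact absurd (by simp [ha, hb]) hk
end

section
/- Let T be a phylogenetic tree on leaf set {1,…,n} with n ≥ 2. Then for every leaf a, the sum over all other leaves b of λ_{ab} equals 1; that is, Σ_{b ≠ a} Π_{v ∈ p_{ab}} 1/(deg(v)−1) = 1. Equivalently, the dot product of the BME vector v_T with any shift vector s_a equals 1. -/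
open SimpleGraph in
/-- Existence of a parent function on a rooted finite tree, together with its basic properties. -/
theorem exists_parent_aux {V : Type*} [Fintype V] [DecidableEq V] (G : SimpleGraph V)
    [DecidableRel G.Adj] (hT : G.IsTree) (r : V) (w : V → ℝ) :
    ∃ (par : V → V) (F : V → ℝ),
      (∀ v (p : G.Walk r v), p.IsPath → (p.support.map w).prod = F v) ∧
      F r = w r ∧
      (∀ v, v ≠ r → F v = F (par v) * w v) ∧
      (∀ v, v ≠ r → G.Adj v (par v)) ∧ par r = r ∧
      (∀ v, Finset.univ.filter (fun c => c ≠ r ∧ par c = v)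
        = (G.neighborFinset v).erase (par v)) := by
  have hA := hT.isAcyclic
  choose Q hQ hQu using fun v => hT.existsUnique_path r v
  have hQu' : ∀ v (p : G.Walk r v), p.IsPath → p = Q v := fun v p hp => hQu v p hp
  have hr : Q r = Walk.nil := (hQu' r Walk.nil (by simp)).symm
  have hnil : ∀ v, v ≠ r → ¬ (Q v).Nil := fun v hv h => hv h.eq.symm
  have hadj : ∀ v, v ≠ r → G.Adj (Q v).penultimate v := fun v hv =>
    Walk.adj_penultimate (hnil v hv)
  have hcat : ∀ v (hv : v ≠ r), Q v = (Q (Q v).penultimate).concat (hadj v hv) := fun v hv =>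
    hA.path_concat (hQ _) (hQ v) (hadj v hv) (Walk.getVert_mem_support _ _)
  refine ⟨fun v => (Q v).penultimate, fun v => ((Q v).support.map w).prod, ?_, ?_, ?_, ?_, ?_, ?_⟩
  · intro v p hp
    rw [hQu' v p hp]
  · simp [hr]
  · intro v hv
    beta_reduce
    conv_lhs => rw [hcat v hv]
    simp [Walk.support_concat]
  · exact fun v hv => (hadj v hv).symm
  · simp [hr]
  · intro v
    ext c
    simp only [Finset.mem_filter, Finset.mem_univ, true_and, Finset.mem_erase,
      mem_neighborFinset]
    constructor
    · rintro ⟨hc, rfl⟩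
      refine ⟨fun h => ?_, hadj c hc⟩
      have h1 := hQ c
      rw [hcat c hc, Walk.concat_isPath_iff] at h1
      apply h1.2
      have h2 : (Q (Q c).penultimate).penultimate ∈ (Q (Q c).penultimate).support :=
        Walk.getVert_mem_support _ _
      rwa [← h] at h2
    · rintro ⟨hne, hvc⟩
      have hns : c ∉ (Q v).support := fun h =>
        hne (hA.eq_penultimate_of_adj_end (hQ v) hvc h)
      have h1 := hQu' c _ ((hQ v).concat hns hvc)
      refine ⟨fun h => hns (by rw [h]; exact Walk.start_mem_support _), ?_⟩
      rw [← h1, Walk.penultimate_concat]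

/-- Let `T` be a phylogenetic tree on leaf set `{1,…,n}`, `n ≥ 2`: a finite tree whose
degree-1 vertices are labeled bijectively by `Fin n` and all of whose internal
(non-leaf) vertices have degree at least 3.  Then for every leaf `a`, the sum over all
other leaves `b` of `λ_{ab} = Π_{v ∈ p_{ab}} 1/(deg(v)-1)` equals `1`, where `p_{ab}`
is the set of internal vertices on the unique path in `T` from `a` to `b`.
(The product is taken over the support of the path, with leaves contributing a factor 1.)
Equivalently, the dot product of the BME vector `v_T` with any shift vector equals 1. -/
theorem sum_bme_coeff_eq_one {V : Type*} [Fintype V] [DecidableEq V] (G : SimpleGraph V)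
    [DecidableRel G.Adj] (hT : G.IsTree) (n : ℕ) (hn : 2 ≤ n)
    (leaf : Fin n → V) (hinj : Function.Injective leaf)
    (hleafdeg : ∀ i, G.degree (leaf i) = 1)
    (hleafall : ∀ v, G.degree v = 1 → ∃ i, leaf i = v)
    (hintdeg : ∀ v, (∀ i, leaf i ≠ v) → 3 ≤ G.degree v)
    (P : ∀ a b : Fin n, G.Walk (leaf a) (leaf b))
    (hP : ∀ a b, (P a b).IsPath) (a : Fin n) :
    ∑ b ∈ Finset.univ.filter (fun b => b ≠ a),
      ((P a b).support.map
        (fun v => if ∀ i, leaf i ≠ v then ((G.degree v : ℝ) - 1)⁻¹ else 1)).prod = 1 := by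
  classical
  set w : V → ℝ := fun v => if ∀ i, leaf i ≠ v then ((G.degree v : ℝ) - 1)⁻¹ else 1 with hw
  obtain ⟨par, F, hF, hFr, hFpar, hadj, hparr, hch⟩ := exists_parent_aux G hT (leaf a) w
  have hwleaf : ∀ i, w (leaf i) = 1 := fun i => by
    simp only [hw]
    rw [if_neg]
    push Not
    exact ⟨i, rfl⟩
  have hsum : ∑ c ∈ Finset.univ.filter (fun c => c ≠ leaf a), F (par c)
      = ∑ v, (((G.neighborFinset v).erase (par v)).card : ℝ) * F v := by
    rw [← Finset.sum_fiberwise (Finset.univ.filter (fun c => c ≠ leaf a)) par]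
    refine Finset.sum_congr rfl fun v _ => ?_
    rw [← hch v, Finset.filter_filter, ← nsmul_eq_mul, ← Finset.sum_const]
    refine Finset.sum_congr rfl fun c hc => ?_
    rw [(Finset.mem_filter.mp hc).2.2]
  have hroot : (((G.neighborFinset (leaf a)).erase (par (leaf a))).card : ℝ) * F (leaf a) = 1 := by
    rw [hparr, Finset.erase_eq_of_notMem (by simp), SimpleGraph.card_neighborFinset_eq_degree,
      hleafdeg, hFr, hwleaf]
    simp
  have hother : ∀ v, v ≠ leaf a → (((G.neighborFinset v).erase (par v)).card : ℝ) * F v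
      = if ∀ i, leaf i ≠ v then F (par v) else 0 := by
    intro v hv
    rw [Finset.card_erase_of_mem (by simpa using hadj v hv),
      SimpleGraph.card_neighborFinset_eq_degree]
    split_ifs with h
    · have h3 := hintdeg v h
      have h3' : (3 : ℝ) ≤ G.degree v := by exact_mod_cast h3
      have hwv : w v = ((G.degree v : ℝ) - 1)⁻¹ := if_pos h
      rw [hFpar v hv, hwv, Nat.cast_sub (by omega), Nat.cast_one]
      have : (G.degree v : ℝ) - 1 ≠ 0 := by linarith
      field_simp
    · push Not at h
      obtain ⟨i, rfl⟩ := h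
      simp [hleafdeg]
  have hsplit : ∑ v, (((G.neighborFinset v).erase (par v)).card : ℝ) * F v
      = 1 + ∑ v ∈ Finset.univ.filter (fun c => c ≠ leaf a),
          if ∀ i, leaf i ≠ v then F (par v) else 0 := by
    rw [← Finset.add_sum_erase _ _ (Finset.mem_univ (leaf a)), hroot, Finset.filter_ne']
    congr 1
    exact Finset.sum_congr rfl fun v hv => hother v (Finset.ne_of_mem_erase hv)
  have hfin : ∑ v ∈ Finset.univ.filter (fun c => c ≠ leaf a),
      (if ∀ i, leaf i ≠ v then 0 else F (par v)) = 1 := by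
    have h1 := hsum.trans hsplit
    rw [← sub_eq_iff_eq_add, ← Finset.sum_sub_distrib] at h1
    rw [← h1]
    refine Finset.sum_congr rfl fun v _ => ?_
    split_ifs <;> simp
  rw [← hfin]
  have himg : ∑ v ∈ (Finset.univ.filter (fun b => b ≠ a)).image leaf,
      (if ∀ i, leaf i ≠ v then 0 else F (par v))
      = ∑ v ∈ Finset.univ.filter (fun c => c ≠ leaf a),
      (if ∀ i, leaf i ≠ v then 0 else F (par v)) := by
    refine Finset.sum_subset ?_ ?_
    · intro v hv
      simp only [Finset.mem_image, Finset.mem_filter, Finset.mem_univ, true_and] at hv ⊢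
      obtain ⟨b, hb, rfl⟩ := hv
      exact fun h => hb (hinj h)
    · intro v hv hv'
      rw [if_pos]
      rintro i rfl
      simp only [Finset.mem_image, Finset.mem_filter, Finset.mem_univ, true_and] at hv hv'
      exact hv' ⟨i, fun h => hv (h ▸ rfl), rfl⟩
  rw [← himg, Finset.sum_image (fun x _ y _ h => hinj h)]
  refine Finset.sum_congr rfl fun b hb => ?_
  have hba : leaf b ≠ leaf a := fun h => (Finset.mem_filter.mp hb).2 (hinj h)
  rw [if_neg (by push Not; exact ⟨b, rfl⟩), hF _ _ (hP a b), hFpar _ hba, hwleaf, mul_one]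
end

section
/- For n ≥ 4, the set of extreme points of the BME polytope on n leaves is exactly the set of BME vectors of binary phylogenetic trees on leaf set {1,…,n}: every BME vector of a binary tree is an extreme point of the BME polytope, and every extreme point of the BME polytope is the BME vector of some binary tree. -/
/-- A phylogenetic tree on leaf set `{1,…,n}`: a finite tree (connected acyclic simple
graph) whose degree-1 vertices (leaves) are labeled bijectively by `Fin n` and all of
whose non-leaf (internal) vertices have degree at least 3.  Degrees are expressed via
`(G.neighborSet v).ncard`. -/
structure PhyloTree (n : ℕ) where
  V : Type
  fin : Fintype V
  G : SimpleGraph V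
  tree : G.IsTree
  leaf : Fin n → V
  inj : Function.Injective leaf
  leafDeg : ∀ i, (G.neighborSet (leaf i)).ncard = 1
  leafAll : ∀ v, (G.neighborSet v).ncard = 1 → ∃ i, leaf i = v
  internalDeg : ∀ v, (∀ i, leaf i ≠ v) → 3 ≤ (G.neighborSet v).ncard

/-- A phylogenetic tree is binary if every internal vertex has degree exactly 3. -/
def PhyloTree.IsBinary {n : ℕ} (T : PhyloTree n) : Prop :=
  ∀ v, (∀ i, T.leaf i ≠ v) → (T.G.neighborSet v).ncard = 3

/-- A phylogenetic tree is the star tree if it has exactly one internal vertex. -/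
def PhyloTree.IsStar {n : ℕ} (T : PhyloTree n) : Prop :=
  ∃! v : T.V, ∀ i, T.leaf i ≠ v

open Classical in
/-- The BME coefficient `λ_{ab} = Π_{v ∈ p_{ab}} 1/(deg v - 1)` of a pair of leaves
`a, b`, the product being over the internal vertices on the unique path from `a` to `b`
(leaves on the path contribute a factor 1). -/
noncomputable def PhyloTree.lam {n : ℕ} (T : PhyloTree n) (a b : Fin n) : ℝ :=
  ((T.tree.existsUnique_path (T.leaf a) (T.leaf b)).choose.support.map
    (fun v => if ∀ i, T.leaf i ≠ v then (((T.G.neighborSet v).ncard : ℝ) - 1)⁻¹ else 1)).prod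

/-- The index set of unordered pairs of leaves, encoded as ordered pairs `(a, b)` with
`a < b`; there are `n(n-1)/2` of them. -/
abbrev LeafPairs (n : ℕ) := {p : Fin n × Fin n // p.1 < p.2}

/-- The BME vector `v_T = (λ_{ab}) ∈ ℝ^{n(n-1)/2}` of a phylogenetic tree. -/
noncomputable def PhyloTree.bmeVec {n : ℕ} (T : PhyloTree n) : LeafPairs n → ℝ :=
  fun p => T.lam p.1.1 p.1.2

/-- The BME polytope: the convex hull of the BME vectors of all phylogenetic trees
on leaf set `{1,…,n}`. -/
noncomputable def bmePolytope (n : ℕ) : Set (LeafPairs n → ℝ) :=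
  convexHull ℝ {x | ∃ T : PhyloTree n, T.bmeVec = x}



namespace BME

section TreePath

variable {V : Type} {G : SimpleGraph V}

/-- The vertex list of the unique path between two vertices of a tree. -/
noncomputable def tp (hG : G.IsTree) (u z : V) : List V :=
  (hG.existsUnique_path u z).choose.support

variable (hG : G.IsTree)

theorem tp_chain (u z : V) : (tp hG u z).IsChain G.Adj :=
  (hG.existsUnique_path u z).choose.isChain_adj_support

theorem tp_nodup (u z : V) : (tp hG u z).Nodup :=
  (hG.existsUnique_path u z).choose_spec.1.support_nodup

theorem tp_head (u z : V) : (tp hG u z).head? = some u := by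
  unfold tp
  rw [List.head?_eq_some_head (SimpleGraph.Walk.support_ne_nil _)]
  simp

theorem tp_last (u z : V) : (tp hG u z).getLast? = some z := by
  unfold tp
  rw [List.getLast?_eq_some_getLast (SimpleGraph.Walk.support_ne_nil _)]
  simp

theorem exists_walk {u z : V} {l : List V} (hc : l.IsChain G.Adj) (hh : l.head? = some u)
    (hl : l.getLast? = some z) : ∃ p : G.Walk u z, p.support = l := by
  have hne : l ≠ [] := by rintro rfl; simp at hh
  have h1 : l.head hne = u := by
    rw [List.head?_eq_some_head hne] at hh; exact Option.some.inj hh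
  have h2 : l.getLast hne = z := by
    rw [List.getLast?_eq_some_getLast hne] at hl; exact Option.some.inj hl
  subst h1 h2
  exact ⟨SimpleGraph.Walk.ofSupport l hne hc, SimpleGraph.Walk.support_ofSupport hne hc⟩

theorem tp_unique {u z : V} {l : List V} (hc : l.IsChain G.Adj) (hh : l.head? = some u)
    (hl : l.getLast? = some z) (hn : l.Nodup) : tp hG u z = l := by
  obtain ⟨p, rfl⟩ := exists_walk hc hh hl
  have hp : p.IsPath := (SimpleGraph.Walk.isPath_def p).2 hn
  unfold tp
  rw [(hG.existsUnique_path u z).unique (hG.existsUnique_path u z).choose_spec.1 hp]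

theorem tp_subset {u z : V} {l : List V} (hc : l.IsChain G.Adj) (hh : l.head? = some u)
    (hl : l.getLast? = some z) : tp hG u z ⊆ l := by
  classical
  obtain ⟨p, rfl⟩ := exists_walk hc hh hl
  unfold tp
  rw [(hG.existsUnique_path u z).unique (hG.existsUnique_path u z).choose_spec.1 p.bypass_isPath]
  exact p.support_bypass_subset_support

theorem tp_self (u : V) : tp hG u u = [u] := tp_unique hG (by simp) (by simp) (by simp) (by simp)

theorem tp_eq_cons (u z : V) : ∃ t, tp hG u z = u :: t := by
  have := tp_head hG u z
  cases h : tp hG u z with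
  | nil => simp [h] at this
  | cons a t => simp [h] at this; exact ⟨t, by rw [this]⟩

theorem mem_tp_left (u z : V) : u ∈ tp hG u z := List.mem_of_head? (tp_head hG u z)

theorem mem_tp_right (u z : V) : z ∈ tp hG u z := List.mem_of_getLast? (tp_last hG u z)

theorem tp_cons {u w z : V} (h : G.Adj u w) (hu : u ∉ tp hG w z) :
    tp hG u z = u :: tp hG w z := by
  obtain ⟨t, ht⟩ := tp_eq_cons hG w z
  have hc := tp_chain hG w z
  have hn := tp_nodup hG w z
  have hl := tp_last hG w z
  apply tp_unique hG
  · rw [ht] at hc ⊢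
    exact List.IsChain.cons_cons h hc
  · simp
  · rw [ht] at hl ⊢
    simpa [List.getLast?_cons] using hl
  · exact List.nodup_cons.2 ⟨hu, hn⟩

theorem exists_next {u z : V} (h : u ≠ z) : ∃ w, G.Adj u w ∧ u ∉ tp hG w z := by
  obtain ⟨t, ht⟩ := tp_eq_cons hG u z
  have hc := tp_chain hG u z
  have hn := tp_nodup hG u z
  have hl := tp_last hG u z
  cases t with
  | nil => rw [ht] at hl; simp at hl; exact absurd hl h
  | cons w t =>
    rw [ht] at hc hn hl
    refine ⟨w, hc.rel, ?_⟩
    have : tp hG w z = w :: t := by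
      apply tp_unique hG hc.of_cons (by simp) _ hn.of_cons
      simpa [List.getLast?_cons] using hl
    rw [this]
    exact (List.nodup_cons.1 hn).1

theorem next_unique {u w w' z : V} (h : G.Adj u w) (h' : G.Adj u w') (hu : u ∉ tp hG w z)
    (hu' : u ∉ tp hG w' z) : w = w' := by
  have h1 := tp_cons hG h hu
  rw [tp_cons hG h' hu'] at h1
  have h2 := tp_head hG w z
  rw [← (List.cons.inj h1).2, tp_head] at h2
  exact (Option.some.inj h2).symm

theorem tp_prefix {x y a : V} (h : y ∈ tp hG x a) : tp hG x y ⊆ tp hG x a := by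
  obtain ⟨l1, l2, hl⟩ := List.append_of_mem h
  have hc := tp_chain hG x a
  have hh := tp_head hG x a
  have e : l1 ++ y :: l2 = (l1 ++ [y]) ++ l2 := by simp
  have : tp hG x y ⊆ l1 ++ [y] := by
    apply tp_subset hG
    · rw [hl, e] at hc; exact hc.left_of_append
    · rw [hl] at hh
      cases l1 <;> simpa using hh
    · simp
  rw [hl, e]
  exact fun z hz => List.mem_append_left _ (this hz)

theorem chain_reverse {l : List V} (h : l.IsChain G.Adj) : l.reverse.IsChain G.Adj := by
  rw [List.isChain_reverse]
  exact h.imp fun _ _ h => h.symm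

theorem tp_reverse (u z : V) : tp hG z u = (tp hG u z).reverse := by
  apply tp_unique hG
  · exact chain_reverse (tp_chain hG u z)
  · simp [tp_last]
  · simp [tp_head]
  · simpa using tp_nodup hG u z

theorem tp_cross {v x y a b : V} (hx : G.Adj v x) (hy : G.Adj v y) (hxy : x ≠ y)
    (ha : v ∉ tp hG x a) (hb : v ∉ tp hG y b) :
    tp hG a b = (tp hG x a).reverse ++ v :: tp hG y b := by
  apply tp_unique hG
  · rw [List.isChain_append]
    refine ⟨chain_reverse (tp_chain hG x a), ?_, ?_⟩
    · rw [← tp_cons hG hy hb]; exact tp_chain _ _ _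
    · intro p hp q hq
      simp [tp_head] at hp hq
      subst hp hq
      exact hx.symm
  · simp [tp_last]
  · have := tp_last hG v b
    rw [tp_cons hG hy hb] at this
    simp [this]
  · rw [List.nodup_append]
    refine ⟨by simpa using tp_nodup hG x a, ?_, ?_⟩
    · rw [← tp_cons hG hy hb]; exact tp_nodup _ _ _
    · rintro p hp q hq rfl
      simp at hp hq
      rcases hq with rfl | hq
      · exact ha hp
      · exact hxy (next_unique hG hx hy (fun h => ha (tp_prefix hG hp h))
          (fun h => hb (tp_prefix hG hq h)))

theorem tp_same {v x a b : V} (ha : v ∉ tp hG x a) (hb : v ∉ tp hG x b) : v ∉ tp hG a b := by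
  obtain ⟨s, hs⟩ := tp_eq_cons hG x a
  obtain ⟨t, ht⟩ := tp_eq_cons hG x b
  have : tp hG a b ⊆ (tp hG x a).reverse ++ t := by
    apply tp_subset hG
    · have e : (tp hG x a).reverse ++ t = s.reverse ++ (x :: t) := by rw [hs]; simp
      rw [List.isChain_append]
      refine ⟨chain_reverse (tp_chain hG x a), ?_, ?_⟩
      · have := tp_chain hG x b
        rw [ht] at this
        exact this.of_cons
      · intro p hp q hq
        simp [tp_head] at hp
        subst hp
        have := tp_chain hG x b
        rw [ht] at this
        cases t with
        | nil => simp at hq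
        | cons c t => simp at hq; subst hq; exact this.rel
    · simp [tp_last]
    · have := tp_last hG x b
      rw [ht] at this
      rw [hs]
      simpa [List.getLast?_append, List.getLast?_cons] using this
  intro h
  have h2 := this h
  simp at h2
  rcases h2 with h2 | h2
  · exact ha h2
  · exact hb (by rw [ht]; exact List.mem_cons_of_mem _ h2)

theorem not_mem_step {u w x z : V} (huw : G.Adj u w) (hwx : G.Adj w x) (hxu : x ≠ u)
    (h : w ∉ tp hG x z) : u ∉ tp hG w z := by
  rw [tp_cons hG hwx h]
  intro hm
  rcases List.mem_cons.1 hm with e | hm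
  · exact huw.ne e
  · exact hxu (next_unique hG (z := u) hwx huw.symm (fun h' => h (tp_prefix hG hm h'))
      (by rw [tp_self]; simpa using huw.ne.symm))

end TreePath



section Phylo

open Classical

variable {n : ℕ} (T : PhyloTree n)

noncomputable instance instFin : Fintype T.V := T.fin

/-- Degree of a vertex. -/
noncomputable def dg (v : T.V) : ℕ := (T.G.neighborSet v).ncard

/-- Neighbours of a vertex as a finset. -/
noncomputable def nb (v : T.V) : Finset T.V := Finset.univ.filter (fun w => T.G.Adj v w)

theorem mem_nb {v w : T.V} : w ∈ nb T v ↔ T.G.Adj v w := by simp [nb]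

theorem card_nb (v : T.V) : (nb T v).card = dg T v := by
  unfold dg
  rw [← Set.ncard_coe_finset]
  congr 1
  ext w
  simp [nb]

/-- The vertex weight. -/
noncomputable def wt (v : T.V) : ℝ :=
  if ∀ i, T.leaf i ≠ v then (((T.G.neighborSet v).ncard : ℝ) - 1)⁻¹ else 1

theorem wt_leaf (i : Fin n) : wt T (T.leaf i) = 1 := by
  unfold wt
  rw [if_neg]
  push Not
  exact ⟨i, rfl⟩

theorem wt_int {v : T.V} (h : ∀ i, T.leaf i ≠ v) : wt T v = ((dg T v : ℝ) - 1)⁻¹ := if_pos h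

theorem dg_int {v : T.V} (h : ∀ i, T.leaf i ≠ v) : 3 ≤ dg T v := T.internalDeg v h

theorem wt_pos (v : T.V) : 0 < wt T v := by
  by_cases h : ∀ i, T.leaf i ≠ v
  · rw [wt_int T h]
    have : (3 : ℝ) ≤ dg T v := by exact_mod_cast dg_int T h
    apply inv_pos.2
    linarith
  · push Not at h
    obtain ⟨i, rfl⟩ := h
    rw [wt_leaf]; exact one_pos

/-- Product of weights along a path. -/
noncomputable def pw (w z : T.V) : ℝ := ((tp T.tree w z).map (wt T)).prod

theorem pw_pos (w z : T.V) : 0 < pw T w z := by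
  unfold pw
  apply List.prod_pos
  intro a ha
  obtain ⟨v, -, rfl⟩ := List.mem_map.1 ha
  exact wt_pos T v

theorem lam_eq (a b : Fin n) : T.lam a b = pw T (T.leaf a) (T.leaf b) := rfl

theorem lam_eq_of_list {a b : Fin n} {l : List T.V} (hc : l.IsChain T.G.Adj)
    (hh : l.head? = some (T.leaf a)) (hl : l.getLast? = some (T.leaf b)) (hn : l.Nodup) :
    T.lam a b = (l.map (wt T)).prod := by
  rw [lam_eq, pw, tp_unique T.tree hc hh hl hn]

theorem lam_pos (a b : Fin n) : 0 < T.lam a b := pw_pos T _ _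

theorem pw_comm (w z : T.V) : pw T w z = pw T z w := by
  unfold pw
  rw [tp_reverse T.tree w z, List.map_reverse]
  exact (List.reverse_perm _).prod_eq.symm

theorem lam_comm (a b : Fin n) : T.lam a b = T.lam b a := pw_comm T _ _

theorem lam_self (a : Fin n) : T.lam a a = 1 := by
  rw [lam_eq, pw, tp_self]
  simp [wt_leaf]

theorem pw_cons {u w z : T.V} (h : T.G.Adj u w) (hu : u ∉ tp T.tree w z) :
    pw T u z = wt T u * pw T w z := by
  unfold pw
  rw [tp_cons T.tree h hu]
  simp

/-- Flow to leaf `b` through the dart from `u` to `w`. -/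
noncomputable def fl (u w : T.V) (b : Fin n) : ℝ :=
  if u ∉ tp T.tree w (T.leaf b) then pw T w (T.leaf b) else 0

theorem leaf_nb (i : Fin n) : ∃ w, nb T (T.leaf i) = {w} := by
  rw [← Finset.card_eq_one, card_nb]
  exact T.leafDeg i

theorem kraft_aux (k : ℕ) : ∀ u w : T.V, T.G.Adj u w →
    (Finset.univ.filter (fun z => u ∉ tp T.tree w z)).card = k → ∑ b, fl T u w b = 1 := by
  induction k using Nat.strong_induction_on with
  | _ k ih =>
  intro u w huw hk
  by_cases hw : ∀ i, T.leaf i ≠ w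
  · have key : ∀ b, fl T u w b = wt T w * ∑ x ∈ (nb T w).erase u, fl T w x b := by
      intro b
      obtain ⟨x0, hx0, hx0'⟩ := exists_next T.tree (hw b).symm
      by_cases hxu : x0 = u
      · have h0 : ∑ x ∈ (nb T w).erase u, fl T w x b = 0 := by
          apply Finset.sum_eq_zero
          intro x hx
          rw [Finset.mem_erase, mem_nb] at hx
          unfold fl
          rw [if_neg]
          intro h
          exact hx.1 ((next_unique T.tree hx.2 hx0 h hx0').trans hxu)
        rw [h0, mul_zero]
        unfold fl
        rw [if_neg]
        rw [tp_cons T.tree hx0 hx0', hxu]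
        intro h
        exact h (List.mem_cons_of_mem _ (mem_tp_left _ _ _))
      · rw [Finset.sum_eq_single x0]
        · unfold fl
          rw [if_pos hx0', if_pos (not_mem_step T.tree huw hx0 hxu hx0'), pw_cons T hx0 hx0']
        · intro x hx hne
          rw [Finset.mem_erase, mem_nb] at hx
          unfold fl
          rw [if_neg]
          intro h
          exact hne (next_unique T.tree hx.2 hx0 h hx0')
        · intro h
          exact absurd (Finset.mem_erase.2 ⟨hxu, (mem_nb T).2 hx0⟩) h
    rw [Finset.sum_congr rfl fun b _ => key b, ← Finset.mul_sum, Finset.sum_comm]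
    have h1 : ∀ x ∈ (nb T w).erase u, ∑ b, fl T w x b = 1 := by
      intro x hx
      rw [Finset.mem_erase, mem_nb] at hx
      refine ih _ ?_ w x hx.2 rfl
      rw [← hk]
      apply Finset.card_lt_card
      rw [Finset.ssubset_iff_of_subset]
      · refine ⟨w, ?_, ?_⟩
        · simp only [Finset.mem_filter, Finset.mem_univ, true_and, tp_self, List.mem_singleton]
          exact huw.ne
        · simp only [Finset.mem_filter, Finset.mem_univ, true_and, not_not]
          exact mem_tp_right _ _ _
      · intro z hz
        simp only [Finset.mem_filter, Finset.mem_univ, true_and] at hz ⊢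
        exact not_mem_step T.tree huw hx.2 hx.1 hz
    rw [Finset.sum_congr rfl h1, Finset.sum_const,
      Finset.card_erase_of_mem ((mem_nb T).2 huw.symm), card_nb, wt_int T hw]
    have h3 := dg_int T hw
    have h3' : (3 : ℝ) ≤ dg T w := by exact_mod_cast h3
    rw [nsmul_eq_mul, Nat.cast_sub (by omega)]
    push_cast
    rw [mul_one]
    exact inv_mul_cancel₀ (by linarith)
  · push Not at hw
    obtain ⟨i, rfl⟩ := hw
    obtain ⟨w', hw'⟩ := leaf_nb T i
    have hu : u = w' := by
      have := (mem_nb T).2 huw.symm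
      rw [hw'] at this
      simpa using this
    subst hu
    rw [Finset.sum_eq_single i]
    · unfold fl
      rw [if_pos]
      · simp [pw, tp_self, wt_leaf]
      · simp [tp_self, huw.ne]
    · intro b _ hb
      unfold fl
      rw [if_neg]
      obtain ⟨x, hx, hx'⟩ := exists_next T.tree (fun h => hb (T.inj h).symm : T.leaf i ≠ T.leaf b)
      have : x = u := by
        have := (mem_nb T).2 hx
        rw [hw'] at this
        simpa using this
      subst this
      rw [tp_cons T.tree hx hx']
      intro h
      exact h (List.mem_cons_of_mem _ (mem_tp_left _ _ _))
    · simp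

theorem kraft {u w : T.V} (h : T.G.Adj u w) : ∑ b, fl T u w b = 1 := kraft_aux T _ u w h rfl

theorem exists_leaf {u w : T.V} (h : T.G.Adj u w) : ∃ b, u ∉ tp T.tree w (T.leaf b) := by
  by_contra hc
  push Not at hc
  have := kraft T h
  rw [Finset.sum_eq_zero] at this
  · exact zero_ne_one this
  · intro b _
    unfold fl
    rw [if_neg]
    exact not_not.2 (hc b)

theorem row_sum (a : Fin n) : ∑ b, T.lam a b = 2 := by
  obtain ⟨w, hw⟩ := leaf_nb T a
  have hadj : T.G.Adj (T.leaf a) w := by rw [← mem_nb, hw]; simp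
  have key : ∀ b, T.lam a b = (if b = a then 1 else 0) + fl T (T.leaf a) w b := by
    intro b
    unfold fl
    by_cases hb : b = a
    · subst hb
      rw [if_pos rfl, lam_self, if_neg (not_not.2 (mem_tp_right _ _ _)), add_zero]
    · obtain ⟨x, hx, hx'⟩ := exists_next T.tree (fun h => hb (T.inj h).symm : T.leaf a ≠ T.leaf b)
      have : x = w := by
        have := (mem_nb T).2 hx
        rw [hw] at this
        simpa using this
      subst this
      rw [if_neg hb, if_pos hx', lam_eq, pw_cons T hx hx', wt_leaf]
      ring
  rw [Finset.sum_congr rfl fun b _ => key b, Finset.sum_add_distrib, kraft T hadj]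
  simp
  norm_num

theorem through_sum {v : T.V} (hv : ∀ i, T.leaf i ≠ v) :
    ∑ a, ∑ b, (if v ∈ tp T.tree (T.leaf a) (T.leaf b) then T.lam a b else 0) = dg T v := by
  have key : ∀ a b, (if v ∈ tp T.tree (T.leaf a) (T.leaf b) then T.lam a b else 0) =
      ∑ x ∈ nb T v, ∑ y ∈ nb T v, (if x ≠ y then wt T v * (fl T v x a * fl T v y b) else 0) := by
    intro a b
    obtain ⟨x0, hx0, hx0'⟩ := exists_next T.tree (hv a).symm
    obtain ⟨y0, hy0, hy0'⟩ := exists_next T.tree (hv b).symm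
    have fx : ∀ x ∈ nb T v, x ≠ x0 → fl T v x a = 0 := by
      intro x hx hne
      unfold fl
      rw [if_neg]
      intro h
      exact hne (next_unique T.tree ((mem_nb T).1 hx) hx0 h hx0')
    have fy : ∀ x ∈ nb T v, x ≠ y0 → fl T v x b = 0 := by
      intro x hx hne
      unfold fl
      rw [if_neg]
      intro h
      exact hne (next_unique T.tree ((mem_nb T).1 hx) hy0 h hy0')
    rw [Finset.sum_eq_single x0, Finset.sum_eq_single y0]
    · by_cases hxy : x0 = y0
      · rw [if_neg (not_not.2 hxy), if_neg]
        subst hxy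
        exact tp_same T.tree hx0' hy0'
      · have hc := tp_cross T.tree hx0 hy0 hxy hx0' hy0'
        rw [if_pos hxy, if_pos]
        · unfold fl
          rw [if_pos hx0', if_pos hy0', lam_eq]
          unfold pw
          rw [hc, List.map_append, List.prod_append, List.map_reverse,
            (List.reverse_perm _).prod_eq, List.map_cons, List.prod_cons]
          ring
        · rw [hc]; simp
    · intro y hy hne
      rw [fy y hy hne]; simp
    · intro h; exact absurd ((mem_nb T).2 hy0) h
    · intro x hx hne
      apply Finset.sum_eq_zero
      intro y _
      rw [fx x hx hne]; simp
    · intro h; exact absurd ((mem_nb T).2 hx0) h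
  have e1 : ∑ a, ∑ b, (if v ∈ tp T.tree (T.leaf a) (T.leaf b) then T.lam a b else 0) =
      ∑ x ∈ nb T v, ∑ y ∈ nb T v, (if x ≠ y then wt T v else 0) := by
    calc _ = ∑ a, ∑ b, ∑ x ∈ nb T v, ∑ y ∈ nb T v,
          (if x ≠ y then wt T v * (fl T v x a * fl T v y b) else 0) :=
          Finset.sum_congr rfl fun a _ => Finset.sum_congr rfl fun b _ => key a b
      _ = ∑ a, ∑ x ∈ nb T v, ∑ b, ∑ y ∈ nb T v,
          (if x ≠ y then wt T v * (fl T v x a * fl T v y b) else 0) :=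
          Finset.sum_congr rfl fun a _ => Finset.sum_comm
      _ = ∑ x ∈ nb T v, ∑ a, ∑ b, ∑ y ∈ nb T v,
          (if x ≠ y then wt T v * (fl T v x a * fl T v y b) else 0) := Finset.sum_comm
      _ = ∑ x ∈ nb T v, ∑ a, ∑ y ∈ nb T v, ∑ b,
          (if x ≠ y then wt T v * (fl T v x a * fl T v y b) else 0) :=
          Finset.sum_congr rfl fun a _ => Finset.sum_congr rfl fun b _ => Finset.sum_comm
      _ = ∑ x ∈ nb T v, ∑ y ∈ nb T v, ∑ a, ∑ b,
          (if x ≠ y then wt T v * (fl T v x a * fl T v y b) else 0) :=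
          Finset.sum_congr rfl fun a _ => Finset.sum_comm
      _ = _ := by
          refine Finset.sum_congr rfl fun x hx => Finset.sum_congr rfl fun y hy => ?_
          by_cases hxy : x = y
          · simp [hxy]
          · simp only [ne_eq, hxy, not_false_eq_true, if_true]
            rw [← mul_one (wt T v)]
            simp only [← Finset.mul_sum]
            rw [kraft T ((mem_nb T).1 hy)]
            simp only [mul_one]
            rw [kraft T ((mem_nb T).1 hx), mul_one]
  rw [e1]
  have e2 : ∀ x ∈ nb T v, ∑ y ∈ nb T v, (if x ≠ y then wt T v else 0) = 1 := by
    intro x hx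
    have h3' : (3 : ℝ) ≤ dg T v := by exact_mod_cast dg_int T hv
    have h3 := dg_int T hv
    rw [← Finset.sum_filter, Finset.sum_const, Finset.filter_ne, Finset.card_erase_of_mem hx,
      card_nb, wt_int T hv, nsmul_eq_mul, Nat.cast_sub (by omega)]
    push_cast
    exact mul_inv_cancel₀ (by linarith)
  rw [Finset.sum_congr rfl e2]
  simp [card_nb]



/-- Cost of a vertex: `log (deg - 1)` for internal vertices, zero for leaves. -/
noncomputable def cst (v : T.V) : ℝ :=
  if ∀ i, T.leaf i ≠ v then Real.log ((dg T v : ℝ) - 1) else 0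

theorem log_wt (v : T.V) : - Real.log (wt T v) = cst T v := by
  by_cases h : ∀ i, T.leaf i ≠ v
  · rw [wt_int T h, cst, if_pos h, Real.log_inv, neg_neg]
  · rw [cst, if_neg h, wt, if_neg h]; simp

theorem log_lam (a b : Fin n) : - Real.log (T.lam a b) =
    ∑ v, if v ∈ tp T.tree (T.leaf a) (T.leaf b) then cst T v else 0 := by
  rw [lam_eq, pw, ← List.prod_toFinset _ (tp_nodup _ _ _),
    Real.log_prod (fun v _ => (wt_pos T v).ne'), ← Finset.sum_neg_distrib,
    Finset.sum_congr rfl fun v _ => log_wt T v, ← Finset.sum_filter]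
  congr 1
  ext v
  simp

theorem entropy : ∑ a, ∑ b, T.lam a b * (- Real.log (T.lam a b)) =
    ∑ v, dg T v * cst T v := by
  have h1 : ∀ a b, T.lam a b * (- Real.log (T.lam a b)) = ∑ v,
      cst T v * (if v ∈ tp T.tree (T.leaf a) (T.leaf b) then T.lam a b else 0) := by
    intro a b
    rw [log_lam, Finset.mul_sum]
    refine Finset.sum_congr rfl fun v _ => ?_
    split_ifs <;> ring
  calc _ = ∑ a, ∑ b, ∑ v,
      cst T v * (if v ∈ tp T.tree (T.leaf a) (T.leaf b) then T.lam a b else 0) :=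
        Finset.sum_congr rfl fun a _ => Finset.sum_congr rfl fun b _ => h1 a b
    _ = ∑ a, ∑ v, ∑ b,
      cst T v * (if v ∈ tp T.tree (T.leaf a) (T.leaf b) then T.lam a b else 0) :=
        Finset.sum_congr rfl fun a _ => Finset.sum_comm
    _ = ∑ v, ∑ a, ∑ b,
      cst T v * (if v ∈ tp T.tree (T.leaf a) (T.leaf b) then T.lam a b else 0) :=
        Finset.sum_comm
    _ = _ := by
        refine Finset.sum_congr rfl fun v _ => ?_
        simp only [← Finset.mul_sum]
        by_cases h : ∀ i, T.leaf i ≠ v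
        · rw [through_sum T h, mul_comm]
        · simp [cst, if_neg h]

theorem dg_eq_degree (v : T.V) : dg T v = T.G.degree v := by
  rw [← card_nb, ← SimpleGraph.card_neighborFinset_eq_degree]
  congr 1
  ext w
  simp [nb]

theorem sum_dg : ∑ v, (dg T v : ℝ) = 2 * ((Fintype.card T.V : ℝ) - 1) := by
  have h1 := T.G.sum_degrees_eq_twice_card_edges
  have h2 := T.tree.card_edgeFinset
  have h3 : ∑ v, dg T v = 2 * T.G.edgeFinset.card := by
    rw [← h1]
    exact Finset.sum_congr rfl fun v _ => dg_eq_degree T v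
  rw [← Nat.cast_sum, h3]
  have h4 : (Fintype.card T.V : ℝ) = T.G.edgeFinset.card + 1 := by
    rw [← h2]; push_cast; rfl
  rw [h4]
  push_cast
  ring

theorem handshake : ∑ v, (if ∀ i, T.leaf i ≠ v then (dg T v : ℝ) - 2 else 0) = (n : ℝ) - 2 := by
  have h1 : ∀ v, (if ∀ i, T.leaf i ≠ v then (dg T v : ℝ) - 2 else 0) =
      ((dg T v : ℝ) - 2) + ∑ i, if T.leaf i = v then 1 else 0 := by
    intro v
    by_cases h : ∀ i, T.leaf i ≠ v
    · rw [if_pos h, Finset.sum_eq_zero, add_zero]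
      intro i _
      rw [if_neg (h i)]
    · rw [if_neg h]
      push Not at h
      obtain ⟨i, rfl⟩ := h
      rw [Finset.sum_eq_single i]
      · have : dg T (T.leaf i) = 1 := T.leafDeg i
        rw [this, if_pos rfl]
        norm_num
      · intro j _ hj
        rw [if_neg]
        exact fun h => hj (T.inj h)
      · simp
  rw [Finset.sum_congr rfl fun v _ => h1 v, Finset.sum_add_distrib, Finset.sum_sub_distrib,
    sum_dg, Finset.sum_comm]
  simp
  ring

theorem pow_ineq (d : ℕ) (hd : 3 ≤ d) : 8 ^ (d - 2) ≤ (d - 1) ^ d := by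
  obtain ⟨k, rfl⟩ := Nat.exists_eq_add_of_le hd
  rcases Nat.lt_or_ge k 6 with hk | hk
  · interval_cases k <;> norm_num
  · calc 8 ^ (3 + k - 2) ≤ 8 ^ (3 + k) := Nat.pow_le_pow_right (by norm_num) (by omega)
      _ ≤ (3 + k - 1) ^ (3 + k) := Nat.pow_le_pow_left (by omega) _

theorem log_ineq (d : ℕ) (hd : 3 ≤ d) :
    3 * Real.log 2 * ((d : ℝ) - 2) ≤ d * Real.log ((d : ℝ) - 1) := by
  have h1 : ((8 : ℝ) ^ (d - 2)) ≤ (((d - 1 : ℕ) : ℝ)) ^ d := by exact_mod_cast pow_ineq d hd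
  have h2 := Real.log_le_log (by positivity) h1
  rw [Real.log_pow, Real.log_pow, Nat.cast_sub (by omega), Nat.cast_sub (by omega)] at h2
  have h8 : Real.log 8 = 3 * Real.log 2 := by
    rw [show (8 : ℝ) = 2 ^ 3 by norm_num, Real.log_pow]; norm_num
  rw [h8] at h2
  push_cast at h2
  linarith

theorem entropy_ge : 3 * Real.log 2 * ((n : ℝ) - 2) ≤
    ∑ a, ∑ b, T.lam a b * (- Real.log (T.lam a b)) := by
  rw [entropy, ← handshake T, Finset.mul_sum]
  refine Finset.sum_le_sum fun v _ => ?_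
  unfold cst
  split_ifs with h
  · exact log_ineq _ (dg_int T h)
  · simp

theorem entropy_binary (hT : T.IsBinary) : 3 * Real.log 2 * ((n : ℝ) - 2) =
    ∑ a, ∑ b, T.lam a b * (- Real.log (T.lam a b)) := by
  rw [entropy, ← handshake T, Finset.mul_sum]
  refine Finset.sum_congr rfl fun v _ => ?_
  unfold cst
  split_ifs with h
  · have : dg T v = 3 := hT v h
    rw [this]
    norm_num
  · simp

theorem gibbs_term {p q : ℝ} (hp : 0 < p) (hq : 0 < q) :
    p * (- Real.log p) + (p - q) ≤ p * (- Real.log q) := by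
  have h := Real.log_le_sub_one_of_pos (div_pos hq hp)
  rw [Real.log_div hq.ne' hp.ne'] at h
  have h2 := mul_le_mul_of_nonneg_left h hp.le
  have h3 : p * (q / p - 1) = q - p := by field_simp
  rw [h3] at h2
  linarith

theorem gibbs_term_lt {p q : ℝ} (hp : 0 < p) (hq : 0 < q) (hne : p ≠ q) :
    p * (- Real.log p) + (p - q) < p * (- Real.log q) := by
  have h := Real.log_lt_sub_one_of_pos (div_pos hq hp)
    (fun h => hne ((div_eq_one_iff_eq hp.ne').1 h).symm)
  rw [Real.log_div hq.ne' hp.ne'] at h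
  have h2 := mul_lt_mul_of_pos_left h hp
  have h3 : p * (q / p - 1) = q - p := by field_simp
  rw [h3] at h2
  linarith

theorem cross_entropy_lt (T' : PhyloTree n) (hT : T.IsBinary) (hne : ∃ a b, T'.lam a b ≠ T.lam a b) :
    ∑ a, ∑ b, T.lam a b * (- Real.log (T.lam a b)) <
      ∑ a, ∑ b, T'.lam a b * (- Real.log (T.lam a b)) := by
  obtain ⟨a, b, hab⟩ := hne
  have h1 : ∑ a, ∑ b, (T'.lam a b * (- Real.log (T'.lam a b)) + (T'.lam a b - T.lam a b)) <
      ∑ a, ∑ b, T'.lam a b * (- Real.log (T.lam a b)) := by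
    apply Finset.sum_lt_sum
    · intro a _
      exact Finset.sum_le_sum fun b _ => gibbs_term (lam_pos _ _ _) (lam_pos _ _ _)
    · refine ⟨a, Finset.mem_univ _, ?_⟩
      apply Finset.sum_lt_sum
      · intro b _
        exact gibbs_term (lam_pos _ _ _) (lam_pos _ _ _)
      · exact ⟨b, Finset.mem_univ _, gibbs_term_lt (lam_pos _ _ _) (lam_pos _ _ _) hab⟩
  simp only [Finset.sum_add_distrib, Finset.sum_sub_distrib, row_sum] at h1
  have h2 := entropy_ge T'
  rw [entropy_binary T hT] at h2
  linarith

/-- The linear functional minimised at the BME vector of `T`. -/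
noncomputable def phi (x : LeafPairs n → ℝ) : ℝ :=
  ∑ p, x p * (- Real.log (T.bmeVec p))

theorem sum_pairs (f : Fin n → Fin n → ℝ) (hs : ∀ a b, f a b = f b a) (h0 : ∀ a, f a a = 0) :
    ∑ a, ∑ b, f a b = 2 * ∑ p : LeafPairs n, f p.1.1 p.1.2 := by
  have h1 : ∑ p : LeafPairs n, f p.1.1 p.1.2 = ∑ a, ∑ b, if a < b then f a b else 0 := by
    rw [← Fintype.sum_prod_type' (f := fun a b => if a < b then f a b else 0),
      ← Finset.sum_filter]
    exact (Finset.sum_subtype (Finset.univ.filter fun p : Fin n × Fin n => p.1 < p.2) (by simp)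
      (fun p => f p.1 p.2)).symm
  have h2 : ∑ a, ∑ b, (if a < b then f a b else 0) = ∑ a, ∑ b, if b < a then f a b else 0 := by
    rw [Finset.sum_comm]
    refine Finset.sum_congr rfl fun a _ => Finset.sum_congr rfl fun b _ => ?_
    rw [hs]
  rw [two_mul, h1]
  nth_rw 2 [h2]
  rw [← Finset.sum_add_distrib]
  refine Finset.sum_congr rfl fun a _ => ?_
  rw [← Finset.sum_add_distrib]
  refine Finset.sum_congr rfl fun b _ => ?_
  rcases lt_trichotomy a b with h | h | h
  · simp [h, h.not_gt]
  · simp [h, h0]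
  · simp [h, h.not_gt]

theorem phi_eq (T' : PhyloTree n) : 2 * phi T T'.bmeVec =
    ∑ a, ∑ b, T'.lam a b * (- Real.log (T.lam a b)) := by
  rw [sum_pairs]
  · rfl
  · intro a b
    rw [lam_comm T', lam_comm T]
  · intro a
    rw [lam_self T, Real.log_one]; simp

theorem phi_lt (hT : T.IsBinary) (T' : PhyloTree n) (hne : T'.bmeVec ≠ T.bmeVec) :
    phi T T.bmeVec < phi T T'.bmeVec := by
  have : ∃ a b, T'.lam a b ≠ T.lam a b := by
    by_contra hc
    push Not at hc
    exact hne (funext fun p => hc _ _)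
  have := cross_entropy_lt T T' hT this
  rw [← phi_eq, ← phi_eq] at this
  linarith

theorem phi_combo (x y : LeafPairs n → ℝ) (s t : ℝ) :
    phi T (s • x + t • y) = s * phi T x + t * phi T y := by
  unfold phi
  rw [Finset.mul_sum, Finset.mul_sum, ← Finset.sum_add_distrib]
  refine Finset.sum_congr rfl fun p _ => ?_
  simp
  ring

theorem binary_extreme (hT : T.IsBinary) :
    T.bmeVec ∈ Set.extremePoints ℝ (bmePolytope n) := by
  have hsub : bmePolytope n ⊆ {x | x = T.bmeVec ∨ phi T T.bmeVec < phi T x} := by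
    apply convexHull_min
    · rintro x ⟨T', rfl⟩
      by_cases h : T'.bmeVec = T.bmeVec
      · exact Or.inl h
      · exact Or.inr (phi_lt T hT T' h)
    · rw [convex_iff_forall_pos]
      intro x hx y hy s t hs ht hst
      have hx' : phi T T.bmeVec ≤ phi T x := by
        rcases hx with rfl | h
        · exact le_rfl
        · exact h.le
      have hy' : phi T T.bmeVec ≤ phi T y := by
        rcases hy with rfl | h
        · exact le_rfl
        · exact h.le
      have ht' : t = 1 - s := by linarith
      rcases hx with hx | hx
      · rcases hy with hy | hy
        · left
          rw [hx, hy, ← add_smul, hst, one_smul]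
        · right
          rw [phi_combo, ht']
          rw [ht'] at ht
          nlinarith
      · right
        rw [phi_combo, ht']
        rw [ht'] at ht
        nlinarith
  refine ⟨subset_convexHull ℝ _ ⟨T, rfl⟩, ?_⟩
  intro x hx y hy hxy
  obtain ⟨s, t, hs, ht, hst, he⟩ := hxy
  have h1 := phi_combo T x y s t
  rw [he] at h1
  have ht' : t = 1 - s := by linarith
  have hy' : phi T T.bmeVec ≤ phi T y := by
    rcases hsub hy with rfl | h
    · exact le_rfl
    · exact h.le
  rcases hsub hx with h | h
  · exact h
  · exfalso
    rw [ht'] at h1 ht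
    nlinarith



/-- Splitting the vertex `v`: a new vertex `none` is joined to `v` and takes over the
neighbours in `X`. -/
def refG {V : Type} (G : SimpleGraph V) (v : V) (X : Finset V) : SimpleGraph (Option V) where
  Adj p q := match p, q with
    | some p, some q => G.Adj p q ∧ ¬(p = v ∧ q ∈ X) ∧ ¬(q = v ∧ p ∈ X)
    | none, some q => q = v ∨ q ∈ X
    | some p, none => p = v ∨ p ∈ X
    | none, none => False
  symm := ⟨by
    rintro (_ | p) (_ | q) h
    · exact h
    · exact h
    · exact h
    · exact ⟨h.1.symm, h.2.2, h.2.1⟩⟩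
  loopless := ⟨by
    rintro (_ | p) h
    · exact h
    · exact h.1.ne rfl⟩

theorem refG_ss {V : Type} {G : SimpleGraph V} {v : V} {X : Finset V} {p q : V} :
    (refG G v X).Adj (some p) (some q) ↔ G.Adj p q ∧ ¬(p = v ∧ q ∈ X) ∧ ¬(q = v ∧ p ∈ X) :=
  Iff.rfl

theorem refG_ns {V : Type} {G : SimpleGraph V} {v : V} {X : Finset V} {q : V} :
    (refG G v X).Adj none (some q) ↔ q = v ∨ q ∈ X := Iff.rfl

theorem refG_sn {V : Type} {G : SimpleGraph V} {v : V} {X : Finset V} {q : V} :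
    (refG G v X).Adj (some q) none ↔ q = v ∨ q ∈ X := Iff.rfl

theorem refG_nn {V : Type} {G : SimpleGraph V} {v : V} {X : Finset V} :
    ¬ (refG G v X).Adj none none := fun h => h

section Refine

variable {T} {v : T.V} {X : Finset T.V}

theorem v_notin (hX : X ⊆ nb T v) : v ∉ X := fun h => ((mem_nb T).1 (hX h)).ne rfl

theorem deg_none (hX : X ⊆ nb T v) (hc : X.card = 2) :
    ((refG T.G v X).neighborSet none).ncard = 3 := by
  have : (refG T.G v X).neighborSet none =
      (((insert v X).map Function.Embedding.some : Finset (Option T.V)) : Set (Option T.V)) := by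
    ext q
    rcases q with _ | q
    · simp [refG_nn]
    · simp [refG_ns]
  rw [this, Set.ncard_coe_finset, Finset.card_map, Finset.card_insert_of_notMem (v_notin hX), hc]

theorem deg_v (hX : X ⊆ nb T v) (hc : X.card = 2) :
    ((refG T.G v X).neighborSet (some v)).ncard + 1 = dg T v := by
  have : (refG T.G v X).neighborSet (some v) =
      ((insert none ((nb T v \ X).map Function.Embedding.some) : Finset (Option T.V)) :
        Set (Option T.V)) := by
    ext q
    rcases q with _ | q
    · simp [refG_sn]
    · have := v_notin hX
      simp [refG_ss, mem_nb, this]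
  have h2 := Finset.card_sdiff_add_card_eq_card hX
  rw [card_nb] at h2
  rw [this, Set.ncard_coe_finset, Finset.card_insert_of_notMem (by simp), Finset.card_map]
  omega

theorem deg_other (hX : X ⊆ nb T v) {p : T.V} (hp : p ≠ v) :
    ((refG T.G v X).neighborSet (some p)).ncard = dg T p := by
  by_cases hpX : p ∈ X
  · have hv : v ∈ nb T p := (mem_nb T).2 ((mem_nb T).1 (hX hpX)).symm
    have : (refG T.G v X).neighborSet (some p) =
        ((insert none (((nb T p).erase v).map Function.Embedding.some) : Finset (Option T.V)) :
          Set (Option T.V)) := by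
      ext q
      rcases q with _ | q
      · simp [refG_sn, hpX]
      · simp [refG_ss, mem_nb, hp, hpX, and_comm]
    rw [this, Set.ncard_coe_finset, Finset.card_insert_of_notMem (by simp), Finset.card_map,
      Finset.card_erase_add_one hv, card_nb]
  · have : (refG T.G v X).neighborSet (some p) =
        (((nb T p).map Function.Embedding.some : Finset (Option T.V)) : Set (Option T.V)) := by
      ext q
      rcases q with _ | q
      · simp [refG_sn, hpX, hp]
      · simp [refG_ss, mem_nb, hp, hpX]
    rw [this, Set.ncard_coe_finset, Finset.card_map, card_nb]

theorem ref_connected (hX : X ⊆ nb T v) : (refG T.G v X).Connected := by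
  have h0 : ∀ q, (q = v ∨ q ∈ X) → (refG T.G v X).Reachable none (some q) :=
    fun q hq => SimpleGraph.Adj.reachable (refG_ns.2 hq)
  have h1 : ∀ p q, T.G.Adj p q → (refG T.G v X).Reachable (some p) (some q) := by
    intro p q hpq
    by_cases h : (p = v ∧ q ∈ X) ∨ (q = v ∧ p ∈ X)
    · have hp : p = v ∨ p ∈ X := by tauto
      have hq : q = v ∨ q ∈ X := by tauto
      exact (h0 p hp).symm.trans (h0 q hq)
    · push Not at h
      apply SimpleGraph.Adj.reachable
      rw [refG_ss]
      exact ⟨hpq, fun h' => h.1 h'.1 h'.2, fun h' => h.2 h'.1 h'.2⟩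
  have h2 : ∀ p q, T.G.Reachable p q → (refG T.G v X).Reachable (some p) (some q) := by
    rintro p q ⟨w⟩
    induction w with
    | nil => exact SimpleGraph.Reachable.refl _
    | cons h _ ih => exact (h1 _ _ h).trans ih
  have h3 : ∀ q, (refG T.G v X).Reachable none q := by
    rintro (_ | q)
    · exact SimpleGraph.Reachable.refl _
    · exact (h0 v (Or.inl rfl)).trans (h2 v q (T.tree.connected.preconnected v q))
  haveI : Nonempty (Option T.V) := ⟨none⟩
  exact SimpleGraph.Connected.mk fun p q => (h3 p).symm.trans (h3 q)

theorem ref_tree (hX : X ⊆ nb T v) (hc : X.card = 2) : (refG T.G v X).IsTree := by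
  rw [SimpleGraph.isTree_iff_connected_and_card]
  refine ⟨ref_connected hX, ?_⟩
  have h1 := (refG T.G v X).sum_degrees_eq_twice_card_edges
  have hdeg : ∀ p, (refG T.G v X).degree p = ((refG T.G v X).neighborSet p).ncard := by
    intro p
    rw [← SimpleGraph.card_neighborFinset_eq_degree, ← Set.ncard_coe_finset]
    simp
  have h2 : ∑ p : T.V, ((refG T.G v X).neighborSet (some p)).ncard + 1 = ∑ p, dg T p := by
    rw [← Finset.add_sum_erase _ _ (Finset.mem_univ v),
      ← Finset.add_sum_erase (a := v) Finset.univ (fun p => dg T p) (Finset.mem_univ v),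
      ← deg_v hX hc]
    rw [Finset.sum_congr rfl fun p hp => deg_other hX (Finset.ne_of_mem_erase hp)]
    ring
  simp only [hdeg] at h1
  rw [Fintype.sum_option, deg_none hX hc] at h1
  have h3 := sum_dg T
  have h4 : (1 : ℕ) ≤ Fintype.card T.V := Fintype.card_pos_iff.2 ⟨v⟩
  have h5 : ∑ p, dg T p = 2 * (Fintype.card T.V - 1) := by
    have : ((∑ p, dg T p : ℕ) : ℝ) = ((2 * (Fintype.card T.V - 1) : ℕ) : ℝ) := by
      push_cast [Nat.cast_sub h4]
      exact h3
    exact_mod_cast this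
  rw [Nat.card_eq_fintype_card, Nat.card_eq_fintype_card, Fintype.card_option,
    ← SimpleGraph.edgeFinset_card]
  omega

/-- The refined tree. -/
noncomputable def refT (hv : ∀ i, T.leaf i ≠ v) (hd : 4 ≤ dg T v) (hX : X ⊆ nb T v)
    (hc : X.card = 2) : PhyloTree n where
  V := Option T.V
  fin := inferInstance
  G := refG T.G v X
  tree := ref_tree hX hc
  leaf i := some (T.leaf i)
  inj := fun i j h => T.inj (Option.some.inj h)
  leafDeg i := by rw [deg_other hX (hv i)]; exact T.leafDeg i
  leafAll p hp := by
    rcases p with _ | p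
    · rw [deg_none hX hc] at hp; omega
    · by_cases hpv : p = v
      · subst hpv
        have := deg_v hX hc
        omega
      · rw [deg_other hX hpv] at hp
        obtain ⟨i, hi⟩ := T.leafAll p hp
        exact ⟨i, by rw [hi]⟩
  internalDeg p hp := by
    rcases p with _ | p
    · rw [deg_none hX hc]
    · by_cases hpv : p = v
      · subst hpv
        have := deg_v hX hc
        omega
      · rw [deg_other hX hpv]
        exact T.internalDeg p fun i hi => hp i (by rw [hi])

theorem chain_lift {l : List T.V} (h : l.IsChain T.G.Adj) (hv : v ∉ l) :
    (l.map some).IsChain (refG T.G v X).Adj := by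
  rw [List.isChain_map]
  induction l with
  | nil => simp
  | cons a l ih =>
    cases l with
    | nil => simp
    | cons b l =>
      rw [List.isChain_cons_cons] at h ⊢
      simp only [List.mem_cons, not_or] at hv
      refine ⟨refG_ss.2 ⟨h.1, fun h => hv.1 h.1.symm, fun h => hv.2.1 h.1.symm⟩,
        ih h.2 (by simp [hv])⟩

variable (hv : ∀ i, T.leaf i ≠ v) (hd : 4 ≤ dg T v) (hX : X ⊆ nb T v) (hc : X.card = 2)

/-- Vertex weights of the refined tree. -/
noncomputable def rwt : Option T.V → ℝ := fun p => wt (refT hv hd hX hc) p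

theorem lam_ref_of_list {a b : Fin n} {l : List (Option T.V)}
    (hch : l.IsChain (refG T.G v X).Adj)
    (hh : l.head? = some (some (T.leaf a))) (hl : l.getLast? = some (some (T.leaf b)))
    (hn : l.Nodup) :
    (refT hv hd hX hc).lam a b = (l.map (rwt hv hd hX hc)).prod :=
  lam_eq_of_list (refT hv hd hX hc) hch hh hl hn

theorem rw_int {p : Option T.V} (h : ∀ i, some (T.leaf i) ≠ p) :
    rwt hv hd hX hc p = ((((refG T.G v X).neighborSet p).ncard : ℝ) - 1)⁻¹ :=
  wt_int (refT hv hd hX hc) h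

theorem wt_other {p : T.V} (hp : p ≠ v) : rwt hv hd hX hc (some p) = wt T p := by
  by_cases h : ∀ i, T.leaf i ≠ p
  · rw [rw_int hv hd hX hc (fun i hi => h i (Option.some.inj hi)), deg_other hX hp, wt_int T h]
  · push Not at h
    obtain ⟨i, rfl⟩ := h
    rw [wt_leaf]
    exact wt_leaf (refT hv hd hX hc) i

theorem wt_none : rwt hv hd hX hc none = 1 / 2 := by
  rw [rw_int hv hd hX hc (fun i => by simp), deg_none hX hc]
  norm_num

theorem wt_v : rwt hv hd hX hc (some v) = ((dg T v : ℝ) - 2)⁻¹ := by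
  rw [rw_int hv hd hX hc (fun i hi => hv i (Option.some.inj hi))]
  have h2 := deg_v hX hc
  have h3 : (((refG T.G v X).neighborSet (some v)).ncard : ℝ) + 1 = (dg T v : ℝ) := by
    exact_mod_cast h2
  congr 1
  linarith

theorem map_wt {l : List T.V} (hl : v ∉ l) :
    ((l.map some).map (rwt hv hd hX hc)) = l.map (wt T) := by
  rw [List.map_map]
  apply List.map_congr_left
  intro p hp
  exact wt_other hv hd hX hc fun h => hl (h ▸ hp)

theorem lam_ref_same {a b : Fin n} (h : v ∉ tp T.tree (T.leaf a) (T.leaf b)) :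
    (refT hv hd hX hc).lam a b = T.lam a b := by
  rw [lam_ref_of_list hv hd hX hc (l := (tp T.tree (T.leaf a) (T.leaf b)).map some),
    map_wt hv hd hX hc h]
  · rfl
  · exact chain_lift (tp_chain _ _ _) h
  · simp [tp_head]
  · simp [tp_last]
  · exact (tp_nodup _ _ _).map (Option.some_injective _)

theorem lam_ref_mid {a b : Fin n} {s t : T.V} (hs : T.G.Adj v s) (ht : T.G.Adj v t) (hst : s ≠ t)
    (ha : v ∉ tp T.tree s (T.leaf a)) (hb : v ∉ tp T.tree t (T.leaf b))
    (mid : List (Option T.V)) (hm : mid.Nodup) (hm2 : ∀ p ∈ mid, p = none ∨ p = some v)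
    (hm3 : (some s :: mid ++ [some t]).IsChain (refG T.G v X).Adj) (hm4 : mid ≠ []) :
    (refT hv hd hX hc).lam a b = pw T s (T.leaf a) * pw T t (T.leaf b) *
      (mid.map (rwt hv hd hX hc)).prod := by
  have ha' : v ∉ (tp T.tree s (T.leaf a)).reverse := by simpa using ha
  have hnod := tp_nodup T.tree (T.leaf a) (T.leaf b)
  rw [tp_cross T.tree hs ht hst ha hb] at hnod
  have hnod2 : ((tp T.tree s (T.leaf a)).reverse ++ tp T.tree t (T.leaf b)).Nodup :=
    hnod.sublist (List.Sublist.append (List.Sublist.refl _) (List.sublist_cons_self _ _))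
  rw [lam_ref_of_list hv hd hX hc (l := (tp T.tree s (T.leaf a)).reverse.map some ++
    (mid ++ (tp T.tree t (T.leaf b)).map some))]
  · rw [List.map_append, List.map_append, map_wt hv hd hX hc ha', map_wt hv hd hX hc hb,
      List.prod_append, List.prod_append, List.map_reverse, (List.reverse_perm _).prod_eq]
    unfold pw
    ring
  · rw [List.isChain_append, List.isChain_append]
    rw [List.cons_append, List.isChain_cons, List.isChain_append] at hm3
    refine ⟨chain_lift (chain_reverse (tp_chain _ _ _)) ha', ⟨hm3.2.1,
      chain_lift (tp_chain _ _ _) hb, ?_⟩, ?_⟩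
    · intro p hp q hq
      have : q = some t := by
        simp [tp_head] at hq; exact hq.symm
      subst this
      exact hm3.2.2.2 p hp _ (by simp)
    · intro p hp q hq
      have : p = some s := by
        simp [tp_head] at hp; exact hp.symm
      subst this
      apply hm3.1
      cases mid with
      | nil => exact absurd rfl hm4
      | cons c l => simpa using hq
  · simp [tp_last]
  · simp [tp_last, List.getLast?_append]
  · have hdis : ∀ p ∈ mid, ∀ l : List T.V, v ∉ l → p ∉ l.map some := by
      intro p hp l hl hpl
      obtain ⟨q, hq, rfl⟩ := List.mem_map.1 hpl
      rcases hm2 _ hp with h | h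
      · cases h
      · exact hl (Option.some.inj h ▸ hq)
    rw [List.nodup_append] at hnod2
    rw [List.nodup_append, List.nodup_append]
    refine ⟨hnod2.1.map (Option.some_injective _), ⟨hm,
      hnod2.2.1.map (Option.some_injective _), ?_⟩, ?_⟩
    · rintro p hp q hq rfl
      exact hdis p hp _ hb hq
    · rintro p hp q hq rfl
      rcases List.mem_append.1 hq with hq | hq
      · exact hdis p hq _ ha' hp
      · obtain ⟨p1, h1, e1⟩ := List.mem_map.1 hp
        obtain ⟨p2, h2, e2⟩ := List.mem_map.1 hq
        exact hnod2.2.2 p1 h1 p2 h2 (Option.some.inj (e1.trans e2.symm))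

theorem lam_ref_cross {a b : Fin n} {s t : T.V} (hs : T.G.Adj v s) (ht : T.G.Adj v t)
    (hst : s ≠ t) (ha : v ∉ tp T.tree s (T.leaf a)) (hb : v ∉ tp T.tree t (T.leaf b)) :
    (refT hv hd hX hc).lam a b = pw T s (T.leaf a) * pw T t (T.leaf b) *
      (((dg T v : ℝ) - 2)⁻¹ - ((if s ∈ X then 1 else 0) + (if t ∈ X then 1 else 0)) *
        (((dg T v : ℝ) - 2)⁻¹ / 2) + (if s ∈ X ∧ t ∈ X then 1 else 0) / 2) := by
  have hsv : s ≠ v := hs.ne.symm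
  have htv : t ≠ v := ht.ne.symm
  have hvX := v_notin hX
  by_cases h1 : s ∈ X <;> by_cases h2 : t ∈ X
  · rw [lam_ref_mid hv hd hX hc hs ht hst ha hb [none] (by simp) (by simp)
      (by simp [refG_sn, refG_ns, h1, h2]) (by simp)]
    simp only [List.map_cons, List.map_nil, List.prod_cons, List.prod_nil, wt_none, h1, h2]
    simp
    left; ring
  · rw [lam_ref_mid hv hd hX hc hs ht hst ha hb [none, some v] (by simp) (by simp)
      (by simp [refG_sn, refG_ns, refG_ss, h1, h2, ht, hvX]) (by simp)]
    simp only [List.map_cons, List.map_nil, List.prod_cons, List.prod_nil, wt_none, wt_v, h1, h2]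
    simp
    left; ring
  · rw [lam_ref_mid hv hd hX hc hs ht hst ha hb [some v, none] (by simp) (by simp)
      (by simp [refG_sn, refG_ns, refG_ss, h1, h2, hs.symm, hvX]) (by simp)]
    simp only [List.map_cons, List.map_nil, List.prod_cons, List.prod_nil, wt_none, wt_v, h1, h2]
    simp
    left; ring
  · rw [lam_ref_mid hv hd hX hc hs ht hst ha hb [some v] (by simp) (by simp)
      (by simp [refG_sn, refG_ns, refG_ss, h1, h2, hs.symm, ht, hvX]) (by simp)]
    simp [wt_v, h1, h2]

theorem lam_cross {a b : Fin n} {s t : T.V} (hv : ∀ i, T.leaf i ≠ v)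
    (hs : T.G.Adj v s) (ht : T.G.Adj v t)
    (hst : s ≠ t) (ha : v ∉ tp T.tree s (T.leaf a)) (hb : v ∉ tp T.tree t (T.leaf b)) :
    T.lam a b = pw T s (T.leaf a) * pw T t (T.leaf b) * ((dg T v : ℝ) - 1)⁻¹ := by
  rw [lam_eq]
  unfold pw
  rw [tp_cross T.tree hs ht hst ha hb, List.map_append, List.prod_append, List.map_reverse,
    (List.reverse_perm _).prod_eq, List.map_cons, List.prod_cons, wt_int T hv]
  ring

theorem ref_ne : (refT hv hd hX hc).bmeVec ≠ T.bmeVec := by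
  obtain ⟨x, y, hxy, hXe⟩ := Finset.card_eq_two.1 hc
  have hx : T.G.Adj v x := (mem_nb T).1 (hX (by simp [hXe]))
  have hy : T.G.Adj v y := (mem_nb T).1 (hX (by simp [hXe]))
  obtain ⟨a, ha⟩ := exists_leaf T hx
  obtain ⟨b, hb⟩ := exists_leaf T hy
  have hab : a ≠ b := by
    rintro rfl
    exact hxy (next_unique T.tree hx hy ha hb)
  intro he
  have hl : (refT hv hd hX hc).lam a b = T.lam a b := by
    rcases lt_or_gt_of_ne hab with h | h
    · exact congrFun he ⟨(a, b), h⟩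
    · rw [lam_comm, lam_comm T]
      exact congrFun he ⟨(b, a), h⟩
  rw [lam_ref_cross hv hd hX hc hx hy hxy ha hb, lam_cross hv hx hy hxy ha hb] at hl
  have hC := mul_pos (pw_pos T x (T.leaf a)) (pw_pos T y (T.leaf b))
  have h2 := mul_left_cancel₀ hC.ne' hl
  have hxX : x ∈ X := by simp [hXe]
  have hyX : y ∈ X := by simp [hXe]
  simp only [hxX, hyX, if_true, and_self] at h2
  have h4 : (4 : ℝ) ≤ dg T v := by exact_mod_cast hd
  have h5 : ((dg T v : ℝ) - 1)⁻¹ = 1 / 2 := by linarith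
  have h6 : (dg T v : ℝ) - 1 ≠ 0 := by linarith
  rw [inv_eq_iff_eq_inv] at h5
  norm_num at h5
  linarith

end Refine

theorem count_one {V : Type} {N : Finset V} {s : V} (hs : s ∈ N) :
    ∑ X ∈ N.powersetCard 2, (if s ∈ X then (1 : ℝ) else 0) = (N.card : ℝ) - 1 := by
  rw [← Finset.sum_filter, Finset.sum_const]
  have : (N.powersetCard 2).filter (fun X => s ∈ X) = (N.erase s).image (fun y => {s, y}) := by
    ext X
    simp only [Finset.mem_filter, Finset.mem_powersetCard, Finset.mem_image, Finset.mem_erase]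
    constructor
    · rintro ⟨⟨hX, hc⟩, hsX⟩
      obtain ⟨x, y, hxy, rfl⟩ := Finset.card_eq_two.1 hc
      simp only [Finset.mem_insert, Finset.mem_singleton] at hsX
      rcases hsX with rfl | rfl
      · exact ⟨y, ⟨hxy.symm, hX (by simp)⟩, rfl⟩
      · exact ⟨x, ⟨hxy, hX (by simp)⟩, Finset.pair_comm _ _⟩
    · rintro ⟨y, ⟨hy, hyN⟩, rfl⟩
      refine ⟨⟨?_, Finset.card_pair hy.symm⟩, by simp⟩
      intro z hz
      simp at hz
      rcases hz with rfl | rfl <;> assumption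
  rw [this, Finset.card_image_of_injOn, Finset.card_erase_of_mem hs, nsmul_eq_mul,
    Nat.cast_sub (Finset.card_pos.2 ⟨s, hs⟩)]
  · simp
  · intro y hy z hz h
    simp at hy hz
    have : y ∈ ({s, z} : Finset V) := by
      have h' : ({s, y} : Finset V) = {s, z} := h
      rw [← h']; simp
    simp at this
    rcases this with h | h
    · exact absurd h hy.2
    · exact h

theorem count_two {V : Type} {N : Finset V} {s t : V} (hs : s ∈ N) (ht : t ∈ N) (hst : s ≠ t) :
    ∑ X ∈ N.powersetCard 2, (if s ∈ X ∧ t ∈ X then (1 : ℝ) else 0) = 1 := by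
  rw [Finset.sum_eq_single {s, t}]
  · simp
  · intro X hX hne
    rw [if_neg]
    rintro ⟨h1, h2⟩
    apply hne
    symm
    apply Finset.eq_of_subset_of_card_le
    · intro z hz
      simp at hz
      rcases hz with rfl | rfl <;> assumption
    · rw [(Finset.mem_powersetCard.1 hX).2, Finset.card_pair hst]
  · intro h
    exfalso
    apply h
    rw [Finset.mem_powersetCard]
    refine ⟨?_, Finset.card_pair hst⟩
    intro z hz
    simp at hz
    rcases hz with rfl | rfl <;> assumption

/-- The refined BME vector as a total function of the set `X`. -/
noncomputable def refVec (v : T.V) (hv : ∀ i, T.leaf i ≠ v) (hd : 4 ≤ dg T v)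
    (X : Finset T.V) : LeafPairs n → ℝ :=
  if h : X ⊆ nb T v ∧ X.card = 2 then (refT hv hd h.1 h.2).bmeVec else 0

theorem refVec_avg (v : T.V) (hv : ∀ i, T.leaf i ≠ v) (hd : 4 ≤ dg T v) :
    ∑ X ∈ (nb T v).powersetCard 2, refVec T v hv hd X =
      (((nb T v).powersetCard 2).card : ℝ) • T.bmeVec := by
  funext p
  obtain ⟨⟨a, b⟩, hab⟩ := p
  rw [Finset.sum_apply]
  simp only [Pi.smul_apply, smul_eq_mul]
  obtain ⟨s, hs, ha⟩ := exists_next T.tree (hv a).symm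
  obtain ⟨t, ht, hb⟩ := exists_next T.tree (hv b).symm
  by_cases hst : s = t
  · subst hst
    have hn := tp_same T.tree ha hb
    rw [Finset.sum_congr rfl (g := fun _ => T.bmeVec ⟨(a, b), hab⟩)]
    · rw [Finset.sum_const, nsmul_eq_mul]
    · intro X hX
      have hX' := Finset.mem_powersetCard.1 hX
      unfold refVec
      rw [dif_pos hX']
      exact lam_ref_same hv hd hX'.1 hX'.2 hn
  · have h1 : ∀ X ∈ (nb T v).powersetCard 2, refVec T v hv hd X ⟨(a, b), hab⟩ =
      pw T s (T.leaf a) * pw T t (T.leaf b) *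
      (((dg T v : ℝ) - 2)⁻¹ - ((if s ∈ X then 1 else 0) + (if t ∈ X then 1 else 0)) *
        (((dg T v : ℝ) - 2)⁻¹ / 2) + (if s ∈ X ∧ t ∈ X then 1 else 0) / 2) := by
      intro X hX
      have hX' := Finset.mem_powersetCard.1 hX
      unfold refVec
      rw [dif_pos hX']
      exact lam_ref_cross hv hd hX'.1 hX'.2 hs ht hst ha hb
    have h2 : T.bmeVec ⟨(a, b), hab⟩ = _ := lam_cross hv hs ht hst ha hb
    have hsN := (mem_nb T).2 hs
    have htN := (mem_nb T).2 ht
    have h4 : (4 : ℝ) ≤ dg T v := by exact_mod_cast hd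
    rw [Finset.sum_congr rfl h1, h2, ← Finset.mul_sum, Finset.sum_add_distrib,
      Finset.sum_sub_distrib, ← Finset.sum_mul, ← Finset.sum_div, Finset.sum_add_distrib,
      count_one hsN, count_one htN, count_two hsN htN hst, Finset.sum_const,
      Finset.card_powersetCard, card_nb, nsmul_eq_mul, Nat.cast_choose_two]
    have h6 : (dg T v : ℝ) - 1 ≠ 0 := by linarith
    have h7 : (dg T v : ℝ) - 2 ≠ 0 := by linarith
    field_simp
    ring

theorem nonbinary_not_extreme (v : T.V) (hv : ∀ i, T.leaf i ≠ v) (hd : 4 ≤ dg T v) :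
    T.bmeVec ∉ Set.extremePoints ℝ (bmePolytope n) := by
  intro h
  have hconv : Convex ℝ (bmePolytope n) := convex_convexHull ℝ _
  have h2 := (hconv.mem_extremePoints_iff_convex_sdiff.1 h).2
  have hpos : (0 : ℝ) < ((nb T v).powersetCard 2).card := by
    rw [Nat.cast_pos, Finset.card_powersetCard, card_nb]
    exact Nat.choose_pos (by omega)
  have h3 := h2.sum_mem (t := (nb T v).powersetCard 2)
    (w := fun _ => (((nb T v).powersetCard 2).card : ℝ)⁻¹) (z := refVec T v hv hd)
    (fun _ _ => (inv_pos.2 hpos).le)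
    (by rw [Finset.sum_const, nsmul_eq_mul]; exact mul_inv_cancel₀ hpos.ne')
    (by
      intro X hX
      have hX' := Finset.mem_powersetCard.1 hX
      unfold refVec
      rw [dif_pos hX']
      exact ⟨subset_convexHull ℝ _ ⟨_, rfl⟩, ref_ne hv hd hX'.1 hX'.2⟩)
  rw [← Finset.smul_sum, refVec_avg, smul_smul, inv_mul_cancel₀ hpos.ne', one_smul] at h3
  exact h3.2 rfl


end Phylo

end BME

/-- For `n ≥ 4`, the extreme points of the BME polytope are exactly the BME vectors of
binary phylogenetic trees on leaf set `{1,…,n}`. -/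
theorem extremePoints_bmePolytope (n : ℕ) (hn : 4 ≤ n) :
    Set.extremePoints ℝ (bmePolytope n)
      = {x | ∃ T : PhyloTree n, T.IsBinary ∧ T.bmeVec = x} := by
  apply Set.Subset.antisymm
  · intro x hx
    obtain ⟨T, rfl⟩ := extremePoints_convexHull_subset hx
    refine ⟨T, ?_, rfl⟩
    intro v hv
    by_contra h
    have h3 := T.internalDeg v hv
    exact BME.nonbinary_not_extreme T v hv (by unfold BME.dg; omega) hx
  · rintro x ⟨T, hT, rfl⟩
    exact BME.binary_extreme T hT
end

section
/- For n ≥ 4, the BME vector of the star tree (the tree with a single internal vertex adjacent to all n leaves, whose BME vector has every entry equal to 1/(n−1)) lies in the relative interior of the BME polytope; moreover, the BME vector of every phylogenetic tree that is neither binary nor the star tree lies on the relative boundary of the BME polytope. -/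
namespace BMEProof
open Classical

section tree
variable {V : Type} {G : SimpleGraph V}

/-- the unique path -/
noncomputable def pth (hG : G.IsTree) (u v : V) : G.Walk u v :=
  (hG.existsUnique_path u v).choose

lemma pth_isPath (hG : G.IsTree) (u v : V) : (pth hG u v).IsPath :=
  (hG.existsUnique_path u v).choose_spec.1

lemma eq_pth (hG : G.IsTree) {u v : V} (p : G.Walk u v) (hp : p.IsPath) : p = pth hG u v :=
  (hG.existsUnique_path u v).choose_spec.2 p hp

/-- path weight -/
noncomputable def W (hG : G.IsTree) (g : V → ℝ) (u v : V) : ℝ :=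
  ((pth hG u v).support.map g).prod

variable (hG : G.IsTree) (g : V → ℝ)

lemma pth_reverse (u v : V) : (pth hG u v).reverse = pth hG v u :=
  eq_pth hG _ (pth_isPath hG u v).reverse

lemma W_comm (u v : V) : W hG g u v = W hG g v u := by
  unfold W
  rw [← pth_reverse hG u v, SimpleGraph.Walk.support_reverse, List.map_reverse, List.prod_reverse]

lemma pth_self (u : V) : pth hG u u = SimpleGraph.Walk.nil :=
  (eq_pth hG _ (by simp)).symm

lemma W_self (u : V) : W hG g u u = g u := by simp [W, pth_self]

lemma pth_split {u v w : V} (h : w ∈ (pth hG u v).support) :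
    pth hG u v = (pth hG u w).append (pth hG w v) := by
  obtain ⟨q, r, hq, hr, e⟩ := (pth_isPath hG u v).mem_support_iff_exists_append.1 h
  rw [e, eq_pth hG q hq, eq_pth hG r hr]

lemma pth_cons {u u' x : V} (h : G.Adj u u') (hn : u ∉ (pth hG u' x).support) :
    pth hG u x = SimpleGraph.Walk.cons h (pth hG u' x) :=
  (eq_pth hG _ ((pth_isPath hG u' x).cons hn)).symm

lemma pth_concat {u u' x : V} (h : G.Adj u' u) (hn : u ∉ (pth hG x u').support) :
    pth hG x u = (pth hG x u').concat h :=
  (eq_pth hG _ ((pth_isPath hG x u').concat hn h)).symm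

lemma W_cons {u u' x : V} (h : G.Adj u u') (hn : u ∉ (pth hG u' x).support) :
    W hG g u x = g u * W hG g u' x := by
  unfold W; rw [pth_cons hG h hn]; simp

lemma pth_mid {a w b : V} (h1 : G.Adj a w) (h2 : G.Adj w b) (hab : a ≠ b) :
    W hG g a b = g a * (g w * g b) := by
  have e1 : w ∉ (pth hG b b).support := by simp [pth_self, h2.ne]
  have e2 : a ∉ (pth hG w b).support := by
    rw [pth_cons hG h2 e1]; simp [pth_self, h1.ne, hab]
  rw [W_cons hG g h1 e2, W_cons hG g h2 e1, W_self]

lemma not_both {r v x y : V} (h : v ∈ (pth hG r x).support) (hy1 : y ∈ (pth hG r v).support)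
    (hy2 : y ∈ (pth hG v x).support) : y = v := by
  by_contra hne
  have hp := pth_isPath hG r x
  rw [pth_split hG h] at hp
  exact hp.ne_of_mem_support_of_append hne hy1 hy2 rfl

lemma trans_mem {r v x y : V} (h : v ∈ (pth hG r x).support)
    (hy : y ∈ (pth hG v x).support) : y ∈ (pth hG r x).support ∧ v ∈ (pth hG r y).support := by
  have hyx : y ∈ (pth hG r x).support := by
    rw [pth_split hG h, SimpleGraph.Walk.mem_support_append_iff]; exact Or.inr hy
  refine ⟨hyx, ?_⟩
  have := h
  rw [pth_split hG hyx, SimpleGraph.Walk.mem_support_append_iff] at this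
  rcases this with h1 | h1
  · exact h1
  -- v after y and y after v
  have e1 := pth_split hG h
  have e2 := pth_split hG hy
  have e3 := pth_split hG hyx
  have e4 := pth_split hG h1
  have l1 := congrArg SimpleGraph.Walk.length e1
  have l2 := congrArg SimpleGraph.Walk.length e2
  have l4 := congrArg SimpleGraph.Walk.length e4
  rw [SimpleGraph.Walk.length_append] at l1 l2 l4
  have : (pth hG v y).length = 0 := by omega
  have := SimpleGraph.Walk.eq_of_length_eq_zero this
  subst this; simp

variable [Fintype V]

/-- descendants -/
noncomputable def below (r v : V) : Finset V := Finset.univ.filter fun x => v ∈ (pth hG r x).support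

/-- children -/
noncomputable def ch (r v : V) : Finset V :=
  Finset.univ.filter fun w => G.Adj v w ∧ w ∉ (pth hG r v).support

lemma mem_below {r v x : V} : x ∈ below hG r v ↔ v ∈ (pth hG r x).support := by simp [below]
lemma mem_ch {r v w : V} : w ∈ ch hG r v ↔ G.Adj v w ∧ w ∉ (pth hG r v).support := by simp [ch]

lemma self_mem_below (r v : V) : v ∈ below hG r v := by simp [mem_below]

lemma ch_pth {r v w : V} (h : w ∈ ch hG r v) :
    pth hG r w = (pth hG r v).concat ((mem_ch hG).1 h).1 :=
  pth_concat hG _ ((mem_ch hG).1 h).2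

lemma ch_mem_iff {r v w y : V} (h : w ∈ ch hG r v) :
    y ∈ (pth hG r w).support ↔ y ∈ (pth hG r v).support ∨ y = w := by
  rw [ch_pth hG h, SimpleGraph.Walk.support_concat]; simp

lemma ch_parent {r v v' w : V} (h : w ∈ ch hG r v) (h' : w ∈ ch hG r v') : v = v' := by
  have e := ch_pth hG h
  rw [ch_pth hG h'] at e
  have := congrArg SimpleGraph.Walk.penultimate e
  simpa using this.symm

lemma below_ch_subset {r v w x : V} (h : w ∈ ch hG r v) (hx : x ∈ below hG r w) :
    x ∈ below hG r v := by
  rw [mem_below] at *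
  rw [pth_split hG hx, SimpleGraph.Walk.mem_support_append_iff, ch_mem_iff hG h]
  simp

lemma not_mem_down {r v w x : V} (h : w ∈ ch hG r v) (hx : x ∈ below hG r w) :
    v ∉ (pth hG w x).support := by
  intro hv
  have hne := ((mem_ch hG).1 h).1.ne
  exact hne (not_both hG ((mem_below hG).1 hx) ((ch_mem_iff hG h).2 (by simp)) hv)

lemma not_mem_below_ch {r v w : V} (h : w ∈ ch hG r v) : v ∉ below hG r w := by
  rw [mem_below]; exact ((mem_ch hG).1 h).2

lemma below_disj {r v w w' : V} (h : w ∈ ch hG r v) (h' : w' ∈ ch hG r v) (hne : w ≠ w') :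
    Disjoint (below hG r w) (below hG r w') := by
  rw [Finset.disjoint_left]
  intro z hz hz'
  rw [mem_below] at hz hz'
  have hh := hz'
  rw [pth_split hG hz, SimpleGraph.Walk.mem_support_append_iff] at hh
  rcases hh with h1 | h1
  · rcases (ch_mem_iff hG h).1 h1 with h2 | h2
    · exact ((mem_ch hG).1 h').2 h2
    · exact hne h2.symm
  · have := (trans_mem hG hz h1).2
    rcases (ch_mem_iff hG h').1 this with h2 | h2
    · exact ((mem_ch hG).1 h).2 h2
    · exact hne h2

lemma below_eq (r v : V) : below hG r v = insert v ((ch hG r v).biUnion (below hG r)) := by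
  ext x
  simp only [Finset.mem_insert, Finset.mem_biUnion]
  constructor
  · intro hx
    by_cases hxv : x = v
    · exact Or.inl hxv
    right
    have hx' := (mem_below hG).1 hx
    have hnn : ¬ (pth hG v x).Nil := fun h => hxv h.eq.symm
    have hadj := SimpleGraph.Walk.adj_snd hnn
    have hm : (pth hG v x).snd ∈ (pth hG v x).support := SimpleGraph.Walk.getVert_mem_support _ _
    refine ⟨(pth hG v x).snd, (mem_ch hG).2 ⟨hadj, fun hc => ?_⟩, (mem_below hG).2 (trans_mem hG hx' hm).1⟩
    exact hadj.ne (not_both hG hx' hc hm).symm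
  · rintro (rfl | ⟨w, hw, hx⟩)
    · exact self_mem_below hG r x
    · exact below_ch_subset hG hw hx

lemma sum_below (r v : V) (F : V → ℝ) :
    ∑ x ∈ below hG r v, F x = F v + ∑ w ∈ ch hG r v, ∑ x ∈ below hG r w, F x := by
  rw [below_eq, Finset.sum_insert, Finset.sum_biUnion]
  · intro w hw w' hw' hne
    exact below_disj hG hw hw' hne
  · simp only [Finset.mem_biUnion, not_exists, not_and]
    intro w hw
    exact not_mem_below_ch hG hw

lemma below_root (r : V) : below hG r r = Finset.univ := by
  ext x; simp [mem_below]

lemma card_below_lt {r v w : V} (h : w ∈ ch hG r v) : (below hG r w).card < (below hG r v).card := by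
  apply Finset.card_lt_card
  rw [Finset.ssubset_iff_of_subset (fun x hx => below_ch_subset hG h hx)]
  exact ⟨v, self_mem_below hG r v, not_mem_below_ch hG h⟩

lemma W_down {r v w x : V} (h : w ∈ ch hG r v) (hx : x ∈ below hG r w) :
    W hG g v x = g v * W hG g w x :=
  W_cons hG g ((mem_ch hG).1 h).1 (not_mem_down hG h hx)

lemma W_cross {r v w w' x y : V} (h : w ∈ ch hG r v) (h' : w' ∈ ch hG r v) (hne : w ≠ w')
    (hx : x ∈ below hG r w) (hy : y ∈ below hG r w') :
    W hG g x y = g v * (W hG g w x * W hG g w' y) := by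
  have hp : ((pth hG x v).append (pth hG v y)).IsPath := by
    rw [SimpleGraph.Walk.isPath_def, SimpleGraph.Walk.support_append,
      pth_cons hG ((mem_ch hG).1 h').1 (not_mem_down hG h' hy),
      SimpleGraph.Walk.support_cons, List.tail_cons, List.nodup_append']
    refine ⟨(pth_isPath hG _ _).support_nodup, (pth_isPath hG _ _).support_nodup, ?_⟩
    intro z hz hz'
    rw [← pth_reverse hG, SimpleGraph.Walk.support_reverse, List.mem_reverse,
      pth_cons hG ((mem_ch hG).1 h).1 (not_mem_down hG h hx),
      SimpleGraph.Walk.support_cons, List.mem_cons] at hz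
    rcases hz with rfl | hz
    · exact not_mem_down hG h' hy hz'
    · have a1 := (mem_below hG).2 (trans_mem hG ((mem_below hG).1 hx) hz).2
      have a2 := (mem_below hG).2 (trans_mem hG ((mem_below hG).1 hy) hz').2
      exact Finset.disjoint_left.1 (below_disj hG h h' hne) a1 a2
  have e := eq_pth hG _ hp
  have : W hG g x y = W hG g v x * W hG g w' y := by
    rw [W_comm hG g v x]
    unfold W
    rw [← e, SimpleGraph.Walk.support_append,
      pth_cons hG ((mem_ch hG).1 h').1 (not_mem_down hG h' hy),
      SimpleGraph.Walk.support_cons, List.tail_cons, List.map_append, List.prod_append]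
  rw [this, W_down hG g h hx]; ring

lemma ch_root (r : V) : ch hG r r = G.neighborFinset r := by
  ext w
  simp only [mem_ch, SimpleGraph.mem_neighborFinset, pth_self]
  constructor
  · exact fun h => h.1
  · intro h; exact ⟨h, by simp [h.ne.symm]⟩

lemma ch_nonroot {r v : V} (h : v ≠ r) : (ch hG r v).card + 1 = G.degree v := by
  have hnn : ¬ (pth hG r v).Nil := fun h' => h h'.eq.symm
  have hadj := SimpleGraph.Walk.adj_penultimate hnn
  have : G.neighborFinset v = insert (pth hG r v).penultimate (ch hG r v) := by
    ext w
    simp only [mem_ch, SimpleGraph.mem_neighborFinset, Finset.mem_insert]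
    constructor
    · intro hw
      by_cases hm : w ∈ (pth hG r v).support
      · left
        exact hG.isAcyclic.eq_penultimate_of_adj_end (pth_isPath hG r v) hw hm
      · exact Or.inr ⟨hw, hm⟩
    · rintro (rfl | h)
      · exact hadj.symm
      · exact h.1
  rw [← SimpleGraph.card_neighborFinset_eq_degree, this, Finset.card_insert_of_notMem]
  simp only [mem_ch, not_and, not_not]
  intro _
  exact SimpleGraph.Walk.getVert_mem_support _ _

lemma root_not_ch {r v : V} : r ∉ ch hG r v := by
  simp [mem_ch]

/-- downward average -/
noncomputable def pp (r : V) (α : V → ℝ) (v : V) : ℝ := ∑ x ∈ below hG r v, α x * W hG g v x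

/-- cross sum below `v` -/
noncomputable def cc (r : V) (α β : V → ℝ) (v : V) : ℝ :=
  ∑ x ∈ below hG r v, ∑ y ∈ below hG r v, α x * β y * W hG g x y

lemma pp_rec (r : V) (α : V → ℝ) (v : V) :
    pp hG g r α v = g v * (α v + ∑ w ∈ ch hG r v, pp hG g r α w) := by
  unfold pp
  rw [sum_below, W_self, mul_add, Finset.mul_sum, mul_comm (α v)]
  congr 1
  refine Finset.sum_congr rfl fun w hw => ?_
  rw [Finset.mul_sum]
  refine Finset.sum_congr rfl fun x hx => ?_
  rw [W_down hG g hw hx]; ring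

lemma cc_rec (r : V) (α β : V → ℝ) (v : V) (hα : α v = 0) :
    cc hG g r α β v = g v * β v * ∑ w ∈ ch hG r v, pp hG g r α w
      + ∑ w ∈ ch hG r v, (cc hG g r α β w +
        ∑ w' ∈ (ch hG r v).erase w, g v * (pp hG g r α w * pp hG g r β w')) := by
  have e : cc hG g r α β v = ∑ w ∈ ch hG r v, ∑ x ∈ below hG r w,
      (α x * β v * W hG g x v + ∑ w' ∈ ch hG r v, ∑ y ∈ below hG r w', α x * β y * W hG g x y) := by
    unfold cc
    rw [sum_below hG r v]
    simp only [hα, zero_mul, Finset.sum_const_zero, zero_add]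
    refine Finset.sum_congr rfl fun w hw => Finset.sum_congr rfl fun x hx => ?_
    rw [sum_below]
  rw [e, Finset.mul_sum, ← Finset.sum_add_distrib]
  refine Finset.sum_congr rfl fun w hw => ?_
  rw [Finset.sum_add_distrib]
  congr 1
  · unfold pp
    rw [Finset.mul_sum]
    refine Finset.sum_congr rfl fun x hx => ?_
    rw [W_comm, W_down hG g hw hx]; ring
  · rw [Finset.sum_comm, ← Finset.add_sum_erase _ _ hw]
    congr 1
    refine Finset.sum_congr rfl fun w' hw' => ?_
    have hw'' := Finset.mem_of_mem_erase hw'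
    have hne := Finset.ne_of_mem_erase hw'
    unfold pp
    rw [Finset.sum_mul_sum, Finset.mul_sum]
    refine Finset.sum_congr rfl fun x hx => ?_
    rw [Finset.mul_sum]
    refine Finset.sum_congr rfl fun y hy => ?_
    rw [W_cross hG g hw hw'' hne.symm hx hy]; ring

lemma W_nonneg (hg : ∀ v, 0 ≤ g v) (u v : V) : 0 ≤ W hG g u v := by
  unfold W
  apply List.prod_nonneg
  intro a ha
  obtain ⟨x, _, rfl⟩ := List.mem_map.1 ha
  exact hg x

lemma pp_nonneg (hg : ∀ v, 0 ≤ g v) (r : V) (α : V → ℝ) (hα : ∀ v, 0 ≤ α v) (v : V) :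
    0 ≤ pp hG g r α v :=
  Finset.sum_nonneg fun x _ => mul_nonneg (hα x) (W_nonneg hG g hg _ _)

lemma cc_nonneg (hg : ∀ v, 0 ≤ g v) (r : V) (α β : V → ℝ) (hα : ∀ v, 0 ≤ α v) (hβ : ∀ v, 0 ≤ β v)
    (v : V) : 0 ≤ cc hG g r α β v :=
  Finset.sum_nonneg fun x _ => Finset.sum_nonneg fun y _ =>
    mul_nonneg (mul_nonneg (hα x) (hβ y)) (W_nonneg hG g hg _ _)

lemma pp_one (r : V) (γ : V → ℝ)
    (hc : ∀ v, v ≠ r → (ch hG r v = ∅ ∧ g v = 1 ∧ γ v = 1) ∨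
      (g v * (ch hG r v).card = 1 ∧ γ v = 0)) (v : V) (hv : v ≠ r) : pp hG g r γ v = 1 := by
  induction hN : (below hG r v).card using Nat.strong_induction_on generalizing v with
  | _ N ih =>
    subst hN
    rw [pp_rec]
    rcases hc v hv with ⟨h1, h2, h3⟩ | ⟨h1, h2⟩
    · simp [h1, h2, h3]
    · rw [Finset.sum_congr rfl (g := fun _ => (1 : ℝ))]
      · simp [h2, h1]
      · intro w hw
        exact ih _ (card_below_lt hG hw) w (fun e => root_not_ch hG (e ▸ hw)) rfl

lemma pp_add (r : V) (α β : V → ℝ) (v : V) :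
    pp hG g r (fun x => α x + β x) v = pp hG g r α v + pp hG g r β v := by
  unfold pp; rw [← Finset.sum_add_distrib]
  exact Finset.sum_congr rfl fun x _ => by ring

lemma arith {ι : Type} (s : Finset ι) (p : ι → ℝ) (g : ℝ) (h0 : ∀ i ∈ s, 0 ≤ p i)
    (h1 : ∀ i ∈ s, p i ≤ 1) (hg : g * s.card = 1) (i0 : ι) (hi : i0 ∈ s) :
    p i0 ≤ (∑ w ∈ s, ∑ w' ∈ s.erase w, g * (p w * (1 - p w'))) + g * ∑ w ∈ s, p w := by
  have hg0 : 0 ≤ g := by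
    by_contra h
    have : g * s.card ≤ 0 := mul_nonpos_of_nonpos_of_nonneg (by linarith) (by positivity)
    linarith
  rw [← Finset.add_sum_erase s p hi, ← Finset.add_sum_erase s _ hi]
  set R := ∑ w ∈ s.erase i0, p w with hR
  have hR0 : 0 ≤ R := Finset.sum_nonneg fun i h => h0 i (Finset.mem_of_mem_erase h)
  have e1 : ∑ w' ∈ s.erase i0, g * (p i0 * (1 - p w')) = g * (p i0 * (s.card - 1 - R)) := by
    rw [← Finset.mul_sum, ← Finset.mul_sum, Finset.sum_sub_distrib, ← hR]
    have := Finset.card_erase_add_one hi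
    have : ((s.erase i0).card : ℝ) + 1 = s.card := by exact_mod_cast this
    simp; left; left; linarith
  have e2 : g * (R * (1 - p i0)) ≤ ∑ w ∈ s.erase i0, ∑ w' ∈ s.erase w, g * (p w * (1 - p w')) := by
    rw [hR, Finset.sum_mul, Finset.mul_sum]
    refine Finset.sum_le_sum fun w hw => ?_
    have hw' := Finset.mem_of_mem_erase hw
    refine Finset.single_le_sum (f := fun w' => g * (p w * (1 - p w'))) (fun i h => ?_)
      (Finset.mem_erase.2 ⟨(Finset.ne_of_mem_erase hw).symm, hi⟩)
    exact mul_nonneg hg0 (mul_nonneg (h0 w hw')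
      (sub_nonneg.2 (h1 i (Finset.mem_of_mem_erase h))))
  rw [e1]
  have : 0 ≤ g * R * (1 - p i0) := mul_nonneg (mul_nonneg hg0 hR0) (sub_nonneg.2 (h1 _ hi))
  have e3 : p i0 = p i0 * (g * s.card) := by rw [hg, mul_one]
  nlinarith

lemma cc_ge (hg : ∀ v, 0 ≤ g v) (r : V) (α β : V → ℝ) (hα : ∀ v, 0 ≤ α v) (hβ : ∀ v, 0 ≤ β v)
    (hc : ∀ v, v ≠ r → (ch hG r v = ∅ ∧ g v = 1 ∧ α v + β v = 1) ∨
      (g v * (ch hG r v).card = 1 ∧ α v + β v = 0)) (a : V) (ha : α a = 1)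
    (v : V) (hv : v ≠ r) (hav : a ∈ below hG r v) :
    1 ≤ cc hG g r α β v + pp hG g r α v := by
  have hone : ∀ v, v ≠ r → pp hG g r α v + pp hG g r β v = 1 := fun v hv => by
    rw [← pp_add]; exact pp_one hG g r _ hc v hv
  induction hN : (below hG r v).card using Nat.strong_induction_on generalizing v with
  | _ N ih =>
    subst hN
    have hav' := hav
    rw [below_eq, Finset.mem_insert, Finset.mem_biUnion] at hav'
    rcases hav' with rfl | ⟨i0, hi0, hai⟩
    · have h1 := cc_nonneg hG g hg r α β hα hβ a
      rcases hc a hv with ⟨h2, h3, h4⟩ | ⟨h2, h3⟩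
      · rw [pp_rec]; simp [h2, h3, ha, h1]
      · have := hβ a; linarith
    · rcases hc v hv with ⟨h2, h3, h4⟩ | ⟨h2, h3⟩
      · rw [h2] at hi0; simp at hi0
      have hr : ∀ w ∈ ch hG r v, w ≠ r := fun w hw e => root_not_ch hG (e ▸ hw)
      have a0 : α v = 0 := by have := hα v; have := hβ v; linarith
      have b0 : β v = 0 := by have := hα v; have := hβ v; linarith
      have IH := ih _ (card_below_lt hG hi0) i0 (hr _ hi0) hai rfl
      rw [cc_rec hG g r α β v a0, pp_rec hG g r α v, a0, b0, Finset.sum_add_distrib]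
      have A := arith (ch hG r v) (pp hG g r α) (g v) (fun i _ => pp_nonneg hG g hg r α hα i)
        (fun i hi => by have := hone i (hr i hi); have := pp_nonneg hG g hg r β hβ i; linarith)
        h2 i0 hi0
      have B : cc hG g r α β i0 ≤ ∑ w ∈ ch hG r v, cc hG g r α β w :=
        Finset.single_le_sum (f := cc hG g r α β) (fun i _ => cc_nonneg hG g hg r α β hα hβ i) hi0
      have C : ∑ w ∈ ch hG r v, ∑ w' ∈ (ch hG r v).erase w,
            g v * (pp hG g r α w * pp hG g r β w') =
          ∑ w ∈ ch hG r v, ∑ w' ∈ (ch hG r v).erase w,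
            g v * (pp hG g r α w * (1 - pp hG g r α w')) := by
        refine Finset.sum_congr rfl fun w hw => Finset.sum_congr rfl fun w' hw' => ?_
        rw [← hone w' (hr w' (Finset.mem_of_mem_erase hw'))]; ring
      rw [C]
      simp only [mul_zero, zero_mul, zero_add]
      linarith

/-- global cross inequality -/
lemma cross_ge (hg : ∀ v, 0 ≤ g v) (r : V) (α β : V → ℝ) (hα : ∀ v, 0 ≤ α v) (hβ : ∀ v, 0 ≤ β v)
    (hc : ∀ v, v ≠ r → (ch hG r v = ∅ ∧ g v = 1 ∧ α v + β v = 1) ∨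
      (g v * (ch hG r v).card = 1 ∧ α v + β v = 0)) (a : V) (ha : α a = 1)
    (hr : g r = 1) (hr0 : α r = 0) (hr1 : β r = 1) (hr2 : (ch hG r r).card = 1) :
    1 ≤ ∑ x, ∑ y, α x * β y * W hG g x y := by
  have e : ∑ x, ∑ y, α x * β y * W hG g x y = cc hG g r α β r := by
    unfold cc; rw [below_root]
  rw [e, cc_rec hG g r α β r hr0]
  obtain ⟨w, hw⟩ := Finset.card_eq_one.1 hr2
  have hwm : w ∈ ch hG r r := by rw [hw]; simp
  rw [hw]
  have haw : a ∈ below hG r w := by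
    have : a ∈ below hG r r := by rw [below_root]; simp
    rw [below_eq, hw] at this
    simp only [Finset.singleton_biUnion, Finset.mem_insert] at this
    rcases this with rfl | h
    · rw [hr0] at ha; norm_num at ha
    · exact h
  have := cc_ge hG g hg r α β hα hβ hc a ha w (fun e => root_not_ch hG (e ▸ hwm)) haw
  simp [hr, hr1]
  linarith

lemma kraft (r : V) (γ : V → ℝ)
    (hc : ∀ v, v ≠ r → (ch hG r v = ∅ ∧ g v = 1 ∧ γ v = 1) ∨
      (g v * (ch hG r v).card = 1 ∧ γ v = 0))
    (hr : g r = 1) (hr0 : γ r = 0) (hr2 : (ch hG r r).card = 1) :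
    ∑ x, γ x * W hG g r x = 1 := by
  have e : ∑ x, γ x * W hG g r x = pp hG g r γ r := by
    unfold pp; rw [below_root]
  rw [e, pp_rec, hr, hr0, Finset.sum_congr rfl (g := fun _ => (1 : ℝ))]
  · simp [hr2]
  · intro w hw
    exact pp_one hG g r γ hc w (fun e => root_not_ch hG (e ▸ hw))

end tree

section phylo
variable {n : ℕ} (T : PhyloTree n)

noncomputable instance instFT : Fintype T.V := T.fin

/-- vertex weight -/
noncomputable def gT (v : T.V) : ℝ :=
  if ∀ i, T.leaf i ≠ v then (((T.G.neighborSet v).ncard : ℝ) - 1)⁻¹ else 1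

lemma lam_eq (a b : Fin n) : T.lam a b = W T.tree (gT T) (T.leaf a) (T.leaf b) := rfl

lemma ncard_eq (v : T.V) : (T.G.neighborSet v).ncard = T.G.degree v := by
  rw [Set.ncard_eq_toFinset_card', ← SimpleGraph.card_neighborFinset_eq_degree]; rfl

lemma gT_leaf (a : Fin n) : gT T (T.leaf a) = 1 := by
  unfold gT; rw [if_neg]; push Not; exact ⟨a, rfl⟩

lemma gT_nonneg (v : T.V) : 0 ≤ gT T v := by
  unfold gT
  split_ifs with h
  · have := T.internalDeg v h
    have : (3 : ℝ) ≤ ((T.G.neighborSet v).ncard : ℝ) := by exact_mod_cast this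
    exact inv_nonneg.2 (by linarith)
  · norm_num

lemma ch_card_root (r : Fin n) : (ch T.tree (T.leaf r) (T.leaf r)).card = 1 := by
  rw [ch_root, SimpleGraph.card_neighborFinset_eq_degree, ← ncard_eq, T.leafDeg]

lemma ch_leaf (r b : Fin n) (h : T.leaf b ≠ T.leaf r) : ch T.tree (T.leaf r) (T.leaf b) = ∅ := by
  have := ch_nonroot T.tree h
  rw [← ncard_eq, T.leafDeg] at this
  exact Finset.card_eq_zero.1 (by omega)

lemma ch_int (r : Fin n) (v : T.V) (h : ∀ i, T.leaf i ≠ v) :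
    2 ≤ (ch T.tree (T.leaf r) v).card ∧ gT T v * (ch T.tree (T.leaf r) v).card = 1 := by
  have e := ch_nonroot T.tree (h r).symm
  have d := T.internalDeg v h
  rw [← ncard_eq] at e
  have h2 : 2 ≤ (ch T.tree (T.leaf r) v).card := by omega
  refine ⟨h2, ?_⟩
  unfold gT
  rw [if_pos h, ← e]
  have : (0 : ℝ) < (ch T.tree (T.leaf r) v).card := by exact_mod_cast (by omega)
  push_cast
  rw [add_sub_cancel_right]
  field_simp

/-- extension of a leaf function by zero -/
noncomputable def lx (c : Fin n → ℝ) (x : T.V) : ℝ := ∑ b, if T.leaf b = x then c b else 0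

lemma lx_leaf (c : Fin n → ℝ) (b : Fin n) : lx T c (T.leaf b) = c b := by
  unfold lx
  simp [T.inj.eq_iff]

lemma lx_int (c : Fin n → ℝ) (v : T.V) (h : ∀ i, T.leaf i ≠ v) : lx T c v = 0 := by
  unfold lx; simp [h]

lemma lx_nonneg (c : Fin n → ℝ) (hc : ∀ b, 0 ≤ c b) (v : T.V) : 0 ≤ lx T c v :=
  Finset.sum_nonneg fun b _ => by split_ifs <;> simp [hc]

lemma lx_sum (c : Fin n → ℝ) (F : T.V → ℝ) : ∑ x, lx T c x * F x = ∑ b, c b * F (T.leaf b) := by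
  unfold lx
  simp_rw [Finset.sum_mul]
  rw [Finset.sum_comm]
  simp

lemma lam_kraft (a : Fin n) : ∑ b, (if b = a then 0 else 1) * T.lam a b = 1 := by
  simp_rw [lam_eq]
  rw [← lx_sum T (fun b => if b = a then 0 else 1) (fun x => W T.tree (gT T) (T.leaf a) x)]
  refine kraft T.tree (gT T) (T.leaf a) _ ?_ (gT_leaf T a) (by rw [lx_leaf]; simp) (ch_card_root T a)
  intro v hv
  by_cases h : ∀ i, T.leaf i ≠ v
  · exact Or.inr ⟨(ch_int T a v h).2, lx_int T _ v h⟩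
  · push Not at h
    obtain ⟨b, rfl⟩ := h
    refine Or.inl ⟨ch_leaf T a b hv, gT_leaf T b, ?_⟩
    rw [lx_leaf, if_neg]
    rintro rfl; exact hv rfl

lemma lam_cross (A : Finset (Fin n)) (a r : Fin n) (ha : a ∈ A) (hr : r ∉ A) :
    1 ≤ ∑ x ∈ A, ∑ y ∈ Aᶜ, T.lam x y := by
  have key := cross_ge T.tree (gT T) (gT_nonneg T) (T.leaf r)
    (lx T fun b => if b ∈ A then 1 else 0) (lx T fun b => if b ∈ Aᶜ then 1 else 0)
    (lx_nonneg T _ fun b => by split_ifs <;> norm_num)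
    (lx_nonneg T _ fun b => by split_ifs <;> norm_num)
    (by
      intro v hv
      by_cases h : ∀ i, T.leaf i ≠ v
      · exact Or.inr ⟨(ch_int T r v h).2, by rw [lx_int T _ v h, lx_int T _ v h]; simp⟩
      · push Not at h
        obtain ⟨b, rfl⟩ := h
        refine Or.inl ⟨ch_leaf T r b hv, gT_leaf T b, ?_⟩
        rw [lx_leaf, lx_leaf]
        by_cases hb : b ∈ A <;> simp [hb])
    (T.leaf a) (by rw [lx_leaf]; simp [ha]) (gT_leaf T r) (by rw [lx_leaf]; simp [hr])
    (by rw [lx_leaf]; simp [hr]) (ch_card_root T r)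
  refine key.trans (le_of_eq ?_)
  simp_rw [mul_assoc, ← Finset.mul_sum]
  rw [lx_sum]
  simp_rw [lx_sum, ← lam_eq]
  simp [Finset.sum_ite, Finset.filter_mem_eq_inter, ite_mul]
  refine Finset.sum_congr rfl fun x _ => ?_
  refine Finset.sum_congr ?_ fun _ _ => rfl
  ext; simp

lemma lam_comm (a b : Fin n) : T.lam a b = T.lam b a := by
  rw [lam_eq, lam_eq, W_comm]

lemma nbr_internal (hn : 4 ≤ n) (a : Fin n) (w : T.V) (h : T.G.Adj (T.leaf a) w) :
    ∀ i, T.leaf i ≠ w := by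
  rintro c rfl
  have hm : T.leaf c ∈ ch T.tree (T.leaf a) (T.leaf a) := by
    rw [ch_root]; simpa using h
  obtain ⟨w, hw⟩ := Finset.card_eq_one.1 (ch_card_root T a)
  have hwc : T.leaf c = w := by rw [hw] at hm; simpa using hm
  subst hwc
  have e := below_root T.tree (T.leaf a)
  rw [below_eq, hw, Finset.singleton_biUnion, below_eq, ch_leaf T a c h.ne.symm] at e
  have h1 := congrArg Finset.card e
  have h2 := Fintype.card_le_of_injective _ T.inj
  rw [Finset.card_univ] at h1
  rw [Fintype.card_fin, ← h1] at h2
  have := Finset.card_le_two (a := T.leaf a) (b := T.leaf c)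
  simp at h2
  omega

lemma exists_nbr (a : Fin n) : ∃ w, T.G.Adj (T.leaf a) w := by
  obtain ⟨w, hw⟩ := Finset.card_eq_one.1 (ch_card_root T a)
  have : w ∈ ch T.tree (T.leaf a) (T.leaf a) := by rw [hw]; simp
  exact ⟨w, ((mem_ch _).1 this).1⟩

lemma star_lam (hn : 4 ≤ n) (hs : T.IsStar) (a b : Fin n) (hab : a ≠ b) :
    T.lam a b = ((n : ℝ) - 1)⁻¹ := by
  obtain ⟨v, hv, hu⟩ := hs
  have hadj : ∀ a, T.G.Adj (T.leaf a) v := by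
    intro a
    obtain ⟨w, hw⟩ := exists_nbr T a
    have := hu w (nbr_internal T hn a w hw)
    exact this ▸ hw
  have hl : ∀ b, b ≠ a → T.lam a b = gT T v := by
    intro b hb
    rw [lam_eq, pth_mid T.tree (gT T) (hadj a) (hadj b).symm (fun e => hb (T.inj e).symm)]
    simp [gT_leaf]
  have k := lam_kraft T a
  have : ∑ b, (if b = a then 0 else 1) * T.lam a b = ∑ b, (if b = a then 0 else 1) * gT T v := by
    refine Finset.sum_congr rfl fun b _ => ?_
    by_cases hb : b = a
    · simp [hb]
    · rw [hl b hb]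
  rw [this, ← Finset.sum_mul, Finset.sum_ite] at k
  simp [Finset.filter_ne', Finset.card_erase_of_mem] at k
  rw [hl b hab.symm]
  rw [Nat.cast_sub (by omega)] at k
  exact eq_inv_of_mul_eq_one_right (by simpa using k)

lemma exists_split (hn : 4 ≤ n) (hs : ¬ T.IsStar) :
    ∃ A : Finset (Fin n), 2 ≤ A.card ∧ 2 ≤ Aᶜ.card ∧ ∑ x ∈ A, ∑ y ∈ Aᶜ, T.lam x y = 1 := by
  let r : Fin n := ⟨0, by omega⟩
  let I : Finset T.V := Finset.univ.filter fun v => ∀ i, T.leaf i ≠ v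
  have hI : I.Nonempty := by
    obtain ⟨w, hw⟩ := exists_nbr T r
    exact ⟨w, by simpa [I] using nbr_internal T hn r w hw⟩
  obtain ⟨w, hwI, hwmin⟩ := I.exists_min_image (fun v => (below T.tree (T.leaf r) v).card) hI
  have hwi : ∀ i, T.leaf i ≠ w := by simpa [I] using hwI
  have hI2 : (I.erase w).Nonempty := by
    by_contra hne
    rw [Finset.not_nonempty_iff_eq_empty] at hne
    apply hs
    refine ⟨w, hwi, fun u hu => ?_⟩
    by_contra huw
    have : u ∈ I.erase w := Finset.mem_erase.2 ⟨huw, by simpa [I] using hu⟩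
    rw [hne] at this; simp at this
  obtain ⟨u, huI, humin⟩ :=
    (I.erase w).exists_min_image (fun v => (below T.tree (T.leaf r) v).card) hI2
  have huw : u ≠ w := Finset.ne_of_mem_erase huI
  have hui : ∀ i, T.leaf i ≠ u := by simpa [I] using Finset.mem_of_mem_erase huI
  have hwch : ∀ x ∈ ch T.tree (T.leaf r) w, ∃ i, T.leaf i = x := by
    intro x hx
    by_contra hne
    push Not at hne
    have := hwmin x (by simpa [I] using hne)
    have := card_below_lt T.tree hx
    omega
  let A : Finset (Fin n) := Finset.univ.filter fun a => T.leaf a ∈ ch T.tree (T.leaf r) w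
  have hAm : ∀ a, a ∈ A ↔ T.leaf a ∈ ch T.tree (T.leaf r) w := fun a => by simp [A]
  have hAc : A.card = (ch T.tree (T.leaf r) w).card := by
    rw [← Finset.card_image_of_injective A T.inj]
    congr 1
    ext x
    simp only [Finset.mem_image, hAm]
    constructor
    · rintro ⟨a, h, rfl⟩; exact h
    · intro h
      obtain ⟨i, rfl⟩ := hwch x h
      exact ⟨i, h, rfl⟩
  obtain ⟨hw2, hwg⟩ := ch_int T r w hwi
  refine ⟨A, by omega, ?_, ?_⟩
  · obtain ⟨x, hx, hxw⟩ := Finset.exists_mem_ne (ch_int T r u hui).1 w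
    have : ∃ b, T.leaf b = x := by
      by_contra hne
      push Not at hne
      have := humin x (Finset.mem_erase.2 ⟨hxw, by simpa [I] using hne⟩)
      have := card_below_lt T.tree hx
      omega
    obtain ⟨b, rfl⟩ := this
    have h1 : r ∈ Aᶜ := by
      rw [Finset.mem_compl, hAm]; exact root_not_ch T.tree
    have h2 : b ∈ Aᶜ := by
      rw [Finset.mem_compl, hAm]
      intro hb
      exact huw (ch_parent T.tree hx hb)
    have h3 : r ≠ b := by
      rintro h
      rw [← h] at hx
      exact root_not_ch T.tree hx
    exact Finset.one_lt_card.2 ⟨r, h1, b, h2, h3⟩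
  · have hrow : ∀ a ∈ A, ∑ y ∈ Aᶜ, T.lam a y = gT T w := by
      intro a ha
      have k := lam_kraft T a
      rw [← Finset.sum_add_sum_compl A, ← Finset.add_sum_erase A _ ha] at k
      have e1 : ∑ y ∈ A.erase a, (if y = a then 0 else 1) * T.lam a y
          = ∑ y ∈ A.erase a, gT T w := by
        refine Finset.sum_congr rfl fun y hy => ?_
        have hya := Finset.ne_of_mem_erase hy
        have hyA := Finset.mem_of_mem_erase hy
        rw [if_neg hya, lam_eq, pth_mid T.tree (gT T) ((mem_ch _).1 ((hAm a).1 ha)).1.symm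
          ((mem_ch _).1 ((hAm y).1 hyA)).1 (fun e => hya (T.inj e).symm)]
        simp [gT_leaf]
      have e2 : ∑ y ∈ Aᶜ, (if y = a then 0 else 1) * T.lam a y = ∑ y ∈ Aᶜ, T.lam a y := by
        refine Finset.sum_congr rfl fun y hy => ?_
        rw [if_neg, one_mul]
        rintro rfl
        exact (Finset.mem_compl.1 hy) ha
      rw [e1, e2, Finset.sum_const, nsmul_eq_mul] at k
      have hc : ((A.erase a).card : ℝ) + 1 = A.card := by
        exact_mod_cast Finset.card_erase_add_one ha
      rw [← hAc] at hwg
      simp only [if_true, zero_mul, zero_add] at k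
      have : ((A.erase a).card : ℝ) = A.card - 1 := by linarith
      rw [this] at k
      linarith
    rw [Finset.sum_congr rfl hrow, Finset.sum_const, nsmul_eq_mul, hAc, mul_comm]
    exact hwg

/-- relabelling -/
def relabel (σ : Equiv.Perm (Fin n)) : PhyloTree n where
  V := T.V
  fin := T.fin
  G := T.G
  tree := T.tree
  leaf := fun i => T.leaf (σ i)
  inj := T.inj.comp σ.injective
  leafDeg := fun i => T.leafDeg _
  leafAll := fun v hv => by
    obtain ⟨i, hi⟩ := T.leafAll v hv
    exact ⟨σ.symm i, by simpa using hi⟩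
  internalDeg := fun v hv => T.internalDeg v fun i => by simpa using hv (σ.symm i)

lemma relabel_lam (σ : Equiv.Perm (Fin n)) (a b : Fin n) :
    (relabel T σ).lam a b = T.lam (σ a) (σ b) := by
  have hg : gT (relabel T σ) = gT T := by
    funext v
    unfold gT
    have : (∀ i, (relabel T σ).leaf i ≠ v) ↔ ∀ i, T.leaf i ≠ v :=
      ⟨fun h i => by simpa [relabel] using h (σ.symm i), fun h i => h (σ i)⟩
    simp only [this]
    rfl
  rw [lam_eq, lam_eq, hg]
  rfl

end phylo

section conv
variable {n : ℕ}

lemma mem_ri {E : Type*} [NormedAddCommGroup E] [NormedSpace ℝ E] (P : Set E) (x : E) :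
    x ∈ intrinsicInterior ℝ P ↔ x ∈ affineSpan ℝ P ∧
      ∃ ε > 0, ∀ y ∈ affineSpan ℝ P, dist y x < ε → y ∈ P := by
  rw [mem_intrinsicInterior]
  constructor
  · rintro ⟨y, hy, rfl⟩
    refine ⟨y.2, ?_⟩
    rw [mem_interior_iff_mem_nhds, Metric.mem_nhds_iff] at hy
    obtain ⟨ε, hε, hb⟩ := hy
    refine ⟨ε, hε, fun z hz hd => ?_⟩
    exact hb (show (⟨z, hz⟩ : affineSpan ℝ P) ∈ Metric.ball y ε from hd)
  · rintro ⟨hx, ε, hε, h⟩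
    refine ⟨⟨x, hx⟩, ?_, rfl⟩
    rw [mem_interior_iff_mem_nhds, Metric.mem_nhds_iff]
    exact ⟨ε, hε, fun z hz => h z z.2 hz⟩

/-- matrix entry functional -/
noncomputable def exL (a b : Fin n) : (LeafPairs n → ℝ) →ₗ[ℝ] ℝ :=
  if h : a < b then LinearMap.proj (⟨(a, b), h⟩ : LeafPairs n)
  else if h : b < a then LinearMap.proj (⟨(b, a), h⟩ : LeafPairs n) else 0

lemma exL_bme (T : PhyloTree n) (a b : Fin n) :
    exL a b T.bmeVec = (if b = a then 0 else 1) * T.lam a b := by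
  unfold exL
  rcases lt_trichotomy a b with h | h | h
  · simp [h, h.ne', PhyloTree.bmeVec]
  · simp [h]
  · simp [h, h.ne, h.not_gt, PhyloTree.bmeVec, lam_comm T a b]

lemma exL_const (κ : ℝ) (a b : Fin n) :
    exL a b (fun _ => κ) = if b = a then 0 else κ := by
  unfold exL
  rcases lt_trichotomy a b with h | h | h
  · simp [h, h.ne']
  · simp [h]
  · simp [h, h.ne, h.not_gt]

lemma exL_pair (p : LeafPairs n) (x : LeafPairs n → ℝ) : exL p.1.1 p.1.2 x = x p := by
  unfold exL; rw [dif_pos p.2]; rfl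

lemma exL_self (a : Fin n) (x : LeafPairs n → ℝ) : exL a a x = 0 := by
  unfold exL; simp

lemma bme_mem (T : PhyloTree n) : T.bmeVec ∈ bmePolytope n :=
  subset_convexHull ℝ _ ⟨T, rfl⟩

lemma kraft_P (a : Fin n) (x : LeafPairs n → ℝ) (hx : x ∈ bmePolytope n) :
    ∑ b, exL a b x = 1 := by
  have hc : Convex ℝ {x : LeafPairs n → ℝ | (∑ b, exL a b) x = 1} :=
    convex_hyperplane (LinearMap.isLinear _) 1
  have := convexHull_min (s := {x | ∃ T : PhyloTree n, T.bmeVec = x}) (t := _) (by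
    rintro _ ⟨T, rfl⟩
    simp only [Set.mem_setOf_eq, LinearMap.sum_apply, exL_bme]
    exact lam_kraft T a) hc hx
  simpa using this

/-- cross functional -/
noncomputable def crL (A : Finset (Fin n)) : (LeafPairs n → ℝ) →ₗ[ℝ] ℝ :=
  ∑ a ∈ A, ∑ b ∈ Aᶜ, exL a b

lemma crL_bme (A : Finset (Fin n)) (T : PhyloTree n) :
    crL A T.bmeVec = ∑ a ∈ A, ∑ b ∈ Aᶜ, T.lam a b := by
  simp only [crL, LinearMap.sum_apply, exL_bme]
  refine Finset.sum_congr rfl fun a ha => Finset.sum_congr rfl fun b hb => ?_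
  rw [if_neg, one_mul]
  rintro rfl
  exact Finset.mem_compl.1 hb ha

lemma cross_P (A : Finset (Fin n)) (a r : Fin n) (ha : a ∈ A) (hr : r ∉ A)
    (x : LeafPairs n → ℝ) (hx : x ∈ bmePolytope n) : 1 ≤ crL A x := by
  have hc : Convex ℝ {x : LeafPairs n → ℝ | 1 ≤ crL A x} :=
    convex_halfSpace_ge (LinearMap.isLinear _) 1
  exact convexHull_min (s := {x | ∃ T : PhyloTree n, T.bmeVec = x}) (t := _) (by
    rintro _ ⟨T, rfl⟩
    rw [Set.mem_setOf_eq, crL_bme]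
    exact lam_cross T A a r ha hr) hc hx

/-- permutation action -/
noncomputable def peL (σ : Equiv.Perm (Fin n)) : (LeafPairs n → ℝ) →ₗ[ℝ] (LeafPairs n → ℝ) :=
  LinearMap.pi fun p => exL (σ p.1.1) (σ p.1.2)

lemma peL_P (σ : Equiv.Perm (Fin n)) (x : LeafPairs n → ℝ) (hx : x ∈ bmePolytope n) :
    peL σ x ∈ bmePolytope n := by
  have hc : Convex ℝ ((peL σ) ⁻¹' (bmePolytope n)) :=
    (convex_convexHull ℝ _).linear_preimage (peL σ)
  exact convexHull_min (s := {x | ∃ T : PhyloTree n, T.bmeVec = x}) (t := _) (by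
    rintro _ ⟨T, rfl⟩
    rw [Set.mem_preimage]
    have : peL σ T.bmeVec = (relabel T σ).bmeVec := by
      funext p
      have hne : σ p.1.2 ≠ σ p.1.1 := fun e => p.2.ne' (σ.injective e)
      simp only [peL, LinearMap.pi_apply, exL_bme, PhyloTree.bmeVec, relabel_lam]
      rw [if_neg hne, one_mul]
    rw [this]
    exact bme_mem _) hc hx

lemma avg_eq (hn : 4 ≤ n) (x : LeafPairs n → ℝ) (hx : x ∈ bmePolytope n) :
    ∑ σ : Equiv.Perm (Fin n), peL σ x =
      fun _ => (Fintype.card (Equiv.Perm (Fin n)) : ℝ) * ((n : ℝ) - 1)⁻¹ := by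
  set B : Fin n → Fin n → ℝ := fun a b => ∑ σ : Equiv.Perm (Fin n), exL (σ a) (σ b) x with hB
  have hBt : ∀ a b c d, a ≠ b → c ≠ d → B c d = B a b := by
    intro a b c d hab hcd
    obtain ⟨τ, h1, h2⟩ : ∃ τ : Equiv.Perm (Fin n), τ a = c ∧ τ b = d := by
      refine ⟨Equiv.swap (Equiv.swap a c b) d * Equiv.swap a c, ?_, ?_⟩
      · simp only [Equiv.Perm.mul_apply, Equiv.swap_apply_left]
        refine Equiv.swap_apply_of_ne_of_ne ?_ hcd
        intro e
        have : Equiv.swap a c a = Equiv.swap a c b := by rw [Equiv.swap_apply_left]; exact e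
        exact hab ((Equiv.swap a c).injective this)
      · simp
    simp only [hB, ← h1, ← h2]
    exact Equiv.sum_comp (Equiv.mulRight τ) (fun σ : Equiv.Perm (Fin n) => exL (σ a) (σ b) x)
  funext p
  have e : (∑ σ : Equiv.Perm (Fin n), peL σ x) p = B p.1.1 p.1.2 := by
    simp [hB, peL]
  rw [e]
  have hs : ∑ b, B p.1.1 b = (Fintype.card (Equiv.Perm (Fin n)) : ℝ) := by
    simp only [hB]
    rw [Finset.sum_comm]
    have : ∀ σ : Equiv.Perm (Fin n), ∑ b, exL (σ p.1.1) (σ b) x = 1 := fun σ => by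
      rw [Equiv.sum_comp σ (fun b => exL (σ p.1.1) b x)]
      exact kraft_P _ x hx
    simp [this]
  rw [← Finset.add_sum_erase _ _ (Finset.mem_univ p.1.1)] at hs
  have h0 : B p.1.1 p.1.1 = 0 := by simp [hB, exL_self]
  rw [h0, zero_add, Finset.sum_congr rfl (g := fun _ => B p.1.1 p.1.2)] at hs
  · rw [Finset.sum_const, Finset.card_erase_of_mem (Finset.mem_univ _), Finset.card_univ,
      Fintype.card_fin, nsmul_eq_mul, Nat.cast_sub (by omega)] at hs
    have : (n : ℝ) - 1 ≠ 0 := by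
      have : (4 : ℝ) ≤ n := by exact_mod_cast hn
      linarith
    rw [← hs]
    field_simp
    push_cast; ring
  · intro b hb
    exact hBt _ _ _ _ p.2.ne (Finset.ne_of_mem_erase hb).symm

lemma const_ri (hn : 4 ≤ n) (hne : (bmePolytope n).Nonempty) :
    (fun _ => ((n : ℝ) - 1)⁻¹) ∈ intrinsicInterior ℝ (bmePolytope n) := by
  have hcv : Convex ℝ (bmePolytope n) := convex_convexHull ℝ _
  obtain ⟨x, hx⟩ := hne.intrinsicInterior hcv
  have hxP := intrinsicInterior_subset hx
  rw [mem_ri] at hx ⊢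
  obtain ⟨hxs, ε, hε, hb⟩ := hx
  set N : ℝ := (Fintype.card (Equiv.Perm (Fin n)) : ℝ) with hN
  have hN0 : 0 < N := by rw [hN]; exact_mod_cast Fintype.card_pos
  set y : LeafPairs n → ℝ := fun _ => ((n : ℝ) - 1)⁻¹ with hy
  have havg : ∑ σ : Equiv.Perm (Fin n), peL σ x = N • y := by
    rw [avg_eq hn x hxP]; funext p; simp [hy, hN]
  have hone : peL (1 : Equiv.Perm (Fin n)) x = x := by
    funext p; simp [peL, exL_pair]
  -- combos
  have key : ∀ z ∈ bmePolytope n, y + N⁻¹ • (z - x) ∈ bmePolytope n := by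
    intro z hz
    have hm := hcv.sum_mem (t := Finset.univ) (w := fun _ : Equiv.Perm (Fin n) => N⁻¹)
      (z := fun σ => if σ = 1 then z else peL σ x) (fun _ _ => inv_nonneg.2 hN0.le)
      (by simp [← hN, hN0.ne']) (by
        intro σ _
        split_ifs
        · exact hz
        · exact peL_P σ x hxP)
    convert hm using 1
    rw [← Finset.smul_sum]
    rw [← Finset.add_sum_erase _ _ (Finset.mem_univ 1)] at havg ⊢
    rw [hone] at havg
    rw [Finset.sum_congr rfl (g := fun σ => peL σ x) (fun σ hσ => if_neg (Finset.ne_of_mem_erase hσ))]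
    rw [if_pos rfl]
    have : ∑ σ ∈ Finset.univ.erase (1 : Equiv.Perm (Fin n)), peL σ x = N • y - x := by
      rw [← havg]; abel
    rw [this]
    have : y = N⁻¹ • (N • y) := by rw [smul_smul, inv_mul_cancel₀ hN0.ne', one_smul]
    conv_lhs => rw [this]
    rw [← smul_add]; congr 1; abel
  have hyP : y ∈ bmePolytope n := by
    have := key x hxP; simpa using this
  refine ⟨subset_affineSpan ℝ _ hyP, ε / N, by positivity, fun y' hy' hd => ?_⟩
  have hz : x + N • (y' - y) ∈ bmePolytope n := by
    apply hb
    · have := AffineSubspace.vadd_mem_of_mem_direction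
        ((affineSpan ℝ (bmePolytope n)).direction.smul_mem N
          (AffineSubspace.vsub_mem_direction hy' (subset_affineSpan ℝ _ hyP))) hxs
      simpa [add_comm] using this
    · rw [dist_eq_norm, add_sub_cancel_left, norm_smul, Real.norm_of_nonneg hN0.le, ← dist_eq_norm]
      rw [lt_div_iff₀ hN0] at hd
      linarith
  have := key _ hz
  rw [add_sub_cancel_left, smul_smul, inv_mul_cancel₀ hN0.ne', one_smul] at this
  simpa using this

lemma boundary (hn : 4 ≤ n) (T : PhyloTree n) (hs : ¬ T.IsStar) :
    T.bmeVec ∈ intrinsicFrontier ℝ (bmePolytope n) := by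
  have hTP := bme_mem T
  have hcl := subset_intrinsicClosure (𝕜 := ℝ) hTP
  rw [← intrinsicInterior_union_intrinsicFrontier] at hcl
  refine hcl.resolve_left fun hri => ?_
  obtain ⟨A, h2, h2', hA⟩ := exists_split T hn hs
  obtain ⟨a, ha⟩ := Finset.card_pos.1 (show 0 < A.card by omega)
  obtain ⟨r, hr⟩ := Finset.card_pos.1 (show 0 < Aᶜ.card by omega)
  rw [Finset.mem_compl] at hr
  set y : LeafPairs n → ℝ := fun _ => ((n : ℝ) - 1)⁻¹ with hy
  have hyP : y ∈ bmePolytope n := intrinsicInterior_subset (const_ri hn ⟨_, hTP⟩)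
  rw [← crL_bme] at hA
  have hcy : 1 < crL A y := by
    have e : crL A y = A.card * (Aᶜ.card * ((n : ℝ) - 1)⁻¹) := by
      simp only [crL, LinearMap.sum_apply, hy, exL_const]
      rw [Finset.sum_congr rfl (g := fun _ => (Aᶜ.card * ((n : ℝ) - 1)⁻¹)), Finset.sum_const,
        nsmul_eq_mul]
      intro a ha
      rw [Finset.sum_congr rfl (g := fun _ => ((n : ℝ) - 1)⁻¹), Finset.sum_const, nsmul_eq_mul]
      intro b hb
      rw [if_neg]
      rintro rfl
      exact Finset.mem_compl.1 hb ha
    have hc : (A.card : ℝ) + Aᶜ.card = n := by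
      have := Finset.card_add_card_compl A
      rw [Fintype.card_fin] at this
      exact_mod_cast this
    have g1 : (2 : ℝ) ≤ A.card := by exact_mod_cast h2
    have g2 : (2 : ℝ) ≤ Aᶜ.card := by exact_mod_cast h2'
    rw [e, ← mul_assoc, ← div_eq_mul_inv, lt_div_iff₀ (by linarith)]
    nlinarith
  rw [mem_ri] at hri
  obtain ⟨hxs, ε, hε, hb⟩ := hri
  set x := T.bmeVec
  obtain ⟨t, ht, htd⟩ : ∃ t : ℝ, 0 < t ∧ t * ‖x - y‖ < ε := by
    refine ⟨ε / (‖x - y‖ + 1), by positivity, ?_⟩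
    rw [div_mul_eq_mul_div, div_lt_iff₀ (by positivity)]
    nlinarith [norm_nonneg (x - y)]
  have hz : x + t • (x - y) ∈ bmePolytope n := by
    apply hb
    · have := AffineSubspace.vadd_mem_of_mem_direction
        ((affineSpan ℝ (bmePolytope n)).direction.smul_mem t
          (AffineSubspace.vsub_mem_direction hxs (subset_affineSpan ℝ _ hyP))) hxs
      simpa [add_comm] using this
    · rw [dist_eq_norm, add_sub_cancel_left, norm_smul, Real.norm_of_nonneg ht.le]
      exact htd
  have := cross_P A a r ha hr _ hz
  rw [map_add, map_smul, map_sub, hA, smul_eq_mul] at this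
  nlinarith

end conv
end BMEProof

/-- For `n ≥ 4`: the BME vector of the star tree (the tree with a single internal
vertex, whose BME vector has every entry `1/(n-1)`) lies in the relative interior of
the BME polytope; and the BME vector of every phylogenetic tree that is neither binary
nor the star tree lies on the relative boundary of the BME polytope. -/
theorem star_interior_others_boundary (n : ℕ) (hn : 4 ≤ n) :
    (∀ T : PhyloTree n, T.IsStar →
      T.bmeVec = (fun _ => ((n : ℝ) - 1)⁻¹) ∧
      T.bmeVec ∈ intrinsicInterior ℝ (bmePolytope n)) ∧
    (∀ T : PhyloTree n, ¬T.IsBinary → ¬T.IsStar →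
      T.bmeVec ∈ intrinsicFrontier ℝ (bmePolytope n)) := by
  refine ⟨fun T hT => ?_, fun T _ hs => BMEProof.boundary hn T hs⟩
  have e : T.bmeVec = (fun _ => ((n : ℝ) - 1)⁻¹) := by
    funext p
    exact BMEProof.star_lam T hn hT _ _ p.2.ne
  refine ⟨e, ?_⟩
  rw [e]
  exact BMEProof.const_ri hn ⟨_, BMEProof.bme_mem T⟩
end

section
/- For n ∈ {4, 5, 6}, the edge graph of the BME polytope is complete: for any two binary phylogenetic trees T₁ and T₂ on leaf set {1,…,n} with distinct BME vectors v_{T₁} ≠ v_{T₂}, there exists a dissimilarity map D ∈ ℝ^{n(n−1)/2} such that v_{T₁}·D = v_{T₂}·D and v_{T₁}·D < v_T·D for every binary phylogenetic tree T on {1,…,n} with v_T ∉ {v_{T₁}, v_{T₂}}. In other words, there is a dissimilarity map for which T₁ and T₂ are the only co-optimal BME trees. -/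
namespace BME

open Finset

/-! ### Generic facts on trees -/

section tree

variable {V : Type} {G : SimpleGraph V}

lemma length_eq_dist (hG : G.IsTree) {u v : V} (p : G.Walk u v) (hp : p.IsPath) :
    p.length = G.dist u v := by
  obtain ⟨q, hq, hl⟩ := hG.1.exists_path_of_dist u v
  rw [← hl, (hG.existsUnique_path u v).unique hp hq]

lemma walk_parity (hG : G.IsTree) (r : V) {u v : V} (p : G.Walk u v) :
    Even (p.length + G.dist r u + G.dist r v) := by
  induction p with
  | nil => simp [← two_mul]
  | cons h q ih =>
    have := hG.dist_eq_dist_add_one_of_adj r h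
    simp only [SimpleGraph.Walk.length_cons]
    grind

lemma dist_parity (hG : G.IsTree) (a b c : V) :
    Even (G.dist a b + G.dist a c + G.dist b c) := by
  obtain ⟨p, hp⟩ := hG.1.exists_walk_length_eq_dist b c
  have := walk_parity hG a p
  grind

/-- Every vertex other than the root has exactly one parent. -/
lemma existsUnique_parent (hG : G.IsTree) (r v : V) (hv : v ≠ r) :
    ∃! w, G.Adj v w ∧ G.dist r w + 1 = G.dist r v := by
  obtain ⟨p, hp⟩ := hG.1.exists_walk_length_eq_dist v r
  cases p with
  | nil => exact absurd rfl hv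
  | @cons _ w _ h q =>
    refine ⟨w, ⟨h, ?_⟩, ?_⟩
    · have h1 := hG.dist_eq_dist_add_one_of_adj r h
      have h2 := SimpleGraph.dist_le q
      rw [SimpleGraph.dist_comm (u := w)] at h2
      rw [SimpleGraph.dist_comm (u := v)] at hp
      simp only [SimpleGraph.Walk.length_cons] at hp
      omega
    · rintro w' ⟨h', hd⟩
      obtain ⟨q', hq'⟩ := hG.1.exists_walk_length_eq_dist w' r
      have e1 : (SimpleGraph.Walk.cons h q).IsPath :=
        SimpleGraph.Walk.isPath_of_length_eq_dist _ hp
      have e2 : (SimpleGraph.Walk.cons h' q').IsPath := by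
        apply SimpleGraph.Walk.isPath_of_length_eq_dist
        rw [SimpleGraph.Walk.length_cons, hq', SimpleGraph.dist_comm (u := w'), hd,
          SimpleGraph.dist_comm]
      have := (hG.existsUnique_path v r).unique e1 e2
      have h3 := congrArg SimpleGraph.Walk.snd this
      simpa using h3.symm

variable [Fintype V] [DecidableEq V] [DecidableRel G.Adj]

lemma sum_neighbors (hG : G.IsTree) (r v : V) (hv : v ≠ r) :
    ∑ w ∈ G.neighborFinset v, ((1 / 2 : ℝ) ^ G.dist r w) =
      (1 / 2 : ℝ) ^ G.dist r v * (2 + ((G.degree v : ℝ) - 1) / 2) := by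
  obtain ⟨w, ⟨hw, hd⟩, hu⟩ := existsUnique_parent hG r v hv
  have hm : w ∈ G.neighborFinset v := by simpa using hw
  rw [← Finset.add_sum_erase _ _ hm]
  have : ∑ x ∈ (G.neighborFinset v).erase w, ((1 / 2 : ℝ) ^ G.dist r x) =
      ∑ x ∈ (G.neighborFinset v).erase w, (1 / 2 : ℝ) ^ G.dist r v / 2 := by
    refine Finset.sum_congr rfl fun x hx => ?_
    rw [Finset.mem_erase, SimpleGraph.mem_neighborFinset] at hx
    have h1 := hG.dist_eq_dist_add_one_of_adj r hx.2
    have h2 : ¬ (G.dist r x + 1 = G.dist r v) := fun h => hx.1 (hu x ⟨hx.2, h⟩)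
    have h3 : G.dist r x = G.dist r v + 1 := by omega
    rw [h3, pow_succ]; ring
  rw [this, Finset.sum_const, Finset.card_erase_of_mem hm, SimpleGraph.card_neighborFinset_eq_degree]
  have hpos : 1 ≤ G.degree v := by
    rw [← SimpleGraph.card_neighborFinset_eq_degree]; exact Finset.card_pos.mpr ⟨w, hm⟩
  rw [nsmul_eq_mul, Nat.cast_sub hpos, ← hd, pow_succ]
  push_cast; ring

lemma sum_neighbors_root (r : V) :
    ∑ w ∈ G.neighborFinset r, ((1 / 2 : ℝ) ^ G.dist r w) = (G.degree r : ℝ) / 2 := by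
  have : ∑ x ∈ G.neighborFinset r, ((1 / 2 : ℝ) ^ G.dist r x) =
      ∑ x ∈ G.neighborFinset r, (1 / 2 : ℝ) := by
    refine Finset.sum_congr rfl fun x hx => ?_
    rw [SimpleGraph.mem_neighborFinset] at hx
    rw [SimpleGraph.dist_eq_one_iff_adj.mpr hx, pow_one]
  rw [this, Finset.sum_const, SimpleGraph.card_neighborFinset_eq_degree, nsmul_eq_mul]; ring

lemma sum_laplacian (f : V → ℝ) :
    ∑ v, ((∑ w ∈ G.neighborFinset v, f w) - G.degree v * f v) = 0 := by
  rw [Finset.sum_sub_distrib, sub_eq_zero]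
  have h : ∀ v, ∑ w ∈ G.neighborFinset v, f w = ∑ w, if G.Adj v w then f w else 0 := by
    intro v; rw [← Finset.sum_filter, SimpleGraph.neighborFinset_eq_filter]
  simp_rw [h]
  rw [Finset.sum_comm]
  refine Finset.sum_congr rfl fun v _ => ?_
  simp_rw [G.adj_comm _ v]
  rw [← Finset.sum_filter, ← SimpleGraph.neighborFinset_eq_filter, Finset.sum_const,
    SimpleGraph.card_neighborFinset_eq_degree, nsmul_eq_mul]

end tree

/-! ### The combinatorial data of a binary phylogenetic tree -/

/-- Number of internal vertices on the path between two leaves. -/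
noncomputable def kf {n : ℕ} (T : PhyloTree n) (a b : Fin n) : ℕ :=
  T.G.dist (T.leaf a) (T.leaf b) - 1

structure Good (n : ℕ) (k : Fin n → Fin n → ℕ) : Prop where
  symm : ∀ a b, k a b = k b a
  pos : ∀ a b, a ≠ b → 1 ≤ k a b
  le : ∀ a b, a ≠ b → k a b ≤ n - 2
  kraft : ∀ a, ∑ b, (if b = a then 0 else 2 ^ (n - 2 - k a b)) = 2 ^ (n - 2)
  par : ∀ a b c, a ≠ b → a ≠ c → b ≠ c → (k a b + k a c + k b c) % 2 = 1
  cherry : ∃ a b, a ≠ b ∧ k a b = 1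

section phylo

variable {n : ℕ} (T : PhyloTree n)

lemma leaf_unique_nbr (i : Fin n) {x y : T.V} (hx : T.G.Adj (T.leaf i) x)
    (hy : T.G.Adj (T.leaf i) y) : x = y := by
  obtain ⟨z, hz⟩ := Set.ncard_eq_one.mp (T.leafDeg i)
  have h1 : x ∈ T.G.neighborSet (T.leaf i) := hx
  have h2 : y ∈ T.G.neighborSet (T.leaf i) := hy
  rw [hz] at h1 h2
  exact h1.trans h2.symm

open Classical in
lemma count_internal {x y : T.V} (p : T.G.Walk x y) (hp : p.IsPath) (hy : ∃ b, T.leaf b = y)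
    (hx : ∀ i, T.leaf i ≠ x) :
    p.support.countP (fun v => ∀ i, T.leaf i ≠ v) = p.length := by
  induction p with
  | nil => obtain ⟨b, hb⟩ := hy; exact absurd hb (hx b)
  | @cons u v w h q ih =>
    rw [SimpleGraph.Walk.cons_isPath_iff] at hp
    rw [SimpleGraph.Walk.support_cons, List.countP_cons_of_pos (by simpa using hx),
      SimpleGraph.Walk.length_cons]
    by_cases hv : ∀ i, T.leaf i ≠ v
    · rw [ih hp.1 hy hv]
    · push Not at hv
      obtain ⟨i, hi⟩ := hv
      subst hi
      cases q with
      | nil => simp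
      | cons h' q' =>
        exfalso
        have := leaf_unique_nbr T i h.symm h'
        subst this
        apply hp.2
        simp

open Classical in
lemma count_internal' {a b : Fin n} (hab : a ≠ b) (p : T.G.Walk (T.leaf a) (T.leaf b))
    (hp : p.IsPath) :
    p.support.countP (fun v => ∀ i, T.leaf i ≠ v) = p.length - 1 := by
  generalize hx : T.leaf a = x at p
  generalize hy : T.leaf b = y at p
  cases p with
  | nil => exact absurd (T.inj (hx.trans hy.symm)) hab
  | @cons u v w h q =>
    rw [SimpleGraph.Walk.cons_isPath_iff] at hp
    rw [SimpleGraph.Walk.support_cons, List.countP_cons_of_neg (by simpa using ⟨a, hx⟩),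
      SimpleGraph.Walk.length_cons, Nat.add_sub_cancel]
    by_cases hv : ∀ i, T.leaf i ≠ v
    · exact count_internal T q hp.1 ⟨b, hy⟩ hv
    · push Not at hv
      obtain ⟨i, hi⟩ := hv
      subst hi
      cases q with
      | nil => simp
      | cons h' q' =>
        exfalso
        have := leaf_unique_nbr T i h.symm h'
        subst this
        apply hp.2
        simp

lemma prod_map_count {α : Type*} (l : List α) (P : α → Prop) [DecidablePred P] (f : α → ℝ)
    (hf : ∀ v, P v → f v = 1 / 2) (hf' : ∀ v, ¬ P v → f v = 1) :
    (l.map f).prod = (1 / 2 : ℝ) ^ l.countP (fun v => P v) := by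
  induction l with
  | nil => simp
  | cons x l ih =>
    by_cases h : P x
    · simp [h, hf x h, ih, pow_succ]; ring
    · simp [h, hf' x h, ih]

lemma lam_eq_s8 (hT : T.IsBinary) {a b : Fin n} (hab : a ≠ b) :
    T.lam a b = (1 / 2 : ℝ) ^ kf T a b := by
  classical
  unfold PhyloTree.lam kf
  have hp := (T.tree.existsUnique_path (T.leaf a) (T.leaf b)).choose_spec.1
  set p := (T.tree.existsUnique_path (T.leaf a) (T.leaf b)).choose
  rw [prod_map_count _ (fun v => ∀ i, T.leaf i ≠ v), count_internal' T hab p hp,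
    length_eq_dist T.tree p hp]
  · intro v hv
    rw [if_pos hv, hT v hv]; norm_num
  · intro v hv
    rw [if_neg hv]

open Classical in
lemma card_internal (hT : T.IsBinary) (hn : 2 ≤ n) [Fintype T.V] :
    (univ.filter (fun v => ∀ i, T.leaf i ≠ v)).card = n - 2 := by
  have h1 := T.tree.card_edgeFinset
  have h2 := T.G.sum_degrees_eq_twice_card_edges
  have hdeg : ∀ v, T.G.degree v = (T.G.neighborSet v).ncard := by
    intro v
    rw [Set.ncard_eq_toFinset_card', ← SimpleGraph.card_neighborFinset_eq_degree]; rfl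
  have hleaf : (univ.filter (fun v => ¬ ∀ i, T.leaf i ≠ v)).card = n := by
    have : univ.filter (fun v => ¬ ∀ i, T.leaf i ≠ v) = univ.image T.leaf := by
      ext v; simp
    rw [this, Finset.card_image_of_injective _ T.inj]; simp
  have h3 := Finset.card_filter_add_card_filter_not (s := (univ : Finset T.V))
    (fun v => ∀ i, T.leaf i ≠ v)
  rw [← Finset.sum_filter_add_sum_filter_not univ (fun v => ∀ i, T.leaf i ≠ v)] at h2
  have e1 : ∑ v ∈ univ.filter (fun v => ∀ i, T.leaf i ≠ v), T.G.degree v =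
      (univ.filter (fun v => ∀ i, T.leaf i ≠ v)).card * 3 := by
    rw [Finset.sum_const_nat]
    intro v hv
    rw [Finset.mem_filter] at hv
    rw [hdeg, hT v hv.2]
  have e2 : ∑ v ∈ univ.filter (fun v => ¬ ∀ i, T.leaf i ≠ v), T.G.degree v =
      (univ.filter (fun v => ¬ ∀ i, T.leaf i ≠ v)).card * 1 := by
    rw [Finset.sum_const_nat]
    intro v hv
    rw [Finset.mem_filter] at hv
    have := hv.2
    push Not at this
    obtain ⟨i, rfl⟩ := this
    rw [hdeg, T.leafDeg]
  rw [e1, e2, hleaf] at h2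
  rw [hleaf, Finset.card_univ] at h3
  omega

lemma kf_le (hT : T.IsBinary) (hn : 2 ≤ n) {a b : Fin n} (hab : a ≠ b) : kf T a b ≤ n - 2 := by
  classical
  have := T.fin
  obtain ⟨p, hp, -⟩ := T.tree.existsUnique_path (T.leaf a) (T.leaf b)
  have h := count_internal' T hab p hp
  unfold kf
  rw [← length_eq_dist T.tree p hp, ← h, ← card_internal T hT hn, List.countP_eq_length_filter,
    ← List.toFinset_card_of_nodup (hp.support_nodup.filter _)]
  apply Finset.card_le_card
  intro v hv
  simpa using (List.mem_filter.mp (List.mem_toFinset.mp hv)).2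

lemma kraft_real (hT : T.IsBinary) (a : Fin n) :
    ∑ b, (if b = a then 0 else (1 / 2 : ℝ) ^ kf T a b) = 1 := by
  classical
  have := T.fin
  have hdeg : ∀ v, T.G.degree v = (T.G.neighborSet v).ncard := by
    intro v
    rw [Set.ncard_eq_toFinset_card', ← SimpleGraph.card_neighborFinset_eq_degree]; rfl
  have h := sum_laplacian (G := T.G) (fun v => (1 / 2 : ℝ) ^ T.G.dist (T.leaf a) v)
  have key : ∀ v, (∑ w ∈ T.G.neighborFinset v, (1 / 2 : ℝ) ^ T.G.dist (T.leaf a) w) -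
      T.G.degree v * (1 / 2 : ℝ) ^ T.G.dist (T.leaf a) v =
      ∑ b, if T.leaf b = v then
        (if b = a then - 1 / 2 else (1 / 2 : ℝ) ^ T.G.dist (T.leaf a) (T.leaf b)) else 0 := by
    intro v
    by_cases hv : ∀ i, T.leaf i ≠ v
    · rw [sum_neighbors T.tree _ _ (hv a).symm, hdeg, hT v hv]
      simp only [hv, if_false, Finset.sum_const_zero]
      push_cast; ring
    · push Not at hv
      obtain ⟨i, rfl⟩ := hv
      have : ∀ b, (T.leaf b = T.leaf i) = (b = i) := fun b => by rw [T.inj.eq_iff]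
      simp only [this, Finset.sum_ite_eq', Finset.mem_univ, if_true]
      by_cases hi : i = a
      · subst hi
        rw [sum_neighbors_root, hdeg, T.leafDeg]; simp; norm_num
      · rw [sum_neighbors T.tree _ _ (fun h => hi (T.inj h)), hdeg, T.leafDeg, if_neg hi]
        push_cast; ring
  simp_rw [key] at h
  rw [Finset.sum_comm] at h
  simp only [Finset.sum_ite_eq, Finset.mem_univ, if_true] at h
  have e : ∀ b, (if b = a then - 1 / 2 else (1 / 2 : ℝ) ^ T.G.dist (T.leaf a) (T.leaf b)) =
      (1 / 2) * (if b = a then 0 else (1 / 2 : ℝ) ^ kf T a b) + (if b = a then -1 / 2 else 0) := by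
    intro b
    by_cases hb : b = a
    · simp [hb]
    · have : 0 < T.G.dist (T.leaf a) (T.leaf b) :=
        T.tree.1.pos_dist_of_ne (fun h => hb (T.inj h).symm)
      simp only [hb, if_false, kf]
      rw [add_zero, ← pow_succ', Nat.sub_add_cancel this]
  simp_rw [e, Finset.sum_add_distrib, ← Finset.mul_sum] at h
  simp only [Finset.sum_ite_eq', Finset.mem_univ, if_true] at h
  linarith

lemma good_kf (hT : T.IsBinary) (hn : 3 ≤ n) : Good n (kf T) := by
  classical
  have := T.fin
  have hk : ∀ a, ∑ b, (if b = a then 0 else 2 ^ (n - 2 - kf T a b)) = 2 ^ (n - 2) := by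
    intro a
    have h := kraft_real T hT a
    have : (∑ b, (if b = a then 0 else 2 ^ (n - 2 - kf T a b)) : ℝ) = 2 ^ (n - 2) := by
      rw [← mul_one ((2 : ℝ) ^ (n - 2)), ← h, Finset.mul_sum]
      refine Finset.sum_congr rfl fun b _ => ?_
      by_cases hb : b = a
      · simp [hb]
      · simp only [hb, if_false]
        rw [pow_sub₀ _ two_ne_zero (kf_le T hT (by omega) (Ne.symm hb))]
        simp
    exact_mod_cast this
  have hpos : ∀ a b, a ≠ b → 1 ≤ kf T a b := by
    intro a b hab
    by_contra hlt
    have h0 : kf T a b = 0 := by omega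
    obtain ⟨c, hca, hcb⟩ : ∃ c, c ≠ a ∧ c ≠ b := by
      have : ∃ c, c ∉ ({a, b} : Finset (Fin n)) := by
        by_contra hcon
        push Not at hcon
        have h1 := Finset.card_le_card (fun x (_ : x ∈ univ) => hcon x)
        have h2 := Finset.card_le_two (a := a) (b := b)
        simp at h1
        omega
      simpa using this
    have h := hk a
    have hle : ∑ x ∈ ({b, c} : Finset (Fin n)), (if x = a then 0 else 2 ^ (n - 2 - kf T a x))
        ≤ 2 ^ (n - 2) := by
      rw [← h]
      exact Finset.sum_le_sum_of_subset (Finset.subset_univ _)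
    rw [Finset.sum_pair (Ne.symm hcb), if_neg (Ne.symm hab), if_neg hca, h0] at hle
    have : 0 < 2 ^ (n - 2 - kf T a c) := by positivity
    simp at hle
  have hsymm : ∀ a b, kf T a b = kf T b a := fun a b => by
    unfold kf; rw [SimpleGraph.dist_comm]
  have hd : ∀ a b, a ≠ b → T.G.dist (T.leaf a) (T.leaf b) = kf T a b + 1 := by
    intro a b hab
    have := hpos a b hab
    unfold kf at *
    omega
  refine ⟨hsymm, hpos, fun a b hab => kf_le T hT (by omega) hab, hk, ?_, ?_⟩
  · intro a b c hab hac hbc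
    have := dist_parity T.tree (T.leaf a) (T.leaf b) (T.leaf c)
    rw [hd a b hab, hd a c hac, hd b c hbc, Nat.even_iff] at this
    omega
  · have hnb : ∀ i, ∃ x, T.G.Adj (T.leaf i) x := by
      intro i
      obtain ⟨z, hz⟩ := Set.ncard_eq_one.mp (T.leafDeg i)
      exact ⟨z, by rw [← SimpleGraph.mem_neighborSet, hz]; rfl⟩
    choose g hg using hnb
    have hmaps : ∀ i ∈ (univ : Finset (Fin n)), g i ∈ univ.filter (fun v => ∀ i, T.leaf i ≠ v) := by
      intro i _
      rw [Finset.mem_filter]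
      refine ⟨Finset.mem_univ _, fun j hj => ?_⟩
      have h1 := hg i
      rw [← hj, ← SimpleGraph.dist_eq_one_iff_adj] at h1
      by_cases hij : i = j
      · subst hij; simp at h1
      · have := hpos i j hij
        rw [hd i j hij] at h1
        omega
    have hcard : (univ.filter (fun v => ∀ i, T.leaf i ≠ v)).card < (univ : Finset (Fin n)).card := by
      rw [card_internal T hT (by omega)]; simp; omega
    obtain ⟨i, -, j, -, hij, he⟩ := Finset.exists_ne_map_eq_of_card_lt_of_maps_to hcard hmaps
    refine ⟨i, j, hij, le_antisymm ?_ (hpos i j hij)⟩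
    have h2 := SimpleGraph.dist_le
      (SimpleGraph.Walk.cons (hg i) (SimpleGraph.Walk.cons (he ▸ (hg j).symm) .nil))
    rw [hd i j hij] at h2
    simp at h2
    omega

end phylo

/-! ### Passing to lists -/

/-- The pairs `a < b`, row by row. -/
def upper (n : ℕ) : List (Fin n × Fin n) :=
  (List.finRange n ×ˢ List.finRange n).filter (fun p => p.1 < p.2)

/-- The upper triangle of a matrix, row by row. -/
def toL {n : ℕ} (k : Fin n → Fin n → ℕ) : List ℕ := (upper n).map fun p => k p.1 p.2

/-- Dot product; written with recursors and primitive operations so that it evaluates quickly. -/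
def dot (m : ℕ) (l : List ℕ) : List ℕ → ℕ :=
  List.rec (fun _ => 0) (fun x _ ih D => List.rec 0 (fun d D' _ =>
    Nat.add (Nat.mul (Nat.pow 2 (Nat.sub m x)) d) (ih D')) D) l

lemma dot_eq (m : ℕ) (l D : List ℕ) :
    dot m l D = (List.zipWith (fun x d => 2 ^ (m - x) * d) l D).sum := by
  induction l generalizing D with
  | nil => rfl
  | cons x l ih =>
    cases D with
    | nil => rfl
    | cons d D => rw [List.zipWith_cons_cons, List.sum_cons, ← ih]; rfl

def entry (m : ℕ) (t : List ℕ) (x y : ℕ) : ℕ := t.getD (Nat.add (Nat.mul m (Nat.sub x 1)) (Nat.sub y 1)) 0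

def mkD (m : ℕ) (t l₁ l₂ : List ℕ) : List ℕ := List.zipWith (entry m t) l₁ l₂

def imp (b c : Bool) : Bool := bif b then c else true

lemma imp_elim {P : Prop} [Decidable P] {c : Bool} (h : imp (decide P) c = true) (hP : P) :
    c = true := by
  simpa [imp, hP] using h

lemma all_elim {l : List ℕ} {f : ℕ → Bool} (h : l.all f = true) {x : ℕ} (hx : x ∈ l) :
    f x = true := List.all_eq_true.mp h x hx

lemma mem_upper {n : ℕ} {a b : Fin n} : (a, b) ∈ upper n ↔ a < b := by
  simp [upper]

lemma sum_upper {n : ℕ} (F : Fin n → Fin n → ℕ) :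
    ((upper n).map fun p => F p.1 p.2).sum = ∑ p : LeafPairs n, F p.1.1 p.1.2 := by
  have hnd : (upper n).Nodup :=
    ((List.nodup_finRange n).product (List.nodup_finRange n)).filter _
  rw [← List.sum_toFinset (fun p : Fin n × Fin n => F p.1 p.2) hnd]
  exact Finset.sum_subtype (f := fun p : Fin n × Fin n => F p.1 p.2) _
    (fun p => by rw [List.mem_toFinset]; exact mem_upper)

lemma sum_pairs_two {n : ℕ} (F : Fin n → Fin n → ℕ) (hF : ∀ a b, F a b = F b a) :
    2 * ∑ p : LeafPairs n, F p.1.1 p.1.2 = ∑ a, ∑ b, if a = b then 0 else F a b := by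
  have h1 : ∑ p : LeafPairs n, F p.1.1 p.1.2 = ∑ a, ∑ b, if a < b then F a b else 0 := by
    rw [← Finset.sum_subtype (p := fun p : Fin n × Fin n => p.1 < p.2)
      (f := fun p : Fin n × Fin n => F p.1 p.2) (Finset.univ.filter fun p => p.1 < p.2)
      (fun p => by simp), Finset.sum_filter, Fintype.sum_prod_type]
  have h2 : ∑ p : LeafPairs n, F p.1.1 p.1.2 = ∑ a, ∑ b, if b < a then F a b else 0 := by
    rw [h1, Finset.sum_comm]
    simp_rw [hF]
  rw [two_mul]
  nth_rewrite 1 [h1]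
  rw [h2, ← Finset.sum_add_distrib]
  refine Finset.sum_congr rfl fun a _ => ?_
  rw [← Finset.sum_add_distrib]
  refine Finset.sum_congr rfl fun b _ => ?_
  rcases lt_trichotomy a b with h | h | h
  · simp [h, h.ne, h.not_gt]
  · simp [h]
  · simp [h, h.ne', h.not_gt]

lemma sum_pairs_perm {n : ℕ} (F : Fin n → Fin n → ℕ) (hF : ∀ a b, F a b = F b a)
    (σ : Equiv.Perm (Fin n)) :
    ∑ p : LeafPairs n, F (σ p.1.1) (σ p.1.2) = ∑ p : LeafPairs n, F p.1.1 p.1.2 := by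
  have h1 := sum_pairs_two F hF
  have h2 := sum_pairs_two (fun a b => F (σ a) (σ b)) (fun a b => hF _ _)
  have h3 : (∑ a, ∑ b, if a = b then 0 else F (σ a) (σ b)) =
      ∑ a, ∑ b, if a = b then 0 else F a b := by
    rw [← Equiv.sum_comp σ (fun a => ∑ b, if a = b then 0 else F a b)]
    refine Finset.sum_congr rfl fun a _ => ?_
    rw [← Equiv.sum_comp σ (fun b => if σ a = b then 0 else F (σ a) b)]
    simp
  beta_reduce at h2
  omega

lemma toL_eq_iff {n : ℕ} {k k' : Fin n → Fin n → ℕ} (hk : Good n k) (hk' : Good n k') :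
    toL k = toL k' ↔ ∀ a b, a ≠ b → k a b = k' a b := by
  unfold toL
  rw [List.map_inj_left]
  constructor
  · intro h a b hab
    rcases lt_or_gt_of_ne hab with h1 | h1
    · exact h (a, b) (mem_upper.mpr h1)
    · rw [hk.symm, hk'.symm]; exact h (b, a) (mem_upper.mpr h1)
  · rintro h ⟨a, b⟩ hp
    exact h a b (mem_upper.mp hp).ne

lemma Good.relabel {n : ℕ} {k : Fin n → Fin n → ℕ} (hk : Good n k) (σ : Equiv.Perm (Fin n)) :
    Good n (fun a b => k (σ a) (σ b)) where
  symm a b := hk.symm _ _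
  pos a b h := hk.pos _ _ (fun e => h (σ.injective e))
  le a b h := hk.le _ _ (fun e => h (σ.injective e))
  kraft a := by
    rw [← hk.kraft (σ a), ← Equiv.sum_comp σ (fun b => if b = σ a then 0 else _)]
    simp
  par a b c h1 h2 h3 := hk.par _ _ _ (fun e => h1 (σ.injective e)) (fun e => h2 (σ.injective e))
    (fun e => h3 (σ.injective e))
  cherry := by
    obtain ⟨a, b, hab, h⟩ := hk.cherry
    exact ⟨σ.symm a, σ.symm b, fun e => hab (σ.symm.injective e), by simpa using h⟩

lemma mem_one {n : ℕ} {k : Fin n → Fin n → ℕ} (hk : Good n k) : 1 ∈ toL k := by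
  obtain ⟨a, b, hab, h⟩ := hk.cherry
  rw [toL, List.mem_map]
  rcases lt_or_gt_of_ne hab with h1 | h1
  · exact ⟨(a, b), mem_upper.mpr h1, h⟩
  · exact ⟨(b, a), mem_upper.mpr h1, by rw [← h]; exact hk.symm _ _⟩

lemma dot_mkD {n m : ℕ} (t : List ℕ) (k k₁ k₂ : Fin n → Fin n → ℕ) :
    dot m (toL k) (mkD m t (toL k₁) (toL k₂)) =
      ∑ p : LeafPairs n, 2 ^ (m - k p.1.1 p.1.2) *
        entry m t (k₁ p.1.1 p.1.2) (k₂ p.1.1 p.1.2) := by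
  rw [← sum_upper (fun a b => 2 ^ (m - k a b) * entry m t (k₁ a b) (k₂ a b))]
  rw [dot_eq]
  unfold mkD toL
  congr 1
  induction upper n with
  | nil => rfl
  | cons x l ih => simp only [List.map_cons, List.zipWith_cons_cons, ih]

/-- Does the list of values `l` attain its minimum exactly at `r` and `s`? -/
def edgeD (m : ℕ) (L : List (List ℕ)) (r s D : List ℕ) : Bool :=
  let v := dot m r D
  (Nat.beq v (dot m s D)) &&
    L.all fun l => Nat.blt v (dot m l D) || (decide (l = r) || decide (l = s))

/-- The finite verification: each representative spans an edge with each other tree. -/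
def edges (m : ℕ) (L reps tables : List (List ℕ)) : Bool :=
  reps.all fun r => L.all fun s => decide (r = s) ||
    tables.any fun t => edgeD m L r s (mkD m t r s)

/-- Reading off an entry from the upper triangle. -/
def look {n : ℕ} (l : List ℕ) (a b : Fin n) : ℕ :=
  l.getD ((upper n).idxOf (if a < b then (a, b) else (b, a))) 0

lemma look_toL {n : ℕ} {k : Fin n → Fin n → ℕ} (hk : Good n k) {a b : Fin n} (hab : a ≠ b) :
    look (toL k) a b = k a b := by
  have key : ∀ a b, a < b → (toL k).getD ((upper n).idxOf (a, b)) 0 = k a b := by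
    intro a b h
    have hm := List.idxOf_lt_length_of_mem (mem_upper.mpr h)
    rw [List.getD_eq_getElem _ _ (by simpa [toL] using hm)]
    simp [toL]
  unfold look
  split_ifs with h
  · exact key a b h
  · rw [hk.symm]; exact key b a (lt_of_le_of_ne (not_lt.mp h) hab.symm)

def permL {n : ℕ} (z : Fin n) (s : List (Fin n)) (l : List ℕ) : List ℕ :=
  (upper n).map fun p => look l (s.getD p.1 z) (s.getD p.2 z)

def normal {n : ℕ} (z : Fin n) (L reps : List (List ℕ)) (perms : List (List (Fin n))) : Bool :=
  L.all fun l => perms.any fun s => decide (permL z s l ∈ reps)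

lemma exists_dissim {n : ℕ} (z : Fin n) (L reps tables : List (List ℕ))
    (perms : List (List (Fin n)))
    (hL : ∀ k : Fin n → Fin n → ℕ, Good n k → toL k ∈ L)
    (hperm : ∀ s ∈ perms, ∀ a b : Fin n, s.getD a z = s.getD b z → a = b)
    (hnormal : normal z L reps perms = true)
    (hedges : edges (n - 2) L reps tables = true)
    {k₁ k₂ : Fin n → Fin n → ℕ} (h₁ : Good n k₁) (h₂ : Good n k₂) (hne : toL k₁ ≠ toL k₂) :
    ∃ E : Fin n → Fin n → ℕ,
      (∑ p : LeafPairs n, 2 ^ (n - 2 - k₁ p.1.1 p.1.2) * E p.1.1 p.1.2) =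
        (∑ p : LeafPairs n, 2 ^ (n - 2 - k₂ p.1.1 p.1.2) * E p.1.1 p.1.2) ∧
      ∀ k, Good n k → toL k ≠ toL k₁ → toL k ≠ toL k₂ →
        (∑ p : LeafPairs n, 2 ^ (n - 2 - k₁ p.1.1 p.1.2) * E p.1.1 p.1.2) <
        (∑ p : LeafPairs n, 2 ^ (n - 2 - k p.1.1 p.1.2) * E p.1.1 p.1.2) := by
  obtain ⟨s, hs, hs'⟩ := List.any_eq_true.mp (List.all_eq_true.mp hnormal _ (hL k₁ h₁))
  have hs'' := of_decide_eq_true hs'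
  have hinj : Function.Injective (fun a : Fin n => s.getD a z) := fun a b h => hperm s hs a b h
  let σ : Equiv.Perm (Fin n) := Equiv.ofBijective _ (Finite.injective_iff_bijective.mp hinj)
  have hσ : ∀ a : Fin n, s.getD a z = σ a := fun a => rfl
  have hrep : toL (fun a b => k₁ (σ a) (σ b)) ∈ reps := by
    have : permL z s (toL k₁) = toL (fun a b => k₁ (σ a) (σ b)) := by
      unfold permL
      rw [toL]
      refine List.map_congr_left ?_
      rintro ⟨a, b⟩ hp
      rw [hσ, hσ]
      exact look_toL h₁ (fun e => (mem_upper.mp hp).ne (σ.injective e))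
    rwa [this] at hs''
  have hiff : ∀ k k', Good n k → Good n k' →
      (toL (fun a b => k (σ a) (σ b)) = toL (fun a b => k' (σ a) (σ b)) ↔ toL k = toL k') := by
    intro k k' hk hk'
    rw [toL_eq_iff hk hk', toL_eq_iff (hk.relabel σ) (hk'.relabel σ)]
    constructor
    · intro h a b hab
      simpa using h (σ.symm a) (σ.symm b) (fun e => hab (σ.symm.injective e))
    · intro h a b hab
      exact h _ _ (fun e => hab (σ.injective e))
  have he := List.all_eq_true.mp (List.all_eq_true.mp hedges _ hrep) _ (hL _ (h₂.relabel σ))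
  rw [Bool.or_eq_true, decide_eq_true_eq, hiff _ _ h₁ h₂] at he
  obtain ⟨t, -, ht⟩ := List.any_eq_true.mp (he.resolve_left hne)
  unfold edgeD at ht
  rw [Bool.and_eq_true, Nat.beq_eq, List.all_eq_true] at ht
  obtain ⟨heq, hlt⟩ := ht
  let E' : Fin n → Fin n → ℕ := fun a b =>
    entry (n - 2) t (k₁ (σ a) (σ b)) (k₂ (σ a) (σ b))
  have hE : ∀ a b, E' a b = E' b a := fun a b => by
    simp only [E']; rw [h₁.symm, h₂.symm]
  have hsum : ∀ k, Good n k →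
      (∑ p : LeafPairs n, 2 ^ (n - 2 - k p.1.1 p.1.2) * E' (σ.symm p.1.1) (σ.symm p.1.2)) =
      dot (n - 2) (toL (fun a b => k (σ a) (σ b)))
        (mkD (n - 2) t (toL (fun a b => k₁ (σ a) (σ b))) (toL (fun a b => k₂ (σ a) (σ b)))) := by
    intro k hk
    rw [dot_mkD]
    rw [← sum_pairs_perm (fun a b => 2 ^ (n - 2 - k a b) * E' (σ.symm a) (σ.symm b))
      (fun a b => by rw [hk.symm, hE]) σ]
    simp [E']
  refine ⟨fun a b => E' (σ.symm a) (σ.symm b), ?_, ?_⟩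
  · rw [hsum k₁ h₁, hsum k₂ h₂, heq]
  · intro k hk hk1 hk2
    rw [hsum k₁ h₁, hsum k hk]
    have := hlt _ (hL _ (hk.relabel σ))
    rw [Bool.or_eq_true, Bool.or_eq_true, Nat.blt_eq, decide_eq_true_eq, decide_eq_true_eq,
      hiff _ _ hk h₁, hiff _ _ hk h₂] at this
    exact this.resolve_right (not_or.mpr ⟨hk1, hk2⟩)

lemma bmeVec_eq {n : ℕ} (T : PhyloTree n) (hT : T.IsBinary) (hn : 2 ≤ n) (p : LeafPairs n) :
    T.bmeVec p = ((2 ^ (n - 2 - kf T p.1.1 p.1.2) : ℕ) : ℝ) / 2 ^ (n - 2) := by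
  have hne := p.2.ne
  unfold PhyloTree.bmeVec
  rw [lam_eq_s8 T hT hne, Nat.cast_pow, Nat.cast_ofNat, pow_sub₀ _ two_ne_zero (kf_le T hT hn hne)]
  field_simp
  simp

lemma main {n : ℕ} (hn : 3 ≤ n) (z : Fin n) (L reps tables : List (List ℕ))
    (perms : List (List (Fin n)))
    (hL : ∀ k : Fin n → Fin n → ℕ, Good n k → toL k ∈ L)
    (hperm : ∀ s ∈ perms, ∀ a b : Fin n, s.getD a z = s.getD b z → a = b)
    (hnormal : normal z L reps perms = true)
    (hedges : edges (n - 2) L reps tables = true)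
    (T₁ T₂ : PhyloTree n) (h₁ : T₁.IsBinary) (h₂ : T₂.IsBinary)
    (hne : T₁.bmeVec ≠ T₂.bmeVec) :
    ∃ D : LeafPairs n → ℝ,
      (∑ p, T₁.bmeVec p * D p) = (∑ p, T₂.bmeVec p * D p) ∧
      ∀ T : PhyloTree n, T.IsBinary → T.bmeVec ≠ T₁.bmeVec → T.bmeVec ≠ T₂.bmeVec →
        (∑ p, T₁.bmeVec p * D p) < (∑ p, T.bmeVec p * D p) := by
  have hvec : ∀ T T' : PhyloTree n, T.IsBinary → T'.IsBinary → T.bmeVec ≠ T'.bmeVec →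
      toL (kf T) ≠ toL (kf T') := by
    intro T T' hT hT' h e
    apply h
    rw [toL_eq_iff (good_kf T hT hn) (good_kf T' hT' hn)] at e
    funext p
    rw [bmeVec_eq T hT (by omega), bmeVec_eq T' hT' (by omega), e _ _ p.2.ne]
  obtain ⟨E, hE1, hE2⟩ := exists_dissim z L reps tables perms hL hperm hnormal hedges
    (good_kf T₁ h₁ hn) (good_kf T₂ h₂ hn) (hvec T₁ T₂ h₁ h₂ hne)
  have hsum : ∀ T : PhyloTree n, T.IsBinary →
      ∑ p, T.bmeVec p * (E p.1.1 p.1.2 : ℝ) =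
      ((∑ p : LeafPairs n, 2 ^ (n - 2 - kf T p.1.1 p.1.2) * E p.1.1 p.1.2 : ℕ) : ℝ) /
        2 ^ (n - 2) := by
    intro T hT
    rw [Nat.cast_sum, Finset.sum_div]
    refine Finset.sum_congr rfl fun p _ => ?_
    rw [bmeVec_eq T hT (by omega), Nat.cast_mul]
    ring
  refine ⟨fun p => (E p.1.1 p.1.2 : ℝ), ?_, ?_⟩
  · rw [hsum T₁ h₁, hsum T₂ h₂, hE1]
  · intro T hT hT1 hT2
    rw [hsum T₁ h₁, hsum T hT]
    apply div_lt_div_of_pos_right _ (by positivity)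
    exact_mod_cast hE2 _ (good_kf T hT hn) (hvec T T₁ hT h₁ hT1) (hvec T T₂ hT h₂ hT2)

/-! ### Finite data -/

/-- Path data of all binary trees on 4 leaves (upper triangle, row by row). -/
def trees4 : List (List ℕ) := [
  [1, 2, 2, 2, 2, 1], [2, 1, 2, 2, 1, 2], [2, 2, 1, 1, 2, 2]]

/-- Representatives up to relabelling. -/
def reps4 : List (List ℕ) := trees4

/-- Relabellings used to normalise a tree. -/
def perms4 : List (List (Fin 4)) := [
  [0, 1, 2, 3]]

/-- Tables giving the dissimilarity of a pair of leaves from its two path lengths. -/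
def tables4 : List (List ℕ) := [
  [1, 0, 0, 2]]

/-- Exhaustive search for path data on 4 leaves. -/
def search4 : Bool :=
  [1, 2].all fun x01 =>
  [1, 2].all fun x02 =>
  [1, 2].all fun x03 =>
  imp (decide (2 ^ (2 - x01) + 2 ^ (2 - x02) + 2 ^ (2 - x03) = 4)) <|
  [1, 2].all fun x12 =>
  imp (decide ((x01 + x02 + x12) % 2 = 1)) <|
  [1, 2].all fun x13 =>
  imp (decide ((x01 + x03 + x13) % 2 = 1)) <|
  imp (decide (2 ^ (2 - x01) + 2 ^ (2 - x12) + 2 ^ (2 - x13) = 4)) <|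
  [1, 2].all fun x23 =>
  imp (decide ((x02 + x03 + x23) % 2 = 1)) <|
  imp (decide (2 ^ (2 - x02) + 2 ^ (2 - x12) + 2 ^ (2 - x23) = 4)) <|
  imp (decide (2 ^ (2 - x03) + 2 ^ (2 - x13) + 2 ^ (2 - x23) = 4)) <|
  imp (decide (1 ∈ [x01, x02, x03, x12, x13, x23])) <|
  decide ([x01, x02, x03, x12, x13, x23] ∈ trees4)

set_option maxHeartbeats 1000000 in
lemma mem_trees4 (k : Fin 4 → Fin 4 → ℕ) (hk : Good 4 k) : toL k ∈ trees4 := by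
  have h : search4 = true := by decide +kernel
  have hr : ∀ a b, a ≠ b → k a b ∈ [1, 2] := by
    intro a b hab
    have h1 := hk.pos a b hab
    have h2 := hk.le a b hab
    simp only [List.mem_cons, List.not_mem_nil]
    omega
  have K0 : 2 ^ (2 - k 0 1) + 2 ^ (2 - k 0 2) + 2 ^ (2 - k 0 3) = 4 := by
    have := hk.kraft 0
    simp [Fin.sum_univ_succ] at this
    omega
  have K1 : 2 ^ (2 - k 0 1) + 2 ^ (2 - k 1 2) + 2 ^ (2 - k 1 3) = 4 := by
    have := hk.kraft 1
    simp [Fin.sum_univ_succ] at this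
    rw [hk.symm 1 0] at this
    omega
  have K2 : 2 ^ (2 - k 0 2) + 2 ^ (2 - k 1 2) + 2 ^ (2 - k 2 3) = 4 := by
    have := hk.kraft 2
    simp [Fin.sum_univ_succ] at this
    rw [hk.symm 2 0, hk.symm 2 1] at this
    omega
  have K3 : 2 ^ (2 - k 0 3) + 2 ^ (2 - k 1 3) + 2 ^ (2 - k 2 3) = 4 := by
    have := hk.kraft 3
    simp [Fin.sum_univ_succ] at this
    rw [hk.symm 3 0, hk.symm 3 1, hk.symm 3 2] at this
    omega
  replace h := all_elim h (hr 0 1 (by decide))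
  replace h := all_elim h (hr 0 2 (by decide))
  replace h := all_elim h (hr 0 3 (by decide))
  replace h := imp_elim h K0
  replace h := all_elim h (hr 1 2 (by decide))
  replace h := imp_elim h (hk.par 0 1 2 (by decide) (by decide) (by decide))
  replace h := all_elim h (hr 1 3 (by decide))
  replace h := imp_elim h (hk.par 0 1 3 (by decide) (by decide) (by decide))
  replace h := imp_elim h K1
  replace h := all_elim h (hr 2 3 (by decide))
  replace h := imp_elim h (hk.par 0 2 3 (by decide) (by decide) (by decide))
  replace h := imp_elim h K2
  replace h := imp_elim h K3
  replace h := imp_elim h (mem_one hk)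
  exact of_decide_eq_true h

/-- Path data of all binary trees on 5 leaves (upper triangle, row by row). -/
def trees5 : List (List ℕ) := [
  [1, 2, 3, 3, 2, 3, 3, 2, 2, 1], [1, 3, 2, 3, 3, 2, 3, 2, 1, 2], [1, 3, 3, 2, 3, 3, 2, 1, 2, 2],
  [2, 1, 3, 3, 2, 2, 2, 3, 3, 1], [2, 2, 2, 2, 1, 3, 3, 3, 3, 1], [2, 2, 2, 2, 3, 1, 3, 3, 1, 3],
  [2, 2, 2, 2, 3, 3, 1, 1, 3, 3], [2, 3, 1, 3, 2, 2, 2, 3, 1, 3], [2, 3, 3, 1, 2, 2, 2, 1, 3, 3],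
  [3, 1, 2, 3, 3, 2, 1, 2, 3, 2], [3, 1, 3, 2, 3, 1, 2, 3, 2, 2], [3, 2, 1, 3, 2, 3, 1, 2, 2, 3],
  [3, 2, 3, 1, 2, 1, 3, 2, 2, 3], [3, 3, 1, 2, 1, 3, 2, 3, 2, 2], [3, 3, 2, 1, 1, 2, 3, 2, 3, 2]]

/-- Representatives up to relabelling. -/
def reps5 : List (List ℕ) := trees5

/-- Relabellings used to normalise a tree. -/
def perms5 : List (List (Fin 5)) := [
  [0, 1, 2, 3, 4]]

/-- Tables giving the dissimilarity of a pair of leaves from its two path lengths. -/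
def tables5 : List (List ℕ) := [
  [3, 0, 4, 2, 5, 5, 4, 3, 6],
  [12, 10, 0, 11, 13, 12, 0, 11, 19],
  [1, 1, 0, 1, 1, 1, 0, 1, 2]]

/-- Exhaustive search for path data on 5 leaves. -/
def search5 : Bool :=
  [1, 2, 3].all fun x01 =>
  [1, 2, 3].all fun x02 =>
  [1, 2, 3].all fun x03 =>
  [1, 2, 3].all fun x04 =>
  imp (decide (2 ^ (3 - x01) + 2 ^ (3 - x02) + 2 ^ (3 - x03) + 2 ^ (3 - x04) = 8)) <|
  [1, 2, 3].all fun x12 =>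
  imp (decide ((x01 + x02 + x12) % 2 = 1)) <|
  [1, 2, 3].all fun x13 =>
  imp (decide ((x01 + x03 + x13) % 2 = 1)) <|
  [1, 2, 3].all fun x14 =>
  imp (decide ((x01 + x04 + x14) % 2 = 1)) <|
  imp (decide (2 ^ (3 - x01) + 2 ^ (3 - x12) + 2 ^ (3 - x13) + 2 ^ (3 - x14) = 8)) <|
  [1, 2, 3].all fun x23 =>
  imp (decide ((x02 + x03 + x23) % 2 = 1)) <|
  [1, 2, 3].all fun x24 =>
  imp (decide ((x02 + x04 + x24) % 2 = 1)) <|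
  imp (decide (2 ^ (3 - x02) + 2 ^ (3 - x12) + 2 ^ (3 - x23) + 2 ^ (3 - x24) = 8)) <|
  [1, 2, 3].all fun x34 =>
  imp (decide ((x03 + x04 + x34) % 2 = 1)) <|
  imp (decide (2 ^ (3 - x03) + 2 ^ (3 - x13) + 2 ^ (3 - x23) + 2 ^ (3 - x34) = 8)) <|
  imp (decide (2 ^ (3 - x04) + 2 ^ (3 - x14) + 2 ^ (3 - x24) + 2 ^ (3 - x34) = 8)) <|
  imp (decide (1 ∈ [x01, x02, x03, x04, x12, x13, x14, x23, x24, x34])) <|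
  decide ([x01, x02, x03, x04, x12, x13, x14, x23, x24, x34] ∈ trees5)

set_option maxHeartbeats 1000000 in
lemma mem_trees5 (k : Fin 5 → Fin 5 → ℕ) (hk : Good 5 k) : toL k ∈ trees5 := by
  have h : search5 = true := by decide +kernel
  have hr : ∀ a b, a ≠ b → k a b ∈ [1, 2, 3] := by
    intro a b hab
    have h1 := hk.pos a b hab
    have h2 := hk.le a b hab
    simp only [List.mem_cons, List.not_mem_nil]
    omega
  have K0 : 2 ^ (3 - k 0 1) + 2 ^ (3 - k 0 2) + 2 ^ (3 - k 0 3) + 2 ^ (3 - k 0 4) = 8 := by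
    have := hk.kraft 0
    simp [Fin.sum_univ_succ] at this
    omega
  have K1 : 2 ^ (3 - k 0 1) + 2 ^ (3 - k 1 2) + 2 ^ (3 - k 1 3) + 2 ^ (3 - k 1 4) = 8 := by
    have := hk.kraft 1
    simp [Fin.sum_univ_succ] at this
    rw [hk.symm 1 0] at this
    omega
  have K2 : 2 ^ (3 - k 0 2) + 2 ^ (3 - k 1 2) + 2 ^ (3 - k 2 3) + 2 ^ (3 - k 2 4) = 8 := by
    have := hk.kraft 2
    simp [Fin.sum_univ_succ] at this
    rw [hk.symm 2 0, hk.symm 2 1] at this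
    omega
  have K3 : 2 ^ (3 - k 0 3) + 2 ^ (3 - k 1 3) + 2 ^ (3 - k 2 3) + 2 ^ (3 - k 3 4) = 8 := by
    have := hk.kraft 3
    simp [Fin.sum_univ_succ] at this
    rw [hk.symm 3 0, hk.symm 3 1, hk.symm 3 2] at this
    omega
  have K4 : 2 ^ (3 - k 0 4) + 2 ^ (3 - k 1 4) + 2 ^ (3 - k 2 4) + 2 ^ (3 - k 3 4) = 8 := by
    have := hk.kraft 4
    simp [Fin.sum_univ_succ] at this
    rw [hk.symm 4 0, hk.symm 4 1, hk.symm 4 2, hk.symm 4 3] at this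
    omega
  replace h := all_elim h (hr 0 1 (by decide))
  replace h := all_elim h (hr 0 2 (by decide))
  replace h := all_elim h (hr 0 3 (by decide))
  replace h := all_elim h (hr 0 4 (by decide))
  replace h := imp_elim h K0
  replace h := all_elim h (hr 1 2 (by decide))
  replace h := imp_elim h (hk.par 0 1 2 (by decide) (by decide) (by decide))
  replace h := all_elim h (hr 1 3 (by decide))
  replace h := imp_elim h (hk.par 0 1 3 (by decide) (by decide) (by decide))
  replace h := all_elim h (hr 1 4 (by decide))
  replace h := imp_elim h (hk.par 0 1 4 (by decide) (by decide) (by decide))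
  replace h := imp_elim h K1
  replace h := all_elim h (hr 2 3 (by decide))
  replace h := imp_elim h (hk.par 0 2 3 (by decide) (by decide) (by decide))
  replace h := all_elim h (hr 2 4 (by decide))
  replace h := imp_elim h (hk.par 0 2 4 (by decide) (by decide) (by decide))
  replace h := imp_elim h K2
  replace h := all_elim h (hr 3 4 (by decide))
  replace h := imp_elim h (hk.par 0 3 4 (by decide) (by decide) (by decide))
  replace h := imp_elim h K3
  replace h := imp_elim h K4
  replace h := imp_elim h (mem_one hk)
  exact of_decide_eq_true h

/-- Path data of all binary trees on 6 leaves (upper triangle, row by row). -/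
def trees6 : List (List ℕ) := [
  [1, 2, 3, 4, 4, 2, 3, 4, 4, 2, 3, 3, 2, 2, 1], [1, 2, 4, 3, 4, 2, 4, 3, 4, 3, 2, 3, 2, 1, 2],
  [1, 2, 4, 4, 3, 2, 4, 4, 3, 3, 3, 2, 1, 2, 2], [1, 3, 2, 4, 4, 3, 2, 4, 4, 2, 2, 2, 3, 3, 1],
  [1, 3, 3, 3, 3, 3, 3, 3, 3, 1, 3, 3, 3, 3, 1], [1, 3, 3, 3, 3, 3, 3, 3, 3, 3, 1, 3, 3, 1, 3],
  [1, 3, 3, 3, 3, 3, 3, 3, 3, 3, 3, 1, 1, 3, 3], [1, 3, 4, 2, 4, 3, 4, 2, 4, 2, 2, 2, 3, 1, 3],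
  [1, 3, 4, 4, 2, 3, 4, 4, 2, 2, 2, 2, 1, 3, 3], [1, 4, 2, 3, 4, 4, 2, 3, 4, 3, 2, 1, 2, 3, 2],
  [1, 4, 2, 4, 3, 4, 2, 4, 3, 3, 1, 2, 3, 2, 2], [1, 4, 3, 2, 4, 4, 3, 2, 4, 2, 3, 1, 2, 2, 3],
  [1, 4, 3, 4, 2, 4, 3, 4, 2, 2, 1, 3, 2, 2, 3], [1, 4, 4, 2, 3, 4, 4, 2, 3, 1, 3, 2, 3, 2, 2],
  [1, 4, 4, 3, 2, 4, 4, 3, 2, 1, 2, 3, 2, 3, 2], [2, 1, 3, 4, 4, 2, 2, 3, 3, 3, 4, 4, 2, 2, 1],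
  [2, 1, 4, 3, 4, 2, 3, 2, 3, 4, 3, 4, 2, 1, 2], [2, 1, 4, 4, 3, 2, 3, 3, 2, 4, 4, 3, 1, 2, 2],
  [2, 2, 2, 3, 3, 1, 3, 4, 4, 3, 4, 4, 2, 2, 1], [2, 2, 2, 3, 3, 3, 1, 4, 4, 3, 2, 2, 4, 4, 1],
  [2, 2, 2, 3, 3, 3, 3, 2, 2, 1, 4, 4, 4, 4, 1], [2, 2, 3, 2, 3, 1, 4, 3, 4, 4, 3, 4, 2, 1, 2],
  [2, 2, 3, 2, 3, 3, 2, 3, 2, 4, 1, 4, 4, 1, 4], [2, 2, 3, 2, 3, 3, 4, 1, 4, 2, 3, 2, 4, 1, 4],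
  [2, 2, 3, 3, 2, 1, 4, 4, 3, 4, 4, 3, 1, 2, 2], [2, 2, 3, 3, 2, 3, 2, 2, 3, 4, 4, 1, 1, 4, 4],
  [2, 2, 3, 3, 2, 3, 4, 4, 1, 2, 2, 3, 1, 4, 4], [2, 3, 1, 4, 4, 2, 2, 3, 3, 3, 2, 2, 4, 4, 1],
  [2, 3, 2, 2, 3, 2, 3, 3, 2, 4, 4, 1, 1, 4, 4], [2, 3, 2, 2, 3, 4, 1, 3, 4, 4, 2, 1, 3, 4, 2],
  [2, 3, 2, 2, 3, 4, 3, 1, 4, 2, 4, 1, 3, 2, 4], [2, 3, 2, 3, 2, 2, 3, 2, 3, 4, 1, 4, 4, 1, 4],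
  [2, 3, 2, 3, 2, 4, 1, 4, 3, 4, 1, 2, 4, 3, 2], [2, 3, 2, 3, 2, 4, 3, 4, 1, 2, 1, 4, 2, 3, 4],
  [2, 3, 3, 2, 2, 2, 2, 3, 3, 1, 4, 4, 4, 4, 1], [2, 3, 3, 2, 2, 4, 4, 1, 3, 1, 4, 2, 4, 2, 3],
  [2, 3, 3, 2, 2, 4, 4, 3, 1, 1, 2, 4, 2, 4, 3], [2, 3, 4, 1, 4, 2, 3, 2, 3, 2, 3, 2, 4, 1, 4],
  [2, 3, 4, 4, 1, 2, 3, 3, 2, 2, 2, 3, 1, 4, 4], [2, 4, 1, 3, 4, 3, 2, 2, 3, 4, 2, 1, 3, 4, 2],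
  [2, 4, 1, 4, 3, 3, 2, 3, 2, 4, 1, 2, 4, 3, 2], [2, 4, 3, 1, 4, 3, 2, 2, 3, 2, 4, 1, 3, 2, 4],
  [2, 4, 3, 4, 1, 3, 2, 3, 2, 2, 1, 4, 2, 3, 4], [2, 4, 4, 1, 3, 3, 3, 2, 2, 1, 4, 2, 4, 2, 3],
  [2, 4, 4, 3, 1, 3, 3, 2, 2, 1, 2, 4, 2, 4, 3], [3, 1, 2, 4, 4, 3, 2, 2, 2, 2, 4, 4, 3, 3, 1],
  [3, 1, 3, 3, 3, 3, 1, 3, 3, 3, 3, 3, 3, 3, 1], [3, 1, 3, 3, 3, 3, 3, 1, 3, 3, 3, 3, 3, 1, 3],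
  [3, 1, 3, 3, 3, 3, 3, 3, 1, 3, 3, 3, 1, 3, 3], [3, 1, 4, 2, 4, 3, 2, 2, 2, 4, 2, 4, 3, 1, 3],
  [3, 1, 4, 4, 2, 3, 2, 2, 2, 4, 4, 2, 1, 3, 3], [3, 2, 1, 4, 4, 2, 3, 2, 2, 2, 3, 3, 4, 4, 1],
  [3, 2, 2, 2, 3, 2, 4, 4, 1, 3, 3, 2, 1, 4, 4], [3, 2, 2, 2, 3, 4, 2, 4, 1, 3, 1, 4, 3, 2, 4],
  [3, 2, 2, 2, 3, 4, 4, 2, 1, 1, 3, 4, 3, 4, 2], [3, 2, 2, 3, 2, 2, 4, 1, 4, 3, 2, 3, 4, 1, 4],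
  [3, 2, 2, 3, 2, 4, 2, 1, 4, 3, 4, 1, 2, 3, 4], [3, 2, 2, 3, 2, 4, 4, 1, 2, 1, 4, 3, 4, 3, 2],
  [3, 2, 3, 2, 2, 2, 1, 4, 4, 2, 3, 3, 4, 4, 1], [3, 2, 3, 2, 2, 4, 1, 2, 4, 4, 3, 1, 2, 4, 3],
  [3, 2, 3, 2, 2, 4, 1, 4, 2, 4, 1, 3, 4, 2, 3], [3, 2, 4, 1, 4, 2, 2, 3, 2, 3, 2, 3, 4, 1, 4],
  [3, 2, 4, 4, 1, 2, 2, 2, 3, 3, 3, 2, 1, 4, 4], [3, 3, 1, 3, 3, 1, 3, 3, 3, 3, 3, 3, 3, 3, 1],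
  [3, 3, 1, 3, 3, 3, 3, 1, 3, 3, 3, 1, 3, 3, 3], [3, 3, 1, 3, 3, 3, 3, 3, 1, 3, 1, 3, 3, 3, 3],
  [3, 3, 2, 2, 2, 1, 2, 4, 4, 2, 4, 4, 3, 3, 1], [3, 3, 2, 2, 2, 1, 4, 2, 4, 4, 2, 4, 3, 1, 3],
  [3, 3, 2, 2, 2, 1, 4, 4, 2, 4, 4, 2, 1, 3, 3], [3, 3, 3, 1, 3, 1, 3, 3, 3, 3, 3, 3, 3, 1, 3],
  [3, 3, 3, 1, 3, 3, 1, 3, 3, 3, 3, 1, 3, 3, 3], [3, 3, 3, 1, 3, 3, 3, 3, 1, 1, 3, 3, 3, 3, 3],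
  [3, 3, 3, 3, 1, 1, 3, 3, 3, 3, 3, 3, 1, 3, 3], [3, 3, 3, 3, 1, 3, 1, 3, 3, 3, 1, 3, 3, 3, 3],
  [3, 3, 3, 3, 1, 3, 3, 1, 3, 1, 3, 3, 3, 3, 3], [3, 4, 1, 2, 4, 2, 3, 2, 2, 4, 3, 1, 2, 4, 3],
  [3, 4, 1, 4, 2, 2, 3, 2, 2, 4, 1, 3, 4, 2, 3], [3, 4, 2, 1, 4, 2, 2, 3, 2, 3, 4, 1, 2, 3, 4],
  [3, 4, 2, 4, 1, 2, 2, 2, 3, 3, 1, 4, 3, 2, 4], [3, 4, 4, 1, 2, 2, 2, 3, 2, 1, 4, 3, 4, 3, 2],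
  [3, 4, 4, 2, 1, 2, 2, 2, 3, 1, 3, 4, 3, 4, 2], [4, 1, 2, 3, 4, 4, 3, 2, 1, 2, 3, 4, 2, 3, 2],
  [4, 1, 2, 4, 3, 4, 3, 1, 2, 2, 4, 3, 3, 2, 2], [4, 1, 3, 2, 4, 4, 2, 3, 1, 3, 2, 4, 2, 2, 3],
  [4, 1, 3, 4, 2, 4, 2, 1, 3, 3, 4, 2, 2, 2, 3], [4, 1, 4, 2, 3, 4, 1, 3, 2, 4, 2, 3, 3, 2, 2],
  [4, 1, 4, 3, 2, 4, 1, 2, 3, 4, 3, 2, 2, 3, 2], [4, 2, 1, 3, 4, 3, 4, 2, 1, 2, 2, 3, 3, 4, 2],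
  [4, 2, 1, 4, 3, 3, 4, 1, 2, 2, 3, 2, 4, 3, 2], [4, 2, 3, 1, 4, 3, 2, 4, 1, 2, 2, 3, 3, 2, 4],
  [4, 2, 3, 4, 1, 3, 2, 1, 4, 2, 3, 2, 2, 3, 4], [4, 2, 4, 1, 3, 3, 1, 4, 2, 3, 2, 2, 4, 2, 3],
  [4, 2, 4, 3, 1, 3, 1, 2, 4, 3, 2, 2, 2, 4, 3], [4, 3, 1, 2, 4, 2, 4, 3, 1, 3, 2, 2, 2, 4, 3],
  [4, 3, 1, 4, 2, 2, 4, 1, 3, 3, 2, 2, 4, 2, 3], [4, 3, 2, 1, 4, 2, 3, 4, 1, 2, 3, 2, 2, 3, 4],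
  [4, 3, 2, 4, 1, 2, 3, 1, 4, 2, 2, 3, 3, 2, 4], [4, 3, 4, 1, 2, 2, 1, 4, 3, 2, 3, 2, 4, 3, 2],
  [4, 3, 4, 2, 1, 2, 1, 3, 4, 2, 2, 3, 3, 4, 2], [4, 4, 1, 2, 3, 1, 4, 3, 2, 4, 3, 2, 2, 3, 2],
  [4, 4, 1, 3, 2, 1, 4, 2, 3, 4, 2, 3, 3, 2, 2], [4, 4, 2, 1, 3, 1, 3, 4, 2, 3, 4, 2, 2, 2, 3],
  [4, 4, 2, 3, 1, 1, 3, 2, 4, 3, 2, 4, 2, 2, 3], [4, 4, 3, 1, 2, 1, 2, 4, 3, 2, 4, 3, 3, 2, 2],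
  [4, 4, 3, 2, 1, 1, 2, 3, 4, 2, 3, 4, 2, 3, 2]]

/-- Representatives up to relabelling. -/
def reps6 : List (List ℕ) := [
  [1, 2, 3, 4, 4, 2, 3, 4, 4, 2, 3, 3, 2, 2, 1],
  [1, 3, 3, 3, 3, 3, 3, 3, 3, 1, 3, 3, 3, 3, 1]]

/-- Relabellings used to normalise a tree. -/
def perms6 : List (List (Fin 6)) := [
  [0, 1, 2, 3, 4, 5], [0, 1, 2, 4, 3, 5], [0, 1, 2, 5, 3, 4], [0, 1, 3, 2, 4, 5],
  [0, 1, 3, 4, 2, 5], [0, 1, 3, 5, 2, 4], [0, 1, 4, 2, 3, 5], [0, 1, 4, 3, 2, 5],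
  [0, 1, 4, 5, 2, 3], [0, 1, 5, 2, 3, 4], [0, 1, 5, 3, 2, 4], [0, 1, 5, 4, 2, 3],
  [0, 2, 1, 3, 4, 5], [0, 2, 1, 4, 3, 5], [0, 2, 1, 5, 3, 4], [0, 2, 3, 1, 4, 5],
  [0, 2, 3, 4, 1, 5], [0, 2, 3, 5, 1, 4], [0, 2, 4, 1, 3, 5], [0, 2, 4, 3, 1, 5],
  [0, 2, 4, 5, 1, 3], [0, 2, 5, 1, 3, 4], [0, 2, 5, 3, 1, 4], [0, 2, 5, 4, 1, 3],
  [0, 3, 1, 2, 4, 5], [0, 3, 1, 4, 2, 5], [0, 3, 1, 5, 2, 4], [0, 3, 2, 1, 4, 5],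
  [0, 3, 2, 4, 1, 5], [0, 3, 2, 5, 1, 4], [0, 3, 4, 1, 2, 5], [0, 3, 4, 2, 1, 5],
  [0, 3, 4, 5, 1, 2], [0, 3, 5, 1, 2, 4], [0, 3, 5, 2, 1, 4], [0, 3, 5, 4, 1, 2],
  [0, 4, 1, 2, 3, 5], [0, 4, 1, 3, 2, 5], [0, 4, 1, 5, 2, 3], [0, 4, 2, 1, 3, 5],
  [0, 4, 2, 3, 1, 5], [0, 4, 2, 5, 1, 3], [0, 4, 3, 1, 2, 5], [0, 4, 3, 2, 1, 5],
  [0, 4, 3, 5, 1, 2], [0, 4, 5, 1, 2, 3], [0, 4, 5, 2, 1, 3], [0, 4, 5, 3, 1, 2],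
  [0, 5, 1, 2, 3, 4], [0, 5, 1, 3, 2, 4], [0, 5, 1, 4, 2, 3], [0, 5, 2, 1, 3, 4],
  [0, 5, 2, 3, 1, 4], [0, 5, 2, 4, 1, 3], [0, 5, 3, 1, 2, 4], [0, 5, 3, 2, 1, 4],
  [0, 5, 3, 4, 1, 2], [0, 5, 4, 1, 2, 3], [0, 5, 4, 2, 1, 3], [0, 5, 4, 3, 1, 2],
  [1, 2, 0, 3, 4, 5], [1, 2, 0, 4, 3, 5], [1, 2, 0, 5, 3, 4], [1, 2, 3, 0, 4, 5],
  [1, 2, 4, 0, 3, 5], [1, 2, 5, 0, 3, 4], [1, 3, 0, 2, 4, 5], [1, 3, 0, 4, 2, 5],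
  [1, 3, 0, 5, 2, 4], [1, 3, 2, 0, 4, 5], [1, 3, 4, 0, 2, 5], [1, 3, 5, 0, 2, 4],
  [1, 4, 0, 2, 3, 5], [1, 4, 0, 3, 2, 5], [1, 4, 0, 5, 2, 3], [1, 4, 2, 0, 3, 5],
  [1, 4, 3, 0, 2, 5], [1, 4, 5, 0, 2, 3], [1, 5, 0, 2, 3, 4], [1, 5, 0, 3, 2, 4],
  [1, 5, 0, 4, 2, 3], [1, 5, 2, 0, 3, 4], [1, 5, 3, 0, 2, 4], [1, 5, 4, 0, 2, 3],
  [2, 3, 0, 1, 4, 5], [2, 3, 1, 0, 4, 5], [2, 4, 0, 1, 3, 5], [2, 4, 1, 0, 3, 5],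
  [2, 5, 0, 1, 3, 4], [2, 5, 1, 0, 3, 4]]

/-- Tables giving the dissimilarity of a pair of leaves from its two path lengths. -/
def tables6 : List (List ℕ) := [
  [23, 0, 27, 27, 18, 20, 35, 27, 27, 27, 31, 59, 27, 27, 31, 32],
  [0, 13, 13, 13, 13, 11, 17, 13, 13, 17, 13, 13, 13, 13, 13, 24],
  [14, 25, 25, 25, 0, 25, 18, 25, 25, 25, 32, 25, 25, 25, 36, 25],
  [54, 58, 0, 58, 34, 58, 79, 58, 42, 58, 78, 58, 58, 58, 61, 58],
  [59, 63, 0, 63, 27, 60, 71, 63, 63, 54, 63, 90, 63, 47, 63, 80],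
  [40, 15, 50, 50, 50, 48, 53, 24, 0, 52, 50, 50, 50, 50, 52, 77],
  [6, 10, 0, 10, 10, 8, 10, 11, 2, 10, 18, 10, 10, 9, 10, 16],
  [50, 0, 54, 54, 50, 49, 54, 50, 54, 42, 62, 90, 54, 22, 86, 54],
  [368, 110, 368, 368, 350, 368, 368, 672, 368, 368, 369, 488, 368, 0, 536, 368],
  [89, 0, 89, 45, 80, 90, 83, 123, 75, 67, 95, 197, 89, 39, 139, 89],
  [104, 39, 104, 48, 95, 104, 76, 96, 104, 92, 117, 112, 0, 112, 144, 117],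
  [212, 166, 212, 212, 212, 212, 160, 52, 0, 232, 212, 212, 212, 308, 292, 269],
  [128, 34, 128, 80, 128, 127, 128, 96, 116, 120, 127, 176, 0, 192, 160, 139],
  [112, 83, 44, 112, 99, 133, 104, 88, 112, 128, 112, 148, 0, 120, 256, 112],
  [48, 48, 13, 48, 24, 48, 42, 48, 48, 48, 51, 48, 0, 48, 72, 48],
  [90, 90, 0, 90, 54, 90, 108, 114, 90, 72, 90, 126, 90, 34, 90, 95],
  [192, 192, 92, 0, 78, 182, 204, 224, 192, 186, 203, 252, 24, 104, 348, 221],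
  [256, 256, 0, 208, 256, 248, 298, 256, 252, 241, 256, 388, 16, 232, 520, 268],
  [34, 34, 0, 34, 34, 14, 34, 34, 12, 34, 50, 34, 34, 18, 34, 61],
  [204, 204, 97, 204, 204, 204, 102, 204, 98, 204, 306, 204, 0, 204, 336, 204],
  [105, 105, 2, 105, 93, 105, 84, 105, 105, 105, 110, 105, 0, 105, 162, 105],
  [28, 28, 28, 3, 28, 7, 7, 28, 28, 0, 46, 28, 5, 28, 28, 55],
  [2, 0, 13, 13, 13, 13, 13, 13, 13, 12, 14, 24, 13, 13, 13, 13],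
  [12, 12, 4, 16, 16, 16, 16, 16, 0, 18, 23, 18, 16, 16, 16, 16],
  [4, 11, 0, 11, 11, 11, 11, 11, 0, 11, 29, 11, 11, 11, 11, 11],
  [248, 132, 248, 0, 248, 248, 248, 248, 162, 204, 269, 704, 248, 248, 248, 248],
  [39, 0, 39, 29, 39, 39, 39, 39, 30, 27, 51, 85, 39, 39, 39, 39],
  [1, 1, 0, 1, 1, 1, 1, 1, 0, 1, 2, 1, 1, 1, 1, 1],
  [77, 77, 0, 65, 77, 77, 77, 77, 66, 17, 84, 169, 77, 77, 77, 77]]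

/-- Exhaustive search for path data on 6 leaves. -/
def search6 : Bool :=
  [1, 2, 3, 4].all fun x01 =>
  [1, 2, 3, 4].all fun x02 =>
  [1, 2, 3, 4].all fun x03 =>
  [1, 2, 3, 4].all fun x04 =>
  [1, 2, 3, 4].all fun x05 =>
  imp (decide (2 ^ (4 - x01) + 2 ^ (4 - x02) + 2 ^ (4 - x03) + 2 ^ (4 - x04) + 2 ^ (4 - x05) = 16)) <|
  [1, 2, 3, 4].all fun x12 =>
  imp (decide ((x01 + x02 + x12) % 2 = 1)) <|
  [1, 2, 3, 4].all fun x13 =>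
  imp (decide ((x01 + x03 + x13) % 2 = 1)) <|
  [1, 2, 3, 4].all fun x14 =>
  imp (decide ((x01 + x04 + x14) % 2 = 1)) <|
  [1, 2, 3, 4].all fun x15 =>
  imp (decide ((x01 + x05 + x15) % 2 = 1)) <|
  imp (decide (2 ^ (4 - x01) + 2 ^ (4 - x12) + 2 ^ (4 - x13) + 2 ^ (4 - x14) + 2 ^ (4 - x15) = 16)) <|
  [1, 2, 3, 4].all fun x23 =>
  imp (decide ((x02 + x03 + x23) % 2 = 1)) <|
  [1, 2, 3, 4].all fun x24 =>
  imp (decide ((x02 + x04 + x24) % 2 = 1)) <|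
  [1, 2, 3, 4].all fun x25 =>
  imp (decide ((x02 + x05 + x25) % 2 = 1)) <|
  imp (decide (2 ^ (4 - x02) + 2 ^ (4 - x12) + 2 ^ (4 - x23) + 2 ^ (4 - x24) + 2 ^ (4 - x25) = 16)) <|
  [1, 2, 3, 4].all fun x34 =>
  imp (decide ((x03 + x04 + x34) % 2 = 1)) <|
  [1, 2, 3, 4].all fun x35 =>
  imp (decide ((x03 + x05 + x35) % 2 = 1)) <|
  imp (decide (2 ^ (4 - x03) + 2 ^ (4 - x13) + 2 ^ (4 - x23) + 2 ^ (4 - x34) + 2 ^ (4 - x35) = 16)) <|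
  [1, 2, 3, 4].all fun x45 =>
  imp (decide ((x04 + x05 + x45) % 2 = 1)) <|
  imp (decide (2 ^ (4 - x04) + 2 ^ (4 - x14) + 2 ^ (4 - x24) + 2 ^ (4 - x34) + 2 ^ (4 - x45) = 16)) <|
  imp (decide (2 ^ (4 - x05) + 2 ^ (4 - x15) + 2 ^ (4 - x25) + 2 ^ (4 - x35) + 2 ^ (4 - x45) = 16)) <|
  imp (decide (1 ∈ [x01, x02, x03, x04, x05, x12, x13, x14, x15, x23, x24, x25, x34, x35, x45])) <|
  decide ([x01, x02, x03, x04, x05, x12, x13, x14, x15, x23, x24, x25, x34, x35, x45] ∈ trees6)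

set_option maxHeartbeats 1000000 in
lemma mem_trees6 (k : Fin 6 → Fin 6 → ℕ) (hk : Good 6 k) : toL k ∈ trees6 := by
  have h : search6 = true := by decide +kernel
  have hr : ∀ a b, a ≠ b → k a b ∈ [1, 2, 3, 4] := by
    intro a b hab
    have h1 := hk.pos a b hab
    have h2 := hk.le a b hab
    simp only [List.mem_cons, List.not_mem_nil]
    omega
  have K0 : 2 ^ (4 - k 0 1) + 2 ^ (4 - k 0 2) + 2 ^ (4 - k 0 3) + 2 ^ (4 - k 0 4) + 2 ^ (4 - k 0 5) = 16 := by
    have := hk.kraft 0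
    simp [Fin.sum_univ_succ] at this
    omega
  have K1 : 2 ^ (4 - k 0 1) + 2 ^ (4 - k 1 2) + 2 ^ (4 - k 1 3) + 2 ^ (4 - k 1 4) + 2 ^ (4 - k 1 5) = 16 := by
    have := hk.kraft 1
    simp [Fin.sum_univ_succ] at this
    rw [hk.symm 1 0] at this
    omega
  have K2 : 2 ^ (4 - k 0 2) + 2 ^ (4 - k 1 2) + 2 ^ (4 - k 2 3) + 2 ^ (4 - k 2 4) + 2 ^ (4 - k 2 5) = 16 := by
    have := hk.kraft 2
    simp [Fin.sum_univ_succ] at this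
    rw [hk.symm 2 0, hk.symm 2 1] at this
    omega
  have K3 : 2 ^ (4 - k 0 3) + 2 ^ (4 - k 1 3) + 2 ^ (4 - k 2 3) + 2 ^ (4 - k 3 4) + 2 ^ (4 - k 3 5) = 16 := by
    have := hk.kraft 3
    simp [Fin.sum_univ_succ] at this
    rw [hk.symm 3 0, hk.symm 3 1, hk.symm 3 2] at this
    omega
  have K4 : 2 ^ (4 - k 0 4) + 2 ^ (4 - k 1 4) + 2 ^ (4 - k 2 4) + 2 ^ (4 - k 3 4) + 2 ^ (4 - k 4 5) = 16 := by
    have := hk.kraft 4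
    simp [Fin.sum_univ_succ] at this
    rw [hk.symm 4 0, hk.symm 4 1, hk.symm 4 2, hk.symm 4 3] at this
    omega
  have K5 : 2 ^ (4 - k 0 5) + 2 ^ (4 - k 1 5) + 2 ^ (4 - k 2 5) + 2 ^ (4 - k 3 5) + 2 ^ (4 - k 4 5) = 16 := by
    have := hk.kraft 5
    simp [Fin.sum_univ_succ] at this
    rw [hk.symm 5 0, hk.symm 5 1, hk.symm 5 2, hk.symm 5 3, hk.symm 5 4] at this
    omega
  replace h := all_elim h (hr 0 1 (by decide))
  replace h := all_elim h (hr 0 2 (by decide))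
  replace h := all_elim h (hr 0 3 (by decide))
  replace h := all_elim h (hr 0 4 (by decide))
  replace h := all_elim h (hr 0 5 (by decide))
  replace h := imp_elim h K0
  replace h := all_elim h (hr 1 2 (by decide))
  replace h := imp_elim h (hk.par 0 1 2 (by decide) (by decide) (by decide))
  replace h := all_elim h (hr 1 3 (by decide))
  replace h := imp_elim h (hk.par 0 1 3 (by decide) (by decide) (by decide))
  replace h := all_elim h (hr 1 4 (by decide))
  replace h := imp_elim h (hk.par 0 1 4 (by decide) (by decide) (by decide))
  replace h := all_elim h (hr 1 5 (by decide))
  replace h := imp_elim h (hk.par 0 1 5 (by decide) (by decide) (by decide))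
  replace h := imp_elim h K1
  replace h := all_elim h (hr 2 3 (by decide))
  replace h := imp_elim h (hk.par 0 2 3 (by decide) (by decide) (by decide))
  replace h := all_elim h (hr 2 4 (by decide))
  replace h := imp_elim h (hk.par 0 2 4 (by decide) (by decide) (by decide))
  replace h := all_elim h (hr 2 5 (by decide))
  replace h := imp_elim h (hk.par 0 2 5 (by decide) (by decide) (by decide))
  replace h := imp_elim h K2
  replace h := all_elim h (hr 3 4 (by decide))
  replace h := imp_elim h (hk.par 0 3 4 (by decide) (by decide) (by decide))
  replace h := all_elim h (hr 3 5 (by decide))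
  replace h := imp_elim h (hk.par 0 3 5 (by decide) (by decide) (by decide))
  replace h := imp_elim h K3
  replace h := all_elim h (hr 4 5 (by decide))
  replace h := imp_elim h (hk.par 0 4 5 (by decide) (by decide) (by decide))
  replace h := imp_elim h K4
  replace h := imp_elim h K5
  replace h := imp_elim h (mem_one hk)
  exact of_decide_eq_true h
lemma perms_inj4 : ∀ s ∈ perms4, ∀ a b : Fin 4, s.getD a 0 = s.getD b 0 → a = b := by
  decide +kernel

lemma normal4 : normal 0 trees4 reps4 perms4 = true := by decide +kernel

lemma edges4 : edges (4 - 2) trees4 reps4 tables4 = true := by decide +kernel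

lemma perms_inj5 : ∀ s ∈ perms5, ∀ a b : Fin 5, s.getD a 0 = s.getD b 0 → a = b := by
  decide +kernel

lemma normal5 : normal 0 trees5 reps5 perms5 = true := by decide +kernel

lemma edges5 : edges (5 - 2) trees5 reps5 tables5 = true := by decide +kernel

lemma perms_inj6 : ∀ s ∈ perms6, ∀ a b : Fin 6, s.getD a 0 = s.getD b 0 → a = b := by
  decide +kernel

lemma normal6 : normal 0 trees6 reps6 perms6 = true := by decide +kernel

lemma edges6 : edges (6 - 2) trees6 reps6 tables6 = true := by decide +kernel

end BME

/-- For `n ∈ {4,5,6}` the edge graph of the BME polytope is complete: for any two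
binary phylogenetic trees `T₁, T₂` on `{1,…,n}` with distinct BME vectors, there is a
dissimilarity map `D` for which `T₁` and `T₂` are the only co-optimal BME trees, i.e.
`v_{T₁}·D = v_{T₂}·D` and `v_{T₁}·D < v_T·D` for every binary tree `T` with
`v_T ∉ {v_{T₁}, v_{T₂}}`. -/
theorem bme_edge_graph_complete (n : ℕ) (hn : n = 4 ∨ n = 5 ∨ n = 6)
    (T₁ T₂ : PhyloTree n) (h₁ : T₁.IsBinary) (h₂ : T₂.IsBinary)
    (hne : T₁.bmeVec ≠ T₂.bmeVec) :
    ∃ D : LeafPairs n → ℝ,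
      (∑ p, T₁.bmeVec p * D p) = (∑ p, T₂.bmeVec p * D p) ∧
      ∀ T : PhyloTree n, T.IsBinary → T.bmeVec ≠ T₁.bmeVec → T.bmeVec ≠ T₂.bmeVec →
        (∑ p, T₁.bmeVec p * D p) < (∑ p, T.bmeVec p * D p) := by
  rcases hn with rfl | rfl | rfl
  · exact BME.main (by norm_num) 0 BME.trees4 BME.reps4 BME.tables4 BME.perms4 BME.mem_trees4
      BME.perms_inj4 BME.normal4 BME.edges4 T₁ T₂ h₁ h₂ hne
  · exact BME.main (by norm_num) 0 BME.trees5 BME.reps5 BME.tables5 BME.perms5 BME.mem_trees5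
      BME.perms_inj5 BME.normal5 BME.edges5 T₁ T₂ h₁ h₂ hne
  · exact BME.main (by norm_num) 0 BME.trees6 BME.reps6 BME.tables6 BME.perms6 BME.mem_trees6
      BME.perms_inj6 BME.normal6 BME.edges6 T₁ T₂ h₁ h₂ hne
end
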